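/- Let Ω ⊆ ℝⁿ be a C¹ domain, let a : [0,∞) → ℝ be C¹ with locally Lipschitz derivative, a(t) > 0 and (t·a(t))′ > 0 for all t ≥ 0, let f ∈ C¹(ℝ), and let u ∈ C³(Ω) be a non-constant weak solution of Δ_a u + f(u) = 0 in Ω. If Ω₀ ⊆ Ω is an open set with ∂Ω₀ ⊆ ∂Ω ∪ crit(u), then H^{n−1}(K ∩ ∂Ω₀) < ∞ for every compact set K ⊆ Ω, where H^{n−1} denotes (n−1)-dimensional Hausdorff measure on ℝⁿ. -/

import Mathlib

open MeasureTheory Set Metric Filter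
open scoped RealInnerProductSpace Topology ENNReal

noncomputable section

variable {n : ℕ}

/-- The quasilinear operator matrix `A(p)` applied to a vector `v`:
`A(p)v = a(|p|) v + (a'(|p|)/|p|) ⟨p,v⟩ p` (with the second term vanishing at `p = 0`). -/
def Aop (a : ℝ → ℝ) (p v : EuclideanSpace ℝ (Fin n)) : EuclideanSpace ℝ (Fin n) :=
  a ‖p‖ • v + ((deriv a ‖p‖ / ‖p‖) * ⟪p, v⟫) • p

/-- `λ₁(t) = a(t) + t·a'(t) = (t a(t))'`. -/
def lam1 (a : ℝ → ℝ) (t : ℝ) : ℝ := a t + t * deriv a t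

/-- `λ₂(t) = a(t)`. -/
def lam2 (a : ℝ → ℝ) (t : ℝ) : ℝ := a t

/-- `λmax(t) = max{λ₁(t), λ₂(t)}`. -/
def lamMax (a : ℝ → ℝ) (t : ℝ) : ℝ := max (lam1 a t) (lam2 a t)

/-- A Lipschitz test function with compact support contained in `Ω`. -/
def IsTestOn (Ω : Set (EuclideanSpace ℝ (Fin n))) (φ : EuclideanSpace ℝ (Fin n) → ℝ) : Prop :=
  (∃ K, LipschitzWith K φ) ∧ HasCompactSupport φ ∧ tsupport φ ⊆ Ω

/-- `u` is a weak solution of `div(a(|∇u|)∇u) + f(u) = 0` in `Ω`. -/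
def IsWeakSolution (a f : ℝ → ℝ) (Ω : Set (EuclideanSpace ℝ (Fin n)))
    (u : EuclideanSpace ℝ (Fin n) → ℝ) : Prop :=
  ∀ φ : EuclideanSpace ℝ (Fin n) → ℝ, IsTestOn Ω φ →
    ∫ x in Ω, a ‖gradient u x‖ * ⟪gradient u x, gradient φ x⟫
      = ∫ x in Ω, f (u x) * φ x

/-- The stability inequality for a solution `u`. -/
def IsStable (a f : ℝ → ℝ) (Ω : Set (EuclideanSpace ℝ (Fin n)))
    (u : EuclideanSpace ℝ (Fin n) → ℝ) : Prop :=
  ∀ φ : EuclideanSpace ℝ (Fin n) → ℝ, IsTestOn Ω φ →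
    ∫ x in Ω, deriv f (u x) * φ x ^ 2
      ≤ ∫ x in Ω, ⟪Aop a (gradient u x) (gradient φ x), gradient φ x⟫

/-- `u` has moderate energy growth in `Ω₀`. -/
def ModerateEnergyGrowth (a : ℝ → ℝ) (u : EuclideanSpace ℝ (Fin n) → ℝ)
    (Ω₀ : Set (EuclideanSpace ℝ (Fin n))) : Prop :=
  ∃ φ : ℕ → EuclideanSpace ℝ (Fin n) → ℝ,
    (∀ j, ∃ K, LipschitzWith K (φ j)) ∧
    (∀ j, HasCompactSupport (φ j)) ∧
    (∀ j x, 0 ≤ φ j x) ∧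
    (∀ K : Set (EuclideanSpace ℝ (Fin n)), IsCompact K → K ⊆ closure Ω₀ →
      TendstoUniformlyOn (fun j => φ j) (fun _ => (1 : ℝ)) atTop K) ∧
    Tendsto (fun j => ∫ x in Ω₀, ‖gradient u x‖ ^ 2 *
        ⟪Aop a (gradient u x) (gradient (φ j) x), gradient (φ j) x⟫)
      atTop (nhds 0)

/-- A `C^k` domain: nonempty, open, connected, with boundary locally given by a regular
`C^k` defining function. -/
def IsCkDomain (k : ℕ∞) (Ω : Set (EuclideanSpace ℝ (Fin n))) : Prop :=
  Ω.Nonempty ∧ IsOpen Ω ∧ IsConnected Ω ∧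
    ∀ p ∈ frontier Ω, ∃ V : Set (EuclideanSpace ℝ (Fin n)),
      ∃ g : EuclideanSpace ℝ (Fin n) → ℝ,
        IsOpen V ∧ p ∈ V ∧ ContDiffOn ℝ k g V ∧ (∀ x ∈ V, gradient g x ≠ 0) ∧
        Ω ∩ V = {x ∈ V | g x < 0}

/-- A `C^k` domain together with its interior unit normal field `η`. -/
def IsCkDomainWithNormal (k : ℕ∞) (Ω : Set (EuclideanSpace ℝ (Fin n)))
    (η : EuclideanSpace ℝ (Fin n) → EuclideanSpace ℝ (Fin n)) : Prop :=
  Ω.Nonempty ∧ IsOpen Ω ∧ IsConnected Ω ∧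
    ∀ p ∈ frontier Ω, ∃ V : Set (EuclideanSpace ℝ (Fin n)),
      ∃ g : EuclideanSpace ℝ (Fin n) → ℝ,
        IsOpen V ∧ p ∈ V ∧ ContDiffOn ℝ k g V ∧ (∀ x ∈ V, gradient g x ≠ 0) ∧
        Ω ∩ V = {x ∈ V | g x < 0} ∧
        η p = -(‖gradient g p‖⁻¹ • gradient g p)

/-- `a ∈ C^{1,1}_loc([0,∞))`: `C¹` on `[0,∞)` with locally Lipschitz derivative. -/
def C11Loc (a : ℝ → ℝ) : Prop :=
  ContDiffOn ℝ 1 a (Ici 0) ∧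
    ∀ t ∈ Ici (0 : ℝ), ∃ V ∈ 𝓝[Ici (0 : ℝ)] t, ∃ K, LipschitzOnWith K (deriv a) V


/-- The Euclidean space. -/
abbrev EE (n : ℕ) := EuclideanSpace ℝ (Fin n)

/-- standard basis vector -/
abbrev ee (j : Fin n) : EE n := EuclideanSpace.single j (1 : ℝ)

/-- partial derivative -/
def pd (j : Fin n) (g : EE n → ℝ) (x : EE n) : ℝ := fderiv ℝ g x (ee j)

/-- Laplacian -/
def lap (g : EE n → ℝ) (x : EE n) : ℝ := ∑ j, pd j (pd j g) x

/-- squared norm of the gradient -/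
def gr2 (u : EE n → ℝ) (x : EE n) : ℝ := ∑ i, (pd i u x) ^ 2

/-- squared norm of the Hessian -/
def hs2 (u : EE n → ℝ) (x : EE n) : ℝ := ∑ i, ∑ j, (pd j (pd i u) x) ^ 2

/-- the differential inequality for the gradient -/
def DI (u : EE n → ℝ) (K : ℝ) (x : EE n) : Prop :=
  ∑ i, (lap (pd i u) x) ^ 2 ≤ K ^ 2 * (gr2 u x + hs2 u x)

lemma gr2_nonneg (u : EE n → ℝ) (x : EE n) : 0 ≤ gr2 u x :=
  Finset.sum_nonneg fun _ _ => sq_nonneg _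

lemma hs2_nonneg (u : EE n → ℝ) (x : EE n) : 0 ≤ hs2 u x :=
  Finset.sum_nonneg fun _ _ => Finset.sum_nonneg fun _ _ => sq_nonneg _

lemma pd_sq_le_gr2 (u : EE n → ℝ) (x : EE n) (i : Fin n) : (pd i u x) ^ 2 ≤ gr2 u x :=
  Finset.single_le_sum (f := fun i => (pd i u x) ^ 2) (fun _ _ => sq_nonneg _) (Finset.mem_univ i)

lemma pd_sq_le_hs2 (u : EE n → ℝ) (x : EE n) (i j : Fin n) :
    (pd j (pd i u) x) ^ 2 ≤ hs2 u x :=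
  (pd_sq_le_gr2 (pd i u) x j).trans
    (Finset.single_le_sum (f := fun i => gr2 (pd i u) x) (fun _ _ => gr2_nonneg _ _)
      (Finset.mem_univ i))

lemma contDiff_pd {g : EE n → ℝ} {k m : WithTop ℕ∞} (hg : ContDiff ℝ k g) (h : m + 1 ≤ k)
    (j : Fin n) : ContDiff ℝ m (pd j g) :=
  (hg.fderiv_right h).clm_apply contDiff_const

lemma hasFDerivAt_pd_eq {g : EE n → ℝ} {L : EE n →L[ℝ] ℝ} {x : EE n} (h : HasFDerivAt g L x)
    (j : Fin n) : pd j g x = L (ee j) := by rw [pd, h.fderiv]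

lemma fderiv_apply_eq_sum (g : EE n → ℝ) (x v : EE n) :
    fderiv ℝ g x v = ∑ j, v j * pd j g x := by
  have : v = ∑ j, v j • ee j := by
    ext i
    simp [Finset.sum_apply, Pi.single_apply]
  conv_lhs => rw [this]
  simp [map_sum, pd]

lemma pd_comm {g : EE n → ℝ} (hg : ContDiff ℝ 2 g) (i j : Fin n) (x : EE n) :
    pd i (pd j g) x = pd j (pd i g) x := by
  have hs := (hg.contDiffAt (x := x)).isSymmSndFDerivAt (by simp)
  have hd : DifferentiableAt ℝ (fderiv ℝ g) x :=
    ((hg.fderiv_right (m := 1) (by norm_num)).differentiable (by norm_num)) x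
  have key : ∀ a b : Fin n, pd a (pd b g) x = fderiv ℝ (fderiv ℝ g) x (ee a) (ee b) := by
    intro a b
    have : HasFDerivAt (pd b g) _ x := hd.hasFDerivAt.clm_apply (hasFDerivAt_const (ee b) x)
    rw [hasFDerivAt_pd_eq this]
    simp
  rw [key, key]
  exact hs.eq _ _

lemma pd_add {f g : EE n → ℝ} {x : EE n} (hf : DifferentiableAt ℝ f x)
    (hg : DifferentiableAt ℝ g x) (j : Fin n) :
    pd j (fun y => f y + g y) x = pd j f x + pd j g x := by
  rw [hasFDerivAt_pd_eq (hf.hasFDerivAt.fun_add hg.hasFDerivAt)]; rfl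

lemma pd_sub {f g : EE n → ℝ} {x : EE n} (hf : DifferentiableAt ℝ f x)
    (hg : DifferentiableAt ℝ g x) (j : Fin n) :
    pd j (fun y => f y - g y) x = pd j f x - pd j g x := by
  rw [hasFDerivAt_pd_eq (hf.hasFDerivAt.fun_sub hg.hasFDerivAt)]; rfl

lemma pd_mul {f g : EE n → ℝ} {x : EE n} (hf : DifferentiableAt ℝ f x)
    (hg : DifferentiableAt ℝ g x) (j : Fin n) :
    pd j (fun y => f y * g y) x = f x * pd j g x + g x * pd j f x := by
  rw [hasFDerivAt_pd_eq (hf.hasFDerivAt.fun_mul hg.hasFDerivAt)]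
  simp [pd]

lemma pd_sum {ι : Type*} (s : Finset ι) {f : ι → EE n → ℝ} {x : EE n}
    (hf : ∀ i ∈ s, DifferentiableAt ℝ (f i) x) (j : Fin n) :
    pd j (fun y => ∑ i ∈ s, f i y) x = ∑ i ∈ s, pd j (f i) x := by
  have := HasFDerivAt.fun_sum (fun i hi => (hf i hi).hasFDerivAt)
  rw [hasFDerivAt_pd_eq this]
  simp [pd]

lemma pd_sq {f : EE n → ℝ} {x : EE n} (hf : DifferentiableAt ℝ f x) (j : Fin n) :
    pd j (fun y => (f y) ^ 2) x = 2 * f x * pd j f x := by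
  have : (fun y => (f y) ^ 2) = fun y => f y * f y := by ext; ring
  rw [this, pd_mul hf hf]; ring

lemma pd_const_mul {f : EE n → ℝ} {x : EE n} (c : ℝ) (hf : DifferentiableAt ℝ f x) (j : Fin n) :
    pd j (fun y => c * f y) x = c * pd j f x := by
  rw [hasFDerivAt_pd_eq (hf.hasFDerivAt.const_mul c)]; simp [pd]

lemma pd_const (c : ℝ) (x : EE n) (j : Fin n) : pd j (fun _ => c) x = 0 := by
  simp [pd]

lemma hasFDerivAt_coord (i : Fin n) (x : EE n) :
    HasFDerivAt (fun y : EE n => y i) (EuclideanSpace.proj i : EE n →L[ℝ] ℝ) x :=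
  (EuclideanSpace.proj i : EE n →L[ℝ] ℝ).hasFDerivAt

lemma contDiff_coord (i : Fin n) {k : WithTop ℕ∞} : ContDiff ℝ k (fun y : EE n => y i) :=
  (EuclideanSpace.proj i : EE n →L[ℝ] ℝ).contDiff

lemma pd_coord (i j : Fin n) (x : EE n) :
    pd j (fun y : EE n => y i) x = if i = j then 1 else 0 := by
  rw [hasFDerivAt_pd_eq (hasFDerivAt_coord i x)]
  simp

lemma pd_comp {φ : ℝ → ℝ} {g : EE n → ℝ} {x : EE n} {d : ℝ} (hφ : HasDerivAt φ d (g x))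
    (hg : DifferentiableAt ℝ g x) (j : Fin n) :
    pd j (fun y => φ (g y)) x = d * pd j g x := by
  have := hφ.comp_hasFDerivAt x hg.hasFDerivAt
  rw [show (fun y => φ (g y)) = φ ∘ g from rfl, hasFDerivAt_pd_eq this]
  simp [pd]

lemma sum_sq_eq_norm (x : EE n) : ∑ i, (x i) ^ 2 = ‖x‖ ^ 2 := by
  rw [EuclideanSpace.norm_sq_eq]; simp

lemma pd_normsq (j : Fin n) (x : EE n) : pd j (fun y : EE n => ‖y‖ ^ 2) x = 2 * x j := by
  have : (fun y : EE n => ‖y‖ ^ 2) = fun y => ∑ i, (y i) ^ 2 := by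
    ext y; rw [sum_sq_eq_norm]
  rw [this, pd_sum]
  · have : ∀ i, pd j (fun y : EE n => (y i) ^ 2) x = 2 * x i * if i = j then 1 else 0 := by
      intro i
      rw [pd_sq (hasFDerivAt_coord i x).differentiableAt, pd_coord]
    simp [this]
  · intro i _
    exact ((contDiff_coord (k := 1) i).pow 2).differentiable (by norm_num) x

/-- affine rescaling -/
lemma pd_rescale (g : EE n → ℝ) (c s : ℝ) (q x : EE n) (j : Fin n)
    (hg : DifferentiableAt ℝ g (q + s • x)) :
    pd j (fun y => c * g (q + s • y)) x = c * s * pd j g (q + s • x) := by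
  have h1 : HasFDerivAt (fun y : EE n => q + s • y) (s • ContinuousLinearMap.id ℝ (EE n)) x :=
    ((hasFDerivAt_id x).const_smul s).const_add q
  have h2 := (hg.hasFDerivAt.comp x h1).const_mul c
  have h3 := hasFDerivAt_pd_eq h2 j
  simp only [Function.comp] at h3
  rw [h3]; simp [pd]; ring

lemma contDiff_rescale {g : EE n → ℝ} {k : WithTop ℕ∞} (hg : ContDiff ℝ k g) (c s : ℝ) (q : EE n) :
    ContDiff ℝ k (fun y => c * g (q + s • y)) := by
  have : ContDiff ℝ k (fun y : EE n => q + s • y) := by fun_prop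
  exact contDiff_const.mul (hg.comp this)

lemma integral_pd_eq_zero {g : EE n → ℝ} (hg : ContDiff ℝ 1 g) (hc : HasCompactSupport g)
    (j : Fin n) : ∫ x, pd j g x = 0 := by
  have hcont : Continuous (pd j g) := (contDiff_pd (m := 0) hg (by norm_num) j).continuous
  have hsupp : HasCompactSupport (pd j g) := by
    have := hc.fderiv (𝕜 := ℝ)
    exact this.comp_left (g := fun L : EE n →L[ℝ] ℝ => L (ee j)) (by simp)
  have h := integral_mul_fderiv_eq_neg_fderiv_mul_of_integrable (μ := (volume : Measure (EE n)))
    (f := fun _ => (1:ℝ)) (g := g) (v := ee j) (by simp) (by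
      simp only [one_mul]; exact hcont.integrable_of_hasCompactSupport hsupp) (by
      simpa using hg.continuous.integrable_of_hasCompactSupport hc)
      (fun x _ => by fun_prop) (fun x _ => hg.differentiable (by norm_num) x)
  simpa [pd] using h

/-- integration by parts, both functions globally C¹, one compactly supported -/
lemma integral_by_parts {F G : EE n → ℝ} (hF : ContDiff ℝ 1 F) (hG : ContDiff ℝ 1 G)
    (hc : HasCompactSupport G) (j : Fin n) :
    ∫ x, pd j F x * G x = - ∫ x, F x * pd j G x := by
  have h := integral_pd_eq_zero (hF.mul hG) hc.mul_left j
  have hcF : Continuous (pd j F) := (contDiff_pd (m := 0) hF (by norm_num) j).continuous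
  have hcG : Continuous (pd j G) := (contDiff_pd (m := 0) hG (by norm_num) j).continuous
  have hs : HasCompactSupport (pd j G) := by
    have := hc.fderiv (𝕜 := ℝ)
    exact this.comp_left (g := fun L : EE n →L[ℝ] ℝ => L (ee j)) (by simp)
  have i1 : Integrable (fun x => F x * pd j G x) :=
    (hF.continuous.mul hcG).integrable_of_hasCompactSupport hs.mul_left
  have i2 : Integrable (fun x => G x * pd j F x) :=
    (hG.continuous.mul hcF).integrable_of_hasCompactSupport hc.mul_right
  have e : ∀ x, pd j (fun y => F y * G y) x = F x * pd j G x + G x * pd j F x := fun x =>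
    pd_mul (hF.differentiable (by norm_num) x) (hG.differentiable (by norm_num) x) j
  have e2 : (∫ x, pd j (fun y => F y * G y) x) = 0 := h
  simp_rw [e] at e2
  rw [integral_add i1 i2] at e2
  simp_rw [mul_comm (pd j F _)]
  linarith

lemma lap_pd {u : EE n → ℝ} (hu : ContDiff ℝ 3 u) (i : Fin n) (x : EE n) :
    lap (pd i u) x = pd i (lap u) x := by
  have h2 : ∀ j, ContDiff ℝ 2 (pd j u) := fun j => contDiff_pd hu (by norm_num) j
  have h1 : ∀ j k, ContDiff ℝ 1 (pd k (pd j u)) := fun j k => contDiff_pd (h2 j) (by norm_num) k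
  unfold lap
  rw [pd_sum _ (fun j _ => (h1 j j).differentiable (by norm_num) x)]
  refine Finset.sum_congr rfl fun j _ => ?_
  have : pd j (pd i u) = pd i (pd j u) := by
    ext y; exact pd_comm (hu.of_le (by norm_num)) j i y
  rw [this, pd_comm (h2 j)]

lemma contDiff_lap {u : EE n → ℝ} {k m : WithTop ℕ∞} (hu : ContDiff ℝ k u) (h : m + 2 ≤ k) :
    ContDiff ℝ m (lap u) := by
  refine ContDiff.sum fun j _ => ?_
  refine contDiff_pd (k := m + 1) (contDiff_pd hu ?_ j) le_rfl j
  rw [add_assoc]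
  exact (by simpa [one_add_one_eq_two] using h)

lemma gr2_rescale {u : EE n → ℝ} (hu : ContDiff ℝ 1 u) (c s : ℝ) (q x : EE n) :
    gr2 (fun y => c * u (q + s • y)) x = (c * s) ^ 2 * gr2 u (q + s • x) := by
  unfold gr2
  rw [Finset.mul_sum]
  refine Finset.sum_congr rfl fun i _ => ?_
  rw [pd_rescale _ _ _ _ _ _ (hu.differentiable (by norm_num) _)]; ring

lemma pd_rescale_fun {g : EE n → ℝ} (hg : ContDiff ℝ 1 g) (c s : ℝ) (q : EE n) (j : Fin n) :
    pd j (fun y => c * g (q + s • y)) = fun y => (c * s) * pd j g (q + s • y) := by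
  ext x; exact pd_rescale _ _ _ _ _ _ (hg.differentiable (by norm_num) _)

lemma hs2_rescale {u : EE n → ℝ} (hu : ContDiff ℝ 2 u) (c s : ℝ) (q x : EE n) :
    hs2 (fun y => c * u (q + s • y)) x = (c * s * s) ^ 2 * hs2 u (q + s • x) := by
  unfold hs2
  rw [Finset.mul_sum]
  refine Finset.sum_congr rfl fun i _ => ?_
  rw [Finset.mul_sum]
  refine Finset.sum_congr rfl fun j _ => ?_
  rw [pd_rescale_fun (hu.of_le (by norm_num)),
    pd_rescale_fun (contDiff_pd hu (by norm_num) i)]; ring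

lemma lap_rescale {u : EE n → ℝ} (hu : ContDiff ℝ 2 u) (c s : ℝ) (q x : EE n) :
    lap (fun y => c * u (q + s • y)) x = (c * s * s) * lap u (q + s • x) := by
  unfold lap
  rw [Finset.mul_sum]
  refine Finset.sum_congr rfl fun i _ => ?_
  rw [pd_rescale_fun (hu.of_le (by norm_num)),
    pd_rescale_fun (contDiff_pd hu (by norm_num) i)]

lemma DI_rescale {u : EE n → ℝ} (hu : ContDiff ℝ 3 u) {K : ℝ} (c s : ℝ) (hs : |s| ≤ 1)
    (q x : EE n) (h : DI u K (q + s • x)) :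
    DI (fun y => c * u (q + s • y)) (K * s) x := by
  unfold DI at *
  have e : ∀ i, lap (pd i (fun y => c * u (q + s • y))) x
      = (c * s * s * s) * lap (pd i u) (q + s • x) := by
    intro i
    rw [pd_rescale_fun (hu.of_le (by norm_num)), lap_rescale (contDiff_pd hu (by norm_num) i)]
  simp_rw [e, mul_pow _ _ 2]
  rw [← Finset.mul_sum, gr2_rescale (hu.of_le (by norm_num)), hs2_rescale (hu.of_le (by norm_num))]
  have hg := gr2_nonneg u (q + s • x)
  have hs2' := hs2_nonneg u (q + s • x)
  have hs1 : s ^ 2 ≤ 1 := by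
    rw [← sq_abs]; nlinarith [abs_nonneg s]
  set g := gr2 u (q + s • x)
  set h2 := hs2 u (q + s • x)
  have hg2 : s ^ 2 * g ≤ g := by nlinarith
  calc _ ≤ (c^2*s^2*s^2*s^2) * (K^2 * (g + h2)) := by
        refine (mul_le_mul_of_nonneg_left h (by positivity)).trans (le_of_eq ?_); ring
    _ = (c^2*s^2*s^2*K^2) * (s^2 * g + s^2*h2) := by ring
    _ ≤ (c^2*s^2*s^2*K^2) * (g + s^2*h2) := by gcongr
    _ = _ := by ring


lemma hasDerivAt_posPow (m : ℕ) (t : ℝ) :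
    HasDerivAt (fun t : ℝ => (max t 0) ^ (m + 2)) ((m + 2 : ℝ) * (max t 0) ^ (m + 1)) t := by
  have hp : ∀ s : ℝ, HasDerivAt (fun t : ℝ => t ^ (m + 2)) ((m + 2 : ℝ) * s ^ (m + 1)) s := by
    intro s
    have := hasDerivAt_pow (m + 2) s
    simpa using this
  rcases lt_trichotomy t 0 with h | h | h
  · have : HasDerivAt (fun _ : ℝ => (0 : ℝ)) 0 t := hasDerivAt_const _ _
    rw [max_eq_right h.le]
    simp only [ne_eq, Nat.add_eq_zero_iff, one_ne_zero, and_false, not_false_eq_true, zero_pow,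
      mul_zero]
    refine this.congr_of_eventuallyEq ?_
    filter_upwards [Iio_mem_nhds h] with s hs
    rw [max_eq_right (le_of_lt hs)]; simp
  · subst h
    have h1 : HasDerivWithinAt (fun t : ℝ => (max t 0) ^ (m + 2)) 0 (Ici 0) 0 := by
      have := (hp 0).hasDerivWithinAt (s := Ici 0)
      simp only [ne_eq, Nat.add_eq_zero_iff, one_ne_zero, and_false, not_false_eq_true, zero_pow,
        mul_zero] at this
      refine this.congr (fun s hs => ?_) (by simp)
      rw [max_eq_left hs]
    have h2 : HasDerivWithinAt (fun t : ℝ => (max t 0) ^ (m + 2)) 0 (Iic 0) 0 := by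
      have := (hasDerivAt_const (0:ℝ) (0:ℝ)).hasDerivWithinAt (s := Iic 0)
      refine this.congr (fun s hs => ?_) (by simp)
      rw [max_eq_right hs]; simp
    have := h2.union h1
    rw [Iic_union_Ici] at this
    simpa using this.hasDerivAt univ_mem
  · rw [max_eq_left h.le]
    refine (hp t).congr_of_eventuallyEq ?_
    filter_upwards [Ioi_mem_nhds h] with s hs
    rw [max_eq_left (le_of_lt hs)]

lemma contDiff_posPow (m : ℕ) : ContDiff ℝ 1 (fun t : ℝ => (max t 0) ^ (m + 2)) := by
  rw [contDiff_one_iff_deriv]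
  refine ⟨fun t => (hasDerivAt_posPow m t).differentiableAt, ?_⟩
  have : deriv (fun t : ℝ => (max t 0) ^ (m + 2)) = fun t => (m + 2 : ℝ) * (max t 0) ^ (m + 1) := by
    ext t; exact (hasDerivAt_posPow m t).deriv
  rw [this]
  fun_prop

/-- the weight -/
def wt (r : ℝ) (x : EE n) : ℝ := max (r ^ 2 - ‖x‖ ^ 2) 0

lemma wt_nonneg (r : ℝ) (x : EE n) : 0 ≤ wt r x := le_max_right _ _

lemma wt_le (r : ℝ) (x : EE n) : wt r x ≤ r ^ 2 :=
  max_le (by nlinarith [sq_nonneg ‖x‖]) (sq_nonneg r)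

lemma continuous_wt (r : ℝ) : Continuous (wt r : EE n → ℝ) := by
  unfold wt; fun_prop

lemma wt_eq_zero {r : ℝ} (hr : 0 ≤ r) {x : EE n} (hx : r ≤ ‖x‖) : wt r x = 0 := by
  unfold wt; rw [max_eq_right]; nlinarith

lemma wt_eq {r : ℝ} {x : EE n} (hx : ‖x‖ ≤ r) : wt r x = r ^ 2 - ‖x‖ ^ 2 := by
  unfold wt; rw [max_eq_left]; nlinarith [norm_nonneg x]

lemma hasCompactSupport_wt (r : ℝ) (m : ℕ) (hm : m ≠ 0) :
    HasCompactSupport (fun x : EE n => wt r x ^ m) := by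
  refine HasCompactSupport.intro (isCompact_closedBall (0 : EE n) |r|) fun x hx => ?_
  have : |r| ≤ ‖x‖ := by
    simp at hx; exact hx.le
  have h : wt r x = 0 := by
    unfold wt; rw [max_eq_right]; rw [← sq_abs r]; nlinarith [abs_nonneg r]
  rw [h, zero_pow hm]

lemma contDiff_wt_pow (r : ℝ) (m : ℕ) : ContDiff ℝ 1 (fun x : EE n => wt r x ^ (m + 2)) := by
  have h : ContDiff ℝ 1 (fun x : EE n => r ^ 2 - ‖x‖ ^ 2) :=
    contDiff_const.sub (contDiff_norm_sq ℝ)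
  exact (contDiff_posPow m).comp h

lemma pd_wt_pow (r : ℝ) (m : ℕ) (j : Fin n) (x : EE n) :
    pd j (fun x : EE n => wt r x ^ (m + 2)) x = -(2 * (m + 2) * x j * wt r x ^ (m + 1)) := by
  have h : ContDiff ℝ 1 (fun x : EE n => ‖x‖ ^ 2) := contDiff_norm_sq ℝ
  have hd : DifferentiableAt ℝ (fun x : EE n => ‖x‖ ^ 2) x := h.differentiable (by norm_num) x
  have := pd_comp (φ := fun t => (max t 0) ^ (m + 2)) (g := fun x : EE n => r ^ 2 - ‖x‖ ^ 2) (x := x)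
    (hasDerivAt_posPow m _) (by fun_prop) j
  unfold wt
  rw [this, pd_sub (by fun_prop) hd, pd_const, pd_normsq]
  ring

/-- weighted integral -/
def J (m : ℕ) (r : ℝ) (F : EE n → ℝ) : ℝ := ∫ x, F x * wt r x ^ m

lemma J_integrable {m : ℕ} (hm : m ≠ 0) (r : ℝ) {F : EE n → ℝ} (hF : Continuous F) :
    Integrable (fun x => F x * wt r x ^ m) :=
  (hF.mul ((continuous_wt r).pow m)).integrable_of_hasCompactSupport
    (hasCompactSupport_wt r m hm).mul_left

lemma J_add {m : ℕ} (hm : m ≠ 0) (r : ℝ) {F G : EE n → ℝ} (hF : Continuous F) (hG : Continuous G) :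
    J m r (fun x => F x + G x) = J m r F + J m r G := by
  unfold J
  rw [← integral_add (J_integrable hm r hF) (J_integrable hm r hG)]
  congr 1; ext x; ring

lemma J_const_mul (m : ℕ) (r c : ℝ) (F : EE n → ℝ) :
    J m r (fun x => c * F x) = c * J m r F := by
  unfold J
  rw [← integral_const_mul]
  congr 1; ext x; ring

lemma J_sum {ι : Type*} (s : Finset ι) {m : ℕ} (hm : m ≠ 0) (r : ℝ) {F : ι → EE n → ℝ}
    (hF : ∀ i ∈ s, Continuous (F i)) :
    J m r (fun x => ∑ i ∈ s, F i x) = ∑ i ∈ s, J m r (F i) := by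
  unfold J
  rw [← integral_finsetSum s (fun i hi => J_integrable hm r (hF i hi))]
  congr 1; ext x; rw [Finset.sum_mul]

lemma J_nonneg (m : ℕ) (r : ℝ) {F : EE n → ℝ} (hF : ∀ x, 0 ≤ F x) : 0 ≤ J m r F :=
  integral_nonneg fun x => mul_nonneg (hF x) (pow_nonneg (wt_nonneg r x) m)

lemma J_mono {m : ℕ} (hm : m ≠ 0) {r : ℝ} (hr : 0 ≤ r) {F G : EE n → ℝ} (hF : Continuous F)
    (hG : Continuous G) (h : ∀ x ∈ ball (0 : EE n) r, F x ≤ G x) : J m r F ≤ J m r G := by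
  refine integral_mono (J_integrable hm r hF) (J_integrable hm r hG) fun x => ?_
  by_cases hx : x ∈ ball (0 : EE n) r
  · exact mul_le_mul_of_nonneg_right (h x hx) (pow_nonneg (wt_nonneg r x) m)
  · have : r ≤ ‖x‖ := by simpa using hx
    simp [wt_eq_zero hr this, hm]

lemma J_succ_le (m : ℕ) (hm : m ≠ 0) (r : ℝ) {F : EE n → ℝ} (hF : Continuous F) (h0 : ∀ x, 0 ≤ F x) :
    J (m + 1) r F ≤ r ^ 2 * J m r F := by
  rw [← J_const_mul]
  refine integral_mono (J_integrable (by omega) r hF) (J_integrable hm r (by fun_prop)) fun x => ?_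
  have h1 := wt_le r x
  have h2 := wt_nonneg r x
  have : F x * wt r x ^ m * wt r x ≤ F x * wt r x ^ m * r ^ 2 :=
    mul_le_mul_of_nonneg_left h1 (mul_nonneg (h0 x) (pow_nonneg h2 m))
  simp only [pow_succ] at *
  linarith

lemma J_split (m : ℕ) (hm : m ≠ 0) {r : ℝ} (hr : 0 ≤ r) {F : EE n → ℝ} (hF : Continuous F) :
    r ^ 2 * J m r F = J (m + 1) r F + J m r (fun x => ‖x‖ ^ 2 * F x) := by
  rw [← J_const_mul]
  unfold J
  rw [← integral_add (J_integrable (by omega) r hF)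
    (J_integrable hm r (F := fun x => ‖x‖ ^ 2 * F x) (by fun_prop))]
  congr 1; ext x
  by_cases hx : ‖x‖ ≤ r
  · rw [pow_succ, wt_eq hx]; ring
  · rw [wt_eq_zero hr (not_le.1 hx).le]; simp [hm]

lemma J_ibp (m : ℕ) (r : ℝ) {G : EE n → ℝ} (hG : ContDiff ℝ 1 G) (j : Fin n) :
    J (m + 2) r (pd j G) = 2 * (m + 2) * J (m + 1) r (fun x => x j * G x) := by
  unfold J
  rw [integral_by_parts hG (contDiff_wt_pow r m) (hasCompactSupport_wt r _ (by omega)) j]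
  simp_rw [pd_wt_pow]
  rw [← integral_const_mul, ← integral_neg]
  congr 1; ext x; ring

lemma J_hasDerivAt (m : ℕ) {F : EE n → ℝ} (hF : Continuous F) (r : ℝ) :
    HasDerivAt (fun r => J (m + 2) r F) (2 * (m + 2) * r * J (m + 1) r F) r := by
  have hd : ∀ (x : EE n) (s : ℝ), HasDerivAt (fun s => F x * wt s x ^ (m + 2))
      (2 * (m + 2) * s * (F x * wt s x ^ (m + 1))) s := by
    intro x s
    have h1 : HasDerivAt (fun s : ℝ => s ^ 2 - ‖x‖ ^ 2) (2 * s) s := by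
      simpa using (hasDerivAt_pow 2 s).sub_const (‖x‖ ^ 2)
    have h2 := ((hasDerivAt_posPow m _).comp s h1).const_mul (F x)
    refine h2.congr_deriv ?_
    unfold wt; ring
  set B : ℝ := |r| + 1 with hB
  have hBpos : 0 < B := by positivity
  obtain ⟨C, hC⟩ := (isCompact_closedBall (0 : EE n) B).exists_bound_of_continuousOn hF.continuousOn
  have key := hasDerivAt_integral_of_dominated_loc_of_deriv_le (μ := (volume : Measure (EE n)))
    (F := fun s x => F x * wt s x ^ (m + 2))
    (F' := fun s x => 2 * (m + 2) * s * (F x * wt s x ^ (m + 1))) (x₀ := r)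
    (s := ball r 1) (bound := (closedBall (0 : EE n) B).indicator
      fun _ => 2 * (m + 2) * B * (C * (B ^ 2) ^ (m + 1))) (ball_mem_nhds r one_pos) ?_ ?_ ?_ ?_ ?_ ?_
  · have := key.2
    unfold J
    rw [← integral_const_mul]
    exact this
  · exact Eventually.of_forall fun s => (J_integrable (by omega) s hF).aestronglyMeasurable
  · exact J_integrable (by omega) r hF
  · exact ((J_integrable (m := m + 1) (by omega) r hF).const_mul _).aestronglyMeasurable
  · refine Eventually.of_forall fun x s hs => ?_
    have hsB : |s| ≤ B := by
      rw [Metric.mem_ball, Real.dist_eq] at hs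
      have := abs_sub_abs_le_abs_sub s r
      linarith
    by_cases hx : x ∈ closedBall (0 : EE n) B
    · rw [indicator_of_mem hx]
      have hw : wt s x ≤ B ^ 2 := (wt_le s x).trans (by rw [← sq_abs]; gcongr)
      have hC0 := hC x hx
      rw [norm_mul, norm_mul, norm_mul, norm_mul, norm_pow, Real.norm_of_nonneg (wt_nonneg s x),
        Real.norm_of_nonneg (show (0:ℝ) ≤ m + 2 by positivity), Real.norm_eq_abs s]
      simp only [Real.norm_ofNat]
      have := wt_nonneg s x
      have : 0 ≤ C := (norm_nonneg _).trans hC0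
      gcongr
    · rw [indicator_of_notMem hx]
      have : B < ‖x‖ := by simpa using hx
      have : wt s x = 0 := by
        unfold wt; rw [max_eq_right]; rw [← sq_abs s]; nlinarith [abs_nonneg s]
      simp [this]
  · exact (integrable_indicator_iff measurableSet_closedBall).2
      (integrableOn_const (by exact (measure_closedBall_lt_top).ne))
  · exact Eventually.of_forall fun x s _ => hd x s



/-- V·ΔV -/
def vd (u : EE n → ℝ) (x : EE n) : ℝ := ∑ i, pd i u x * lap (pd i u) x
/-- (x·∇)V_i -/
def Yf (u : EE n → ℝ) (i : Fin n) (x : EE n) : ℝ := ∑ j, x j * pd j (pd i u) x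
/-- V·(x·∇)V -/
def VY (u : EE n → ℝ) (x : EE n) : ℝ := ∑ i, pd i u x * Yf u i x
/-- |(x·∇)V|² -/
def YY (u : EE n → ℝ) (x : EE n) : ℝ := ∑ i, (Yf u i x) ^ 2
/-- ΔV·(x·∇)V -/
def LY (u : EE n → ℝ) (x : EE n) : ℝ := ∑ i, lap (pd i u) x * Yf u i x

lemma continuous_pd {g : EE n → ℝ} (hg : ContDiff ℝ 1 g) (j : Fin n) : Continuous (pd j g) :=
  (contDiff_pd (m := 0) hg (by norm_num) j).continuous

section

lemma u_c1 {u : EE n → ℝ} (hu : ContDiff ℝ 3 u) (i : Fin n) : ContDiff ℝ 2 (pd i u) := contDiff_pd hu (by norm_num) i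
lemma u_c2 {u : EE n → ℝ} (hu : ContDiff ℝ 3 u) (i j : Fin n) : ContDiff ℝ 1 (pd j (pd i u)) := contDiff_pd (u_c1 hu i) (by norm_num) j
lemma u_cc1 {u : EE n → ℝ} (hu : ContDiff ℝ 3 u) (i : Fin n) : Continuous (pd i u) := (u_c1 hu i).continuous
lemma u_cc2 {u : EE n → ℝ} (hu : ContDiff ℝ 3 u) (i j : Fin n) : Continuous (pd j (pd i u)) := (u_c2 hu i j).continuous
lemma u_cc3 {u : EE n → ℝ} (hu : ContDiff ℝ 3 u) (i j k : Fin n) : Continuous (pd k (pd j (pd i u))) := continuous_pd (u_c2 hu i j) k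
lemma cont_coord {u : EE n → ℝ} (hu : ContDiff ℝ 3 u) (i : Fin n) : Continuous (fun x : EE n => x i) := (contDiff_coord (k := 0) i).continuous
lemma cont_gr2 {u : EE n → ℝ} (hu : ContDiff ℝ 3 u) : Continuous (gr2 u) := continuous_finsetSum _ fun i _ => (u_cc1 hu i).pow 2
lemma cont_hs2 {u : EE n → ℝ} (hu : ContDiff ℝ 3 u) : Continuous (hs2 u) :=
  continuous_finsetSum _ fun i _ => continuous_finsetSum _ fun j _ => (u_cc2 hu i j).pow 2
lemma cont_lap {u : EE n → ℝ} (hu : ContDiff ℝ 3 u) (i : Fin n) : Continuous (lap (pd i u)) :=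
  continuous_finsetSum _ fun j _ => u_cc3 hu i j j
lemma cont_vd {u : EE n → ℝ} (hu : ContDiff ℝ 3 u) : Continuous (vd u) :=
  continuous_finsetSum _ fun i _ => (u_cc1 hu i).mul (cont_lap hu i)
lemma c1_Yf {u : EE n → ℝ} (hu : ContDiff ℝ 3 u) (i : Fin n) : ContDiff ℝ 1 (Yf u i) :=
  ContDiff.sum fun j _ => (contDiff_coord j).mul (u_c2 hu i j)
lemma cont_VY {u : EE n → ℝ} (hu : ContDiff ℝ 3 u) : Continuous (VY u) :=
  continuous_finsetSum _ fun i _ => (u_cc1 hu i).mul (c1_Yf hu i).continuous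
lemma cont_YY {u : EE n → ℝ} (hu : ContDiff ℝ 3 u) : Continuous (YY u) :=
  continuous_finsetSum _ fun i _ => (c1_Yf hu i).continuous.pow 2
lemma cont_LY {u : EE n → ℝ} (hu : ContDiff ℝ 3 u) : Continuous (LY u) :=
  continuous_finsetSum _ fun i _ => (cont_lap hu i).mul (c1_Yf hu i).continuous

lemma Id1 {u : EE n → ℝ} (hu : ContDiff ℝ 3 u) (r : ℝ) : J 3 r (hs2 u) + J 3 r (vd u) = 6 * J 2 r (VY u) := by
  rw [← J_add (by norm_num) r (cont_hs2 hu) (cont_vd hu)]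
  have hP : ∀ i j, ContDiff ℝ 1 (fun x => pd i u x * pd j (pd i u) x) := fun i j =>
    ((u_c1 hu i).of_le (by norm_num)).mul (u_c2 hu i j)
  have e1 : (fun x => hs2 u x + vd u x)
      = fun x => ∑ i, ∑ j, pd j (fun x => pd i u x * pd j (pd i u) x) x := by
    ext x
    unfold hs2 vd lap
    rw [← Finset.sum_add_distrib]
    refine Finset.sum_congr rfl fun i _ => ?_
    rw [Finset.mul_sum, ← Finset.sum_add_distrib]
    refine Finset.sum_congr rfl fun j _ => ?_
    rw [pd_mul ((u_c1 hu i).differentiable (by norm_num) x)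
      ((u_c2 hu i j).differentiable (by norm_num) x)]
    ring
  have e2 : VY u = fun x => ∑ i, ∑ j, x j * (pd i u x * pd j (pd i u) x) := by
    ext x
    unfold VY Yf
    refine Finset.sum_congr rfl fun i _ => ?_
    rw [Finset.mul_sum]
    refine Finset.sum_congr rfl fun j _ => ?_
    ring
  have cP : ∀ i j, Continuous (fun x : EE n => x j * (pd i u x * pd j (pd i u) x)) := fun i j =>
    (cont_coord hu j).mul (hP i j).continuous
  rw [e1, e2, J_sum _ (by norm_num) r (fun i _ => continuous_finsetSum _ fun j _ =>
    continuous_pd (hP i j) j), J_sum _ (by norm_num) r (fun i _ => continuous_finsetSum _ fun j _ =>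
    cP i j), Finset.mul_sum]
  refine Finset.sum_congr rfl fun i _ => ?_
  rw [J_sum _ (by norm_num) r (fun j _ => continuous_pd (hP i j) j),
    J_sum _ (by norm_num) r (fun j _ => cP i j), Finset.mul_sum]
  refine Finset.sum_congr rfl fun j _ => ?_
  rw [J_ibp 1 r (hP i j) j]
  norm_num

/-- radial integration by parts -/
lemma J_radial {u : EE n → ℝ} (hu : ContDiff ℝ 3 u) (m : ℕ) (r : ℝ) {F : EE n → ℝ} (hF : ContDiff ℝ 1 F) :
    2 * (m + 2) * J (m + 1) r (fun x => ‖x‖ ^ 2 * F x)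
      = n * J (m + 2) r F + J (m + 2) r (fun x => ∑ j, x j * pd j F x) := by
  have hG : ∀ j, ContDiff ℝ 1 (fun x : EE n => x j * F x) := fun j => (contDiff_coord j).mul hF
  have e1 : (fun x : EE n => ‖x‖ ^ 2 * F x) = fun x => ∑ j, x j * (x j * F x) := by
    ext x; rw [← sum_sq_eq_norm, Finset.sum_mul]
    exact Finset.sum_congr rfl fun j _ => by ring
  have e2 : ∀ j (x : EE n), pd j (fun x : EE n => x j * F x) x = x j * pd j F x + F x := by
    intro j x
    rw [pd_mul (hasFDerivAt_coord j x).differentiableAt (hF.differentiable (by norm_num) x), pd_coord]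
    simp
  have cF : ∀ j, Continuous (pd j F) := fun j => continuous_pd hF j
  have cx := cont_coord hu
  have c1 : ∀ j, Continuous (fun x : EE n => x j * pd j F x) := fun j => (cx j).mul (cF j)
  have c0 : ∀ j, Continuous (fun x : EE n => x j * (x j * F x)) := fun j =>
    (cx j).mul ((cx j).mul hF.continuous)
  rw [e1, J_sum _ (by omega) r (fun j _ => c0 j), Finset.mul_sum,
    J_sum _ (by omega) r (fun j _ => c1 j)]
  have e3 : (n : ℝ) * J (m + 2) r F = ∑ _j : Fin n, J (m + 2) r F := by simp
  rw [e3, ← Finset.sum_add_distrib]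
  refine Finset.sum_congr rfl fun j _ => ?_
  rw [← J_ibp m r (hG j) j, show pd j (fun x : EE n => x j * F x) = fun x => x j * pd j F x + F x from
    funext (e2 j), J_add (by omega) r (c1 j) hF.continuous]
  ring

lemma c1_gr2 {u : EE n → ℝ} (hu : ContDiff ℝ 3 u) : ContDiff ℝ 1 (gr2 u) :=
  ContDiff.sum fun i _ => ((u_c1 hu i).of_le (by norm_num)).pow 2
lemma c1_hs2 {u : EE n → ℝ} (hu : ContDiff ℝ 3 u) : ContDiff ℝ 1 (hs2 u) :=
  ContDiff.sum fun i _ => ContDiff.sum fun j _ => (u_c2 hu i j).pow 2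

lemma Id2 {u : EE n → ℝ} (hu : ContDiff ℝ 3 u) (r : ℝ) : 4 * J 1 r (fun x => ‖x‖ ^ 2 * gr2 u x) = n * J 2 r (gr2 u) + 2 * J 2 r (VY u) := by
  have h0 := J_radial hu 0 r (c1_gr2 hu)
  norm_num at h0
  rw [h0]
  have hfe : (fun x => ∑ j, x j * pd j (gr2 u) x) = fun x => 2 * VY u x := ?_
  · rw [hfe, J_const_mul]
  ext x
  have : ∀ j, pd j (gr2 u) x = ∑ i, 2 * pd i u x * pd j (pd i u) x := by
    intro j
    unfold gr2
    rw [pd_sum _ (fun i _ => (((u_c1 hu i).pow 2).differentiable (by norm_num) x))]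
    exact Finset.sum_congr rfl fun i _ => pd_sq ((u_c1 hu i).differentiable (by norm_num) x) j
  simp_rw [this]
  unfold VY Yf
  simp_rw [Finset.mul_sum]
  rw [Finset.sum_comm]
  refine Finset.sum_congr rfl fun i _ => Finset.sum_congr rfl fun j _ => by ring

lemma Id4 {u : EE n → ℝ} (hu : ContDiff ℝ 3 u) (r : ℝ) : J 3 r (fun x => ∑ j, x j * pd j (hs2 u) x)
    = 12 * J 2 r (YY u) - 2 * J 3 r (LY u) - 2 * J 3 r (hs2 u) := by
  have hP : ∀ i k, ContDiff ℝ 1 (fun x => pd k (pd i u) x * Yf u i x) := fun i k =>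
    (u_c2 hu i k).mul (c1_Yf hu i)
  have dY : ∀ i k x, pd k (Yf u i) x = pd k (pd i u) x + ∑ j, x j * pd k (pd j (pd i u)) x := by
    intro i k x
    unfold Yf
    rw [pd_sum _ (fun j _ => (((contDiff_coord j).mul (u_c2 hu i j)).differentiable (by norm_num) x))]
    have : ∀ j, pd k (fun y : EE n => y j * pd j (pd i u) y) x
        = x j * pd k (pd j (pd i u)) x + pd j (pd i u) x * if j = k then 1 else 0 := by
      intro j
      rw [pd_mul (hasFDerivAt_coord j x).differentiableAt
        ((u_c2 hu i j).differentiable (by norm_num) x), pd_coord]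
    simp_rw [this]
    rw [Finset.sum_add_distrib]
    simp [add_comm]
  have e1 : ∀ x, ∑ i, ∑ k, pd k (fun x => pd k (pd i u) x * Yf u i x) x
      = LY u x + hs2 u x + (1/2) * ∑ j, x j * pd j (hs2 u) x := by
    intro x
    have h2 : ∀ j, pd j (hs2 u) x = ∑ i, ∑ k, 2 * pd k (pd i u) x * pd j (pd k (pd i u)) x := by
      intro j
      unfold hs2
      rw [pd_sum _ (fun i _ => (ContDiff.sum fun k _ => (u_c2 hu i k).pow 2).differentiable (by norm_num) x)]
      refine Finset.sum_congr rfl fun i _ => ?_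
      rw [pd_sum _ (fun k _ => ((u_c2 hu i k).pow 2).differentiable (by norm_num) x)]
      exact Finset.sum_congr rfl fun k _ => pd_sq ((u_c2 hu i k).differentiable (by norm_num) x) j
    have h3 : (1/2) * ∑ j, x j * pd j (hs2 u) x
        = ∑ i, ∑ k, pd k (pd i u) x * ∑ j, x j * pd k (pd j (pd i u)) x := by
      simp_rw [h2, Finset.mul_sum]
      rw [Finset.sum_comm]
      refine Finset.sum_congr rfl fun i _ => ?_
      rw [Finset.sum_comm]
      refine Finset.sum_congr rfl fun k _ => Finset.sum_congr rfl fun j _ => ?_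
      rw [pd_comm (u_c1 hu i) j k]; ring
    rw [h3]
    unfold LY hs2 lap
    rw [← Finset.sum_add_distrib, ← Finset.sum_add_distrib]
    refine Finset.sum_congr rfl fun i _ => ?_
    rw [Finset.sum_mul, ← Finset.sum_add_distrib, ← Finset.sum_add_distrib]
    refine Finset.sum_congr rfl fun k _ => ?_
    rw [pd_mul ((u_c2 hu i k).differentiable (by norm_num) x)
      ((c1_Yf hu i).differentiable (by norm_num) x), dY]
    ring
  have e2 : YY u = fun x => ∑ i, ∑ k, x k * (pd k (pd i u) x * Yf u i x) := by
    ext x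
    unfold YY
    refine Finset.sum_congr rfl fun i _ => ?_
    rw [sq]
    conv_lhs => enter [1]; unfold Yf
    rw [Finset.sum_mul]
    exact Finset.sum_congr rfl fun k _ => by ring
  have cP : ∀ i j, Continuous (fun x : EE n => x j * (pd j (pd i u) x * Yf u i x)) := fun i j =>
    (cont_coord hu j).mul (hP i j).continuous
  have e3 : J 3 r (fun x => ∑ i, ∑ k, pd k (fun x => pd k (pd i u) x * Yf u i x) x) = 6 * J 2 r (YY u) := by
    rw [e2, J_sum _ (by norm_num) r (fun i _ => continuous_finsetSum _ fun j _ =>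
      continuous_pd (hP i j) j), J_sum _ (by norm_num) r (fun i _ => continuous_finsetSum _ fun j _ =>
      cP i j), Finset.mul_sum]
    refine Finset.sum_congr rfl fun i _ => ?_
    rw [J_sum _ (by norm_num) r (fun j _ => continuous_pd (hP i j) j),
      J_sum _ (by norm_num) r (fun j _ => cP i j), Finset.mul_sum]
    refine Finset.sum_congr rfl fun j _ => ?_
    rw [J_ibp 1 r (hP i j) j]
    norm_num
  have cR : Continuous (fun x : EE n => ∑ j, x j * pd j (hs2 u) x) :=
    continuous_finsetSum _ fun j _ => (cont_coord hu j).mul (continuous_pd (c1_hs2 hu) j)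
  have e4 : J 3 r (fun x => ∑ i, ∑ k, pd k (fun x => pd k (pd i u) x * Yf u i x) x)
     = J 3 r (LY u) + J 3 r (hs2 u) + (1/2) * J 3 r (fun x => ∑ j, x j * pd j (hs2 u) x) := by
    simp_rw [e1]
    have q1 : Continuous (fun x => LY u x + hs2 u x) := (cont_LY hu).add (cont_hs2 hu)
    have q2 : Continuous (fun x : EE n => (1/2) * ∑ j, x j * pd j (hs2 u) x) := continuous_const.mul cR
    rw [J_add (by norm_num) r q1 q2,
      J_add (by norm_num) r (cont_LY hu) (cont_hs2 hu), J_const_mul]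
  linarith

lemma Id3 {u : EE n → ℝ} (hu : ContDiff ℝ 3 u) (r : ℝ) : 6 * J 2 r (fun x => ‖x‖ ^ 2 * hs2 u x)
    = (n - 2) * J 3 r (hs2 u) + 12 * J 2 r (YY u) - 2 * J 3 r (LY u) := by
  have := J_radial hu 1 r (c1_hs2 hu)
  norm_num at this
  rw [this, Id4 hu]
  ring

end


lemma vd_sq_le {u : EE n → ℝ} {K : ℝ} {x : EE n} (h : DI u K x) :
    vd u x ^ 2 ≤ gr2 u x * (K ^ 2 * (gr2 u x + hs2 u x)) :=
  (Finset.sum_mul_sq_le_sq_mul_sq _ _ _).trans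
    (mul_le_mul_of_nonneg_left h (gr2_nonneg u x))

lemma YY_le (u : EE n → ℝ) (x : EE n) : YY u x ≤ ‖x‖ ^ 2 * hs2 u x := by
  unfold YY hs2
  rw [Finset.mul_sum]
  refine Finset.sum_le_sum fun i _ => ?_
  rw [← sum_sq_eq_norm]
  exact Finset.sum_mul_sq_le_sq_mul_sq _ _ _

lemma YY_nonneg (u : EE n → ℝ) (x : EE n) : 0 ≤ YY u x :=
  Finset.sum_nonneg fun _ _ => sq_nonneg _

lemma LY_abs_le {u : EE n → ℝ} {K r : ℝ} (hK : 0 ≤ K) {x : EE n} (h : DI u K x) (hr : ‖x‖ ≤ r) :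
    |LY u x| ≤ K * r * (gr2 u x + hs2 u x) := by
  have hg := gr2_nonneg u x
  have hh := hs2_nonneg u x
  have hr0 : 0 ≤ r := (norm_nonneg x).trans hr
  refine abs_le_of_sq_le_sq ?_ (by positivity)
  calc LY u x ^ 2 ≤ (∑ i, lap (pd i u) x ^ 2) * YY u x := Finset.sum_mul_sq_le_sq_mul_sq _ _ _
    _ ≤ (K ^ 2 * (gr2 u x + hs2 u x)) * (‖x‖ ^ 2 * hs2 u x) :=
        mul_le_mul h (YY_le u x) (YY_nonneg u x) (by positivity)
    _ ≤ (K ^ 2 * (gr2 u x + hs2 u x)) * (r ^ 2 * (gr2 u x + hs2 u x)) := by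
        gcongr; linarith
    _ = _ := by ring

lemma vd_w_le {K r w g h v : ℝ} (hK : 0 ≤ K) (hr : 0 ≤ r) (hw : 0 ≤ w) (hg : 0 ≤ g) (hh : 0 ≤ h)
    (hv : v ^ 2 ≤ g * (K ^ 2 * (g + h))) :
    |r ^ 2 * w ^ 2 * v| ≤ r * K / 2 * (r ^ 2 * w * g + w ^ 3 * (g + h)) := by
  refine abs_le_of_sq_le_sq ?_ (by positivity)
  have h1 : (r ^ 2 * w ^ 2 * v) ^ 2 ≤ (r ^ 2 * w ^ 2) ^ 2 * (g * (K ^ 2 * (g + h))) := by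
    rw [mul_pow]; gcongr
  have h2 : 0 ≤ (r * K / 2) ^ 2 * (r ^ 2 * w * g - w ^ 3 * (g + h)) ^ 2 := by positivity
  nlinarith

section
variable {K r : ℝ}

/-- the quantity S -/
lemma J_vd_bound {u : EE n → ℝ} (hu : ContDiff ℝ 3 u) (hK : 0 ≤ K) (hr : 0 ≤ r) (hD : ∀ x ∈ ball (0 : EE n) r, DI u K x) :
    r ^ 2 * J 2 r (fun x => |vd u x|) ≤
      r * K / 2 * (r ^ 2 * J 1 r (gr2 u) + (J 3 r (gr2 u) + J 3 r (hs2 u))) := by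
  have c1 := cont_gr2 hu
  have c2 := cont_hs2 hu
  have c3 := cont_vd hu
  rw [← J_add (by norm_num) r c1 c2]
  unfold J
  rw [← integral_const_mul, ← integral_const_mul,
    ← integral_add ((J_integrable (by norm_num) r c1).const_mul _)
      (J_integrable (by norm_num) r (by fun_prop)), ← integral_const_mul]
  have cw := continuous_wt (n := n) r
  refine integral_mono ((J_integrable (by norm_num) r (by fun_prop)).const_mul _)
    ((((J_integrable (by norm_num) r c1).const_mul _).add
      (J_integrable (by norm_num) r (by fun_prop))).const_mul _) fun x => ?_
  by_cases hx : x ∈ ball (0 : EE n) r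
  · have := vd_w_le hK hr (wt_nonneg r x) (gr2_nonneg u x) (hs2_nonneg u x) (vd_sq_le (hD x hx))
    rw [abs_mul, abs_of_nonneg (by positivity)] at this
    linarith
  · have : wt r x = 0 := wt_eq_zero hr (by simpa using hx)
    simp [this]

lemma J_abs_le {u : EE n → ℝ} (hu : ContDiff ℝ 3 u) (m : ℕ) (r : ℝ) (F : EE n → ℝ) : |J m r F| ≤ J m r (fun x => |F x|) := by
  unfold J
  refine (abs_integral_le_integral_abs).trans (le_of_eq ?_)
  congr 1; ext x
  rw [abs_mul, abs_of_nonneg (pow_nonneg (wt_nonneg r x) m)]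

lemma J_LY_bound {u : EE n → ℝ} (hu : ContDiff ℝ 3 u) (hK : 0 ≤ K) (hr : 0 ≤ r) (hD : ∀ x ∈ ball (0 : EE n) r, DI u K x) :
    |J 3 r (LY u)| ≤ K * r * (J 3 r (gr2 u) + J 3 r (hs2 u)) := by
  have c1 := cont_gr2 hu
  have c2 := cont_hs2 hu
  have c3 := cont_LY hu
  rw [← J_add (by norm_num) r c1 c2, ← J_const_mul]
  refine (J_abs_le hu _ _ _).trans (J_mono (by norm_num) hr (by fun_prop) (by fun_prop) fun x hx => ?_)
  exact LY_abs_le hK (hD x hx) (by simpa using (mem_ball_zero_iff.1 hx).le)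

lemma J_CS {u : EE n → ℝ} (hu : ContDiff ℝ 3 u) : J 2 r (VY u) ^ 2 ≤ J 2 r (gr2 u) * J 2 r (YY u) := by
  have c1 := cont_gr2 hu
  have c2 := cont_YY hu
  have c3 := cont_VY hu
  have key : ∀ t : ℝ, 0 ≤ J 2 r (gr2 u) * (t * t) + (2 * J 2 r (VY u)) * t + J 2 r (YY u) := by
    intro t
    have e : J 2 r (fun x => ((t * t) * gr2 u x + (2 * t) * VY u x) + YY u x)
        = J 2 r (gr2 u) * (t * t) + (2 * J 2 r (VY u)) * t + J 2 r (YY u) := by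
      rw [J_add (by norm_num) r (by fun_prop) c2, J_add (by norm_num) r (by fun_prop) (by fun_prop),
        J_const_mul, J_const_mul]
      ring
    rw [← e]
    refine J_nonneg _ _ fun x => ?_
    have : (t * t) * gr2 u x + (2 * t) * VY u x + YY u x = ∑ i, (t * pd i u x + Yf u i x) ^ 2 := by
      unfold gr2 VY YY
      rw [Finset.mul_sum, Finset.mul_sum, ← Finset.sum_add_distrib, ← Finset.sum_add_distrib]
      exact Finset.sum_congr rfl fun i _ => by ring
    rw [this]
    exact Finset.sum_nonneg fun _ _ => sq_nonneg _
  have := discrim_le_zero key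
  unfold discrim at this
  nlinarith

/-- weighted height -/
def Hf (u : EE n → ℝ) (r : ℝ) : ℝ := J 2 r (gr2 u)
/-- weighted energy -/
def If (u : EE n → ℝ) (r : ℝ) : ℝ := J 3 r (hs2 u) + J 3 r (vd u)

lemma Hf_deriv {u : EE n → ℝ} (hu : ContDiff ℝ 3 u) (r : ℝ) : HasDerivAt (Hf u) (4 * r * J 1 r (gr2 u)) r := by
  have := J_hasDerivAt 0 (cont_gr2 hu) r
  norm_num at this
  exact this

lemma If_deriv {u : EE n → ℝ} (hu : ContDiff ℝ 3 u) (r : ℝ) : HasDerivAt (If u) (6 * r * J 2 r (hs2 u) + 6 * r * J 2 r (vd u)) r := by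
  have h1 := J_hasDerivAt 1 (cont_hs2 hu) r
  have h2 := J_hasDerivAt 1 (cont_vd hu) r
  norm_num at h1 h2
  exact h1.add h2

lemma Hf_id {u : EE n → ℝ} (hu : ContDiff ℝ 3 u) (hr : 0 ≤ r) : 4 * r ^ 2 * J 1 r (gr2 u) = (4 + n) * Hf u r + If u r / 3 := by
  have h1 := J_split 1 (by norm_num) hr (cont_gr2 hu)
  have h2 := Id2 hu r
  have h3 := Id1 hu r
  norm_num at h1
  unfold Hf If
  nlinarith

set_option maxHeartbeats 1000000 in
lemma freq_ineqs {u : EE n → ℝ} (hu : ContDiff ℝ 3 u) (hK : 0 ≤ K) (hr : 0 ≤ r) (hr1 : r ≤ 1) (hKr : K * r ≤ 1)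
    (hD : ∀ x ∈ ball (0 : EE n) r, DI u K x) :
    Hf u r ≤ If u r + (8 + n) / 4 * Hf u r ∧
    If u r ^ 2 / 3 + ((4 + n) * If u r - r * K * (33 + 3 * n) * (If u r + (8 + n) / 4 * Hf u r)) * Hf u r
      ≤ r * (6 * r * J 2 r (hs2 u) + 6 * r * J 2 r (vd u)) * Hf u r := by
  have c1 := cont_gr2 hu
  have c2 := cont_hs2 hu
  have c3 := cont_vd hu
  have hH0 : 0 ≤ Hf u r := J_nonneg _ _ (gr2_nonneg u)
  have hD0 : 0 ≤ J 3 r (hs2 u) := J_nonneg _ _ (hs2_nonneg u)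
  have hG0 : 0 ≤ J 3 r (gr2 u) := J_nonneg _ _ (gr2_nonneg u)
  have hG1 : J 3 r (gr2 u) ≤ Hf u r := by
    refine (J_succ_le 2 (by norm_num) r c1 (gr2_nonneg u)).trans ?_
    have : r ^ 2 ≤ 1 := by nlinarith
    unfold Hf at *
    nlinarith
  have hid := Hf_id hu hr
  have hvb := J_vd_bound hu hK hr hD
  have hLY := J_LY_bound hu hK hr hD
  have h3 : |J 3 r (vd u)| ≤ r ^ 2 * J 2 r (fun x => |vd u x|) :=
    (J_abs_le hu _ _ _).trans (J_succ_le 2 (by norm_num) r (by fun_prop) (fun x => abs_nonneg _))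
  have h2 : |r ^ 2 * J 2 r (vd u)| ≤ r ^ 2 * J 2 r (fun x => |vd u x|) := by
    rw [abs_mul, abs_of_nonneg (sq_nonneg r)]
    exact mul_le_mul_of_nonneg_left (J_abs_le hu _ _ _) (sq_nonneg r)
  have hrI : r * (6 * r * J 2 r (hs2 u) + 6 * r * J 2 r (vd u))
      = (4 + n) * If u r + 12 * J 2 r (YY u)
        + (-(4 + n) * J 3 r (vd u) - 2 * J 3 r (LY u) + 6 * (r ^ 2 * J 2 r (vd u))) := by
    have e1 := J_split 2 (by norm_num) hr c2
    have e2 := Id3 hu r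
    norm_num at e1
    unfold If
    nlinarith
  have hCS : If u r ^ 2 ≤ 36 * (Hf u r * J 2 r (YY u)) := by
    have := J_CS hu (r := r)
    have h1 : If u r = 6 * J 2 r (VY u) := Id1 hu r
    rw [h1]; unfold Hf; nlinarith
  have hI : If u r = J 3 r (hs2 u) + J 3 r (vd u) := rfl
  have hn : (0:ℝ) ≤ n := Nat.cast_nonneg n
  generalize J 3 r (hs2 u) = D at *
  generalize J 3 r (gr2 u) = G at *
  generalize J 3 r (vd u) = W at *
  generalize J 3 r (LY u) = L at *
  generalize hS : r ^ 2 * J 2 r (fun x => |vd u x|) = S at *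
  generalize r ^ 2 * J 2 r (vd u) = W2 at *
  generalize J 2 r (YY u) = Y at *
  generalize Hf u r = H at *
  generalize If u r = I at *
  have hS0 : 0 ≤ r ^ 2 * J 1 r (gr2 u) + (G + D) := by
    have : 0 ≤ J 1 r (gr2 u) := J_nonneg _ _ (gr2_nonneg u)
    positivity
  have eS : r ^ 2 * J 1 r (gr2 u) + (G + D) ≤ I / 12 + (8 + n) / 4 * H + D := by nlinarith
  generalize r ^ 2 * J 1 r (gr2 u) + (G + D) = S' at *
  have hKr0 : 0 ≤ r * K := by positivity
  have hW : |W| ≤ S' / 2 := by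
    have : r * K / 2 * S' ≤ 1 / 2 * S' := by gcongr; linarith
    linarith
  have hDI : D ≤ 25 / 12 * I + (8 + n) / 4 * H := by
    have := neg_abs_le W; linarith
  have hnH : 0 ≤ n * H := by positivity
  have hT : H ≤ I + (8 + n) / 4 * H := by nlinarith
  refine ⟨hT, ?_⟩
  rw [hrI]
  set T := I + (8 + n) / 4 * H with hTdef
  have hDT : D ≤ 25 / 12 * T := by nlinarith
  have hST : S' ≤ 13 / 6 * T := by nlinarith
  have hGD : G + D ≤ 37 / 12 * T := by linarith
  have hT0 : 0 ≤ T := hH0.trans hT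
  have b1 : |W| ≤ r * K / 2 * (13 / 6 * T) := (h3.trans hvb).trans (by gcongr)
  have b2 : |W2| ≤ r * K / 2 * (13 / 6 * T) := (h2.trans hvb).trans (by gcongr)
  have b3 : |L| ≤ K * r * (37 / 12 * T) := hLY.trans (by gcongr)
  have hErr : -(r * K * (33 + 3 * n) * T) ≤ -(4 + n) * W - 2 * L + 6 * W2 := by
    have i1 : -((4 + n) * (r * K / 2 * (13 / 6 * T))) ≤ -(4 + n) * W := by
      have := mul_le_mul_of_nonneg_left ((le_abs_self W).trans b1) (by positivity : (0:ℝ) ≤ 4 + n)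
      linarith
    have i2 := (le_abs_self L).trans b3
    have i3 := (neg_abs_le W2)
    have j1 : 0 ≤ r * K * T := by positivity
    have j2 : 0 ≤ n * (r * K * T) := by positivity
    linarith
  have hErr' := mul_le_mul_of_nonneg_right hErr hH0
  nlinarith

end


/-- doubling exponent -/
def Gam (u : EE n → ℝ) (R : ℝ) : ℝ :=
  (4 + n) + Real.exp (33 + 3 * n) * (If u R / Hf u R + (8 + n) / 4)

section
variable {K R : ℝ}

lemma Hf_nonneg {u : EE n → ℝ} (hu : ContDiff ℝ 3 u) (r : ℝ) : 0 ≤ Hf u r := J_nonneg _ _ (gr2_nonneg u)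

lemma freq_mono {u : EE n → ℝ} (hu : ContDiff ℝ 3 u) (hK : 0 ≤ K) (hR1 : R ≤ 1) (hKR : K * R ≤ 1)
    (hD : ∀ x ∈ ball (0 : EE n) R, DI u K x) {r0 : ℝ} (hr0 : 0 < r0)
    (hpos : ∀ r ∈ Icc r0 R, 0 < Hf u r) :
    MonotoneOn (fun r => Real.exp (K * (33 + 3 * n) * r) * (If u r / Hf u r + (8 + n) / 4)) (Icc r0 R) := by
  have hder : ∀ r ∈ Icc r0 R, HasDerivAt
      (fun r => Real.exp (K * (33 + 3 * n) * r) * (If u r / Hf u r + (8 + n) / 4))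
      (Real.exp (K * (33 + 3 * n) * r) * (K * (33 + 3 * n)) * (If u r / Hf u r + (8 + n) / 4)
        + Real.exp (K * (33 + 3 * n) * r) * (((6 * r * J 2 r (hs2 u) + 6 * r * J 2 r (vd u)) * Hf u r
          - If u r * (4 * r * J 1 r (gr2 u))) / Hf u r ^ 2)) r := by
    intro r hr
    have h1 := (If_deriv hu r).div (Hf_deriv hu r) (hpos r hr).ne'
    have h2 : HasDerivAt (fun r => Real.exp (K * (33 + 3 * n) * r))
      (Real.exp (K * (33 + 3 * n) * r) * (K * (33 + 3 * n))) r := by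
      have := ((hasDerivAt_id r).const_mul (K * (33 + 3 * (n:ℝ)))).exp
      simpa using this
    exact h2.mul (h1.add_const _)
  refine monotoneOn_of_deriv_nonneg (convex_Icc _ _)
    (fun r hr => (hder r hr).continuousAt.continuousWithinAt)
    (fun r hr => (hder r (interior_subset hr)).differentiableAt.differentiableWithinAt) ?_
  intro r hr
  have hr := interior_subset hr
  rw [(hder r hr).deriv]
  have hr' : 0 < r := hr0.trans_le hr.1
  have hH := hpos r hr
  obtain ⟨h1, h2⟩ := freq_ineqs hu hK hr'.le (hr.2.trans hR1)
    ((mul_le_mul_of_nonneg_left hr.2 hK).trans hKR)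
    (fun x hx => hD x (ball_subset_ball hr.2 hx))
  have hid := Hf_id hu hr'.le (r := r)
  have e : (Real.exp (K * (33 + 3 * n) * r) * (K * (33 + 3 * n)) * (If u r / Hf u r + (8 + n) / 4)
        + Real.exp (K * (33 + 3 * n) * r) * (((6 * r * J 2 r (hs2 u) + 6 * r * J 2 r (vd u)) * Hf u r
          - If u r * (4 * r * J 1 r (gr2 u))) / Hf u r ^ 2))
     = Real.exp (K * (33 + 3 * n) * r) / (r * Hf u r ^ 2) *
      (r * K * (33 + 3 * n) * (If u r + (8 + n) / 4 * Hf u r) * Hf u r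
        + (r * (6 * r * J 2 r (hs2 u) + 6 * r * J 2 r (vd u)) * Hf u r
          - If u r * (4 * r ^ 2 * J 1 r (gr2 u)))) := by
    field_simp
  rw [e, hid]
  refine mul_nonneg (by positivity) ?_
  nlinarith

lemma dbl_aux {u : EE n → ℝ} (hu : ContDiff ℝ 3 u) (hK : 0 ≤ K) (hR1 : R ≤ 1) (hKR : K * R ≤ 1)
    (hD : ∀ x ∈ ball (0 : EE n) R, DI u K x) {r0 Γ : ℝ} (hr0 : 0 < r0) (hrR : r0 ≤ R)
    (hpos : ∀ r ∈ Icc r0 R, 0 < Hf u r) (hΓ : Gam u R ≤ Γ) :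
    AntitoneOn (fun r => Hf u r * r ^ (-Γ)) (Icc r0 R) := by
  have hn : (0:ℝ) ≤ n := Nat.cast_nonneg n
  have hmono := freq_mono hu hK hR1 hKR hD hr0 hpos
  have hN : ∀ r ∈ Icc r0 R, 0 ≤ If u r / Hf u r + (8 + n) / 4 ∧
      (4 + n) * Hf u r + If u r / 3 ≤ Γ * Hf u r := by
    intro r hr
    have hr' : 0 < r := hr0.trans_le hr.1
    have hH := hpos r hr
    have hR0 : 0 < R := hr0.trans_le hrR
    have hNn : ∀ r ∈ Icc r0 R, 0 ≤ If u r / Hf u r + (8 + n) / 4 := by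
      intro r hr
      have hr' : 0 < r := hr0.trans_le hr.1
      have hH := hpos r hr
      obtain ⟨h1, -⟩ := freq_ineqs hu hK hr'.le (hr.2.trans hR1)
        ((mul_le_mul_of_nonneg_left hr.2 hK).trans hKR)
        (fun x hx => hD x (ball_subset_ball hr.2 hx))
      have : If u r / Hf u r + (8 + n) / 4 = (If u r + (8 + n) / 4 * Hf u r) / Hf u r := by
        field_simp
      rw [this]
      exact div_nonneg (hH.le.trans h1) hH.le
    refine ⟨hNn r hr, ?_⟩
    have hm := hmono hr (right_mem_Icc.2 hrR) hr.2
    simp only at hm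
    have h1 : If u r / Hf u r + (8 + n) / 4 ≤ Γ - (4 + n) := by
      calc If u r / Hf u r + (8 + n) / 4
          ≤ Real.exp (K * (33 + 3 * n) * r) * (If u r / Hf u r + (8 + n) / 4) := by
            refine le_mul_of_one_le_left (hNn r hr) (Real.one_le_exp (by positivity))
        _ ≤ _ := hm
        _ ≤ Real.exp (33 + 3 * n) * (If u R / Hf u R + (8 + n) / 4) := by
            refine mul_le_mul_of_nonneg_right (Real.exp_le_exp.2 ?_) (hNn R (right_mem_Icc.2 hrR))
            nlinarith [mul_le_mul_of_nonneg_right hKR (by positivity : (0:ℝ) ≤ 33 + 3 * n)]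
        _ ≤ _ := by unfold Gam at hΓ; linarith
    have h2 : If u r ≤ (Γ - (4 + n) - (8 + n) / 4) * Hf u r := by
      rw [← div_le_iff₀ hH]; linarith
    have h3 : 0 ≤ Γ - (4 + n) := (hNn r hr).trans h1
    have h4 : If u r / 3 ≤ (Γ - (4 + n)) * Hf u r := by
      have : 0 ≤ (Γ - (4 + n)) * Hf u r := by positivity
      have : 0 ≤ (8 + n) / 4 * Hf u r := by positivity
      nlinarith
    linarith
  have hder : ∀ r ∈ Icc r0 R, HasDerivAt (fun r => Hf u r * r ^ (-Γ))
      (4 * r * J 1 r (gr2 u) * r ^ (-Γ) + Hf u r * (-Γ * r ^ (-Γ - 1))) r := by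
    intro r hr
    exact (Hf_deriv hu r).mul (Real.hasDerivAt_rpow_const (Or.inl (hr0.trans_le hr.1).ne'))
  refine antitoneOn_of_deriv_nonpos (convex_Icc _ _)
    (fun r hr => (hder r hr).continuousAt.continuousWithinAt)
    (fun r hr => (hder r (interior_subset hr)).differentiableAt.differentiableWithinAt) ?_
  intro r hr
  have hr := interior_subset hr
  rw [(hder r hr).deriv]
  have hr' : 0 < r := hr0.trans_le hr.1
  have hid := Hf_id hu hr'.le (r := r)
  have h2 := (hN r hr).2
  have hp : r ^ (-Γ) = r ^ (-Γ - 1) * r := by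
    rw [← Real.rpow_add_one hr'.ne']; congr 1; ring
  rw [hp]
  have : 4 * r * J 1 r (gr2 u) * (r ^ (-Γ - 1) * r) + Hf u r * (-Γ * r ^ (-Γ - 1))
     = r ^ (-Γ - 1) * (4 * r ^ 2 * J 1 r (gr2 u) - Γ * Hf u r) := by ring
  rw [this]
  exact mul_nonpos_of_nonneg_of_nonpos (by positivity) (by linarith)

/-- Doubling. -/
theorem doubling {u : EE n → ℝ} (hu : ContDiff ℝ 3 u) (hK : 0 ≤ K) (hR1 : R ≤ 1) (hKR : K * R ≤ 1)
    (hD : ∀ x ∈ ball (0 : EE n) R, DI u K x) (hHR : 0 < Hf u R) {Γ : ℝ} (hΓ : Gam u R ≤ Γ)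
    {r r' : ℝ} (hr : 0 < r) (hrr : r ≤ r') (hrR : r' ≤ R) :
    0 < Hf u r ∧ Hf u r' * (r / r') ^ Γ ≤ Hf u r := by
  have hcont : Continuous (Hf u) := continuous_iff_continuousAt.2 fun r => (Hf_deriv hu r).continuousAt
  have key : ∀ s, 0 < s → s ≤ R → (∀ t ∈ Icc s R, 0 < Hf u t) := by
    intro s hs hsR
    by_contra hcon
    push Not at hcon
    obtain ⟨t, ht, hHt⟩ := hcon
    set Z := {t ∈ Icc s R | Hf u t ≤ 0} with hZ
    have hZc : IsCompact Z := by
      have : Z = Icc s R ∩ Hf u ⁻¹' Iic 0 := rfl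
      rw [this]
      exact isCompact_Icc.inter_right (isClosed_Iic.preimage hcont)
    obtain ⟨m, hm, hmax⟩ := hZc.exists_isGreatest ⟨t, ht, hHt⟩
    have hmR : m < R := lt_of_le_of_ne hm.1.2 (fun h => by rw [h] at hm; exact absurd hm.2 (not_le.2 hHR))
    have hm0 : 0 < m := hs.trans_le hm.1.1
    have hlow : ∀ t ∈ Ioc m R, Hf u R * (R ^ (-Γ)) ≤ Hf u t * t ^ (-Γ) := by
      intro t ht
      have ht0 : 0 < t := hm0.trans ht.1
      refine dbl_aux hu hK hR1 hKR hD ht0 ht.2 ?_ hΓ (left_mem_Icc.2 ht.2) (right_mem_Icc.2 ht.2) ht.2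
      intro τ hτ
      by_contra h
      exact absurd (hmax (show τ ∈ Z from ⟨⟨hm.1.1.trans (ht.1.le.trans hτ.1), hτ.2⟩, not_lt.1 h⟩))
        (not_le.2 (ht.1.trans_le hτ.1))
    have hlim : Tendsto (fun t => Hf u t * t ^ (-Γ)) (𝓝[>] m) (𝓝 (Hf u m * m ^ (-Γ))) := by
      have : ContinuousAt (fun t => Hf u t * t ^ (-Γ)) m :=
        hcont.continuousAt.mul (Real.continuousAt_rpow_const _ _ (Or.inl hm0.ne'))
      exact this.tendsto.mono_left nhdsWithin_le_nhds
    have h5 : Hf u R * (R ^ (-Γ)) ≤ Hf u m * m ^ (-Γ) := by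
      refine ge_of_tendsto hlim ?_
      filter_upwards [Ioc_mem_nhdsGT hmR] with t ht using hlow t ht
    have h6 : Hf u m * m ^ (-Γ) ≤ 0 := mul_nonpos_of_nonpos_of_nonneg hm.2 (by positivity)
    have h7 : 0 < Hf u R * (R ^ (-Γ)) := by
      have : 0 < R := hm0.trans hmR
      positivity
    linarith
  have hp := key r hr (hrr.trans hrR)
  refine ⟨hp r (left_mem_Icc.2 (hrr.trans hrR)), ?_⟩
  have h := dbl_aux hu hK hR1 hKR hD hr (hrr.trans hrR) hp hΓ (left_mem_Icc.2 (hrr.trans hrR))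
    ⟨hrr, hrR⟩ hrr
  simp only at h
  have hr'0 : 0 < r' := hr.trans_le hrr
  rw [Real.div_rpow hr.le hr'0.le]
  rw [Real.rpow_neg hr.le, Real.rpow_neg hr'0.le] at h
  have a1 : 0 < r ^ Γ := by positivity
  have a2 : 0 < r' ^ Γ := by positivity
  rw [← div_eq_mul_inv, ← div_eq_mul_inv, div_le_div_iff₀ a2 a1] at h
  rw [mul_div_assoc', div_le_iff₀ a2]
  exact h
end


lemma hasDerivAt_line {g : EE n → ℝ} {x : EE n} (j : Fin n) (s : ℝ)
    (hg : DifferentiableAt ℝ g (x + s • ee j)) :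
    HasDerivAt (fun t : ℝ => g (x + t • ee j)) (pd j g (x + s • ee j)) s := by
  have h1 : HasDerivAt (fun t : ℝ => x + t • (ee j : EE n)) (ee j) s := by
    simpa using ((hasDerivAt_id s).smul_const (ee j : EE n)).const_add x
  exact hg.hasFDerivAt.comp_hasDerivAt s h1

lemma pd_pd_nonpos_of_isLocalMax {g : EE n → ℝ} (hg : ContDiff ℝ 2 g) {x : EE n}
    (h : IsLocalMax g x) (j : Fin n) : pd j (pd j g) x ≤ 0 := by
  by_contra hc
  push Not at hc
  set φ : ℝ → ℝ := fun t => g (x + t • ee j) with hφ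
  have h1 : ∀ s, HasDerivAt φ (pd j g (x + s • ee j)) s := fun s =>
    hasDerivAt_line j s (hg.differentiable (by norm_num) _)
  have h2 : deriv φ = fun s => pd j g (x + s • ee j) := funext fun s => (h1 s).deriv
  have hc1 : ContDiff ℝ 1 (pd j g) := contDiff_pd hg (by norm_num) j
  have h3 : deriv (deriv φ) 0 = pd j (pd j g) x := by
    rw [h2]
    have := (hasDerivAt_line (g := pd j g) (x := x) j 0 (hc1.differentiable (by norm_num) _)).deriv
    simpa using this
  have hmax : IsLocalMax φ 0 := by
    have hc : ContinuousAt (fun t : ℝ => x + t • (ee j : EE n)) 0 := by fun_prop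
    have := hc.tendsto
    simp only [zero_smul, add_zero] at this
    have h4 := this.eventually h
    filter_upwards [h4] with t ht
    simpa [hφ] using ht
  have hmin : IsLocalMin φ 0 := isLocalMin_of_deriv_deriv_pos (by rw [h3]; exact hc)
    hmax.deriv_eq_zero (h1 0).continuousAt
  have hconst : φ =ᶠ[𝓝 0] fun _ => φ 0 := by
    filter_upwards [hmax, hmin] with t h1 h2 using le_antisymm h1 h2
  have : deriv φ =ᶠ[𝓝 0] fun _ => 0 := by
    have := hconst.deriv
    simpa using this
  have := this.deriv_eq
  rw [h3] at this
  simp at this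
  linarith

/-- reflection in the j-th coordinate -/
def rfx (j : Fin n) (x : EE n) : EE n := x - (2 * x j) • ee j

lemma rfx_apply_self (j : Fin n) (x : EE n) : rfx j x j = - x j := by
  simp [rfx]; ring
lemma rfx_apply_ne {j k : Fin n} (h : k ≠ j) (x : EE n) : rfx j x k = x k := by
  simp [rfx, h]

lemma norm_rfx (j : Fin n) (x : EE n) : ‖rfx j x‖ = ‖x‖ := by
  have : ‖rfx j x‖ ^ 2 = ‖x‖ ^ 2 := by
    rw [← sum_sq_eq_norm, ← sum_sq_eq_norm]
    refine Finset.sum_congr rfl fun k _ => ?_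
    by_cases h : k = j
    · subst h; rw [rfx_apply_self]; ring
    · rw [rfx_apply_ne h]
  exact (sq_eq_sq₀ (norm_nonneg _) (norm_nonneg _)).1 this

lemma contDiff_rfx (j : Fin n) {k : WithTop ℕ∞} : ContDiff ℝ k (rfx j : EE n → EE n) :=
  contDiff_id.sub ((contDiff_const.mul (contDiff_coord j)).smul contDiff_const)

lemma pd_rfx {g : EE n → ℝ} {x : EE n} (j k : Fin n) (hg : DifferentiableAt ℝ g (rfx j x)) :
    pd k (fun y => g (rfx j y)) x = (if k = j then -1 else 1) * pd k g (rfx j x) := by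
  have h1 : HasFDerivAt (rfx j : EE n → EE n) (ContinuousLinearMap.id ℝ (EE n) -
      ((2 : ℝ) • (EuclideanSpace.proj j : EE n →L[ℝ] ℝ)).smulRight (ee j)) x := by
    have := (hasFDerivAt_id x).sub (((hasFDerivAt_coord j x).const_mul 2).smul_const (ee j : EE n))
    exact this
  have h2 := hg.hasFDerivAt.comp x h1
  have h3 : pd k (fun y => g (rfx j y)) x = _ := hasFDerivAt_pd_eq h2 k
  rw [h3]
  by_cases h : k = j
  · subst h
    have : (ee k : EE n) - (2 : ℝ) • ee k = - ee k := by
      rw [two_smul]; abel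
    simp [pd, two_smul]
    ring
  · have : (ee k : EE n) j = 0 := by simp [Ne.symm h]
    simp [pd, h]

lemma lap_rfx {g : EE n → ℝ} (hg : ContDiff ℝ 2 g) (j : Fin n) (x : EE n) :
    lap (fun y => g (rfx j y)) x = lap g (rfx j x) := by
  unfold lap
  refine Finset.sum_congr rfl fun k _ => ?_
  have h1 : pd k (fun y => g (rfx j y)) = fun x => (if k = j then -1 else 1) * pd k g (rfx j x) :=
    funext fun x => pd_rfx j k (hg.differentiable (by norm_num) _)
  have hc1 : ContDiff ℝ 1 (pd k g) := contDiff_pd hg (by norm_num) k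
  have hc2 : DifferentiableAt ℝ (fun y => pd k g (rfx j y)) x :=
    (hc1.comp (contDiff_rfx j)).differentiable (by norm_num) x
  rw [h1, pd_const_mul _ hc2,
    pd_rfx j k (hc1.differentiable (by norm_num) _)]
  split_ifs <;> ring

lemma lap_add {f g : EE n → ℝ} (hf : ContDiff ℝ 2 f) (hg : ContDiff ℝ 2 g) (x : EE n) :
    lap (fun y => f y + g y) x = lap f x + lap g x := by
  unfold lap
  rw [← Finset.sum_add_distrib]
  refine Finset.sum_congr rfl fun k _ => ?_
  rw [show pd k (fun y => f y + g y) = fun y => pd k f y + pd k g y from funext fun y =>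
    pd_add (hf.differentiable (by norm_num) y) (hg.differentiable (by norm_num) y) k]
  exact pd_add ((contDiff_pd (m := 1) hf (by norm_num) k).differentiable (by norm_num) x)
    ((contDiff_pd (m := 1) hg (by norm_num) k).differentiable (by norm_num) x) k

lemma lap_const_mul {f : EE n → ℝ} (c : ℝ) (hf : ContDiff ℝ 2 f) (x : EE n) :
    lap (fun y => c * f y) x = c * lap f x := by
  unfold lap
  rw [Finset.mul_sum]
  refine Finset.sum_congr rfl fun k _ => ?_
  rw [show pd k (fun y => c * f y) = fun y => c * pd k f y from funext fun y =>
    pd_const_mul c (hf.differentiable (by norm_num) y) k]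
  exact pd_const_mul c ((contDiff_pd (m := 1) hf (by norm_num) k).differentiable (by norm_num) x) k

lemma lap_normsq (x : EE n) : lap (fun y : EE n => ‖y‖ ^ 2) x = 2 * n := by
  unfold lap
  have : ∀ k : Fin n, pd k (pd k (fun y : EE n => ‖y‖ ^ 2)) x = 2 := by
    intro k
    rw [show pd k (fun y : EE n => ‖y‖ ^ 2) = fun y => 2 * y k from funext (pd_normsq k),
      pd_const_mul 2 (hasFDerivAt_coord k x).differentiableAt, pd_coord]
    simp
  simp [this]; ring

lemma lap_coord (j : Fin n) (x : EE n) : lap (fun y : EE n => y j) x = 0 := by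
  unfold lap
  refine Finset.sum_eq_zero fun k _ => ?_
  rw [show pd k (fun y : EE n => y j) = fun _ => if j = k then 1 else 0 from funext (pd_coord j k),
    pd_const]

lemma lap_coord_sq (j : Fin n) (x : EE n) : lap (fun y : EE n => (y j) ^ 2) x = 2 := by
  unfold lap
  have : ∀ k : Fin n, pd k (pd k (fun y : EE n => (y j) ^ 2)) x = if j = k then 2 else 0 := by
    intro k
    rw [show pd k (fun y : EE n => (y j) ^ 2) = fun y => (2 * (if j = k then 1 else 0)) * y j from
      funext fun y => by
        rw [pd_sq (hasFDerivAt_coord j y).differentiableAt, pd_coord]; ring,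
      pd_const_mul _ (hasFDerivAt_coord j x).differentiableAt, pd_coord]
    split_ifs <;> simp
  simp [this]

/-- one-sided gradient bound at the origin -/
lemma grad_est_aux {v : EE n → ℝ} (hv : ContDiff ℝ 2 v) {d M F : ℝ} (hd : 0 < d)
    (hM : ∀ x ∈ closedBall (0 : EE n) d, |v x| ≤ M) (hF : ∀ x ∈ ball (0 : EE n) d, |lap v x| ≤ F)
    (j : Fin n) : pd j v 0 ≤ 2 * n * M / d + F * d := by
  refine le_of_forall_pos_le_add fun e he => ?_
  set K : ℝ := n * M / d ^ 2 + F / 2 + e / (2 * d) with hKdef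
  have hM0 : 0 ≤ M := (abs_nonneg _).trans (hM 0 (by simp [hd.le]))
  have hF0 : 0 ≤ F := (abs_nonneg _).trans (hF 0 (by simp [hd]))
  have hK0 : 0 ≤ K := by positivity
  -- the comparison function
  set ψ : EE n → ℝ := fun x => (((1/2) * v x + (-1/2) * v (rfx j x)) + (-M / d ^ 2) * ‖x‖ ^ 2)
    + ((-2 * d * K) * x j + K * (x j) ^ 2) with hψ
  have c1 : ContDiff ℝ 2 (fun x => (1/2) * v x) := contDiff_const.mul hv
  have c2 : ContDiff ℝ 2 (fun x => v (rfx j x)) := hv.comp (contDiff_rfx j)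
  have c2' : ContDiff ℝ 2 (fun x => (-1/2) * v (rfx j x)) := contDiff_const.mul c2
  have c3 : ContDiff ℝ 2 (fun x : EE n => ‖x‖ ^ 2) := contDiff_norm_sq ℝ
  have c3' : ContDiff ℝ 2 (fun x : EE n => (-M / d ^ 2) * ‖x‖ ^ 2) := contDiff_const.mul c3
  have c4 : ContDiff ℝ 2 (fun x : EE n => x j) := contDiff_coord j
  have c4' : ContDiff ℝ 2 (fun x : EE n => (-2 * d * K) * x j) := contDiff_const.mul c4
  have c5 : ContDiff ℝ 2 (fun x : EE n => (x j) ^ 2) := c4.pow 2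
  have c5' : ContDiff ℝ 2 (fun x : EE n => K * (x j) ^ 2) := contDiff_const.mul c5
  have hψc : ContDiff ℝ 2 ψ := ((c1.add c2').add c3').add (c4'.add c5')
  have hlap : ∀ x, lap ψ x = (1/2) * lap v x + (-1/2) * lap v (rfx j x) + (-M / d ^ 2) * (2 * n)
      + K * 2 := by
    intro x
    rw [hψ, lap_add ((c1.add c2').add c3') (c4'.add c5'), lap_add (c1.add c2') c3', lap_add c1 c2',
      lap_add c4' c5', lap_const_mul _ hv, lap_const_mul _ c2, lap_const_mul _ c3,
      lap_const_mul _ c4, lap_const_mul _ c5, lap_rfx hv, lap_normsq, lap_coord, lap_coord_sq]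
    ring
  set G : Set (EE n) := closedBall 0 d ∩ {x | 0 ≤ x j} with hG
  have hcc : Continuous (fun x : EE n => x j) := c4.continuous
  have hGc : IsCompact G := (isCompact_closedBall 0 d).inter_right (isClosed_le continuous_const hcc)
  have h0G : (0 : EE n) ∈ G := ⟨by simp [hd.le], by simp⟩
  obtain ⟨x0, hx0, hmax⟩ := hGc.exists_isMaxOn ⟨0, h0G⟩ hψc.continuous.continuousOn
  have hneg : ψ x0 ≤ 0 := by
    by_contra hpos
    push Not at hpos
    have hx0n : ‖x0‖ ≤ d := by simpa using hx0.1
    have hx0j : 0 ≤ x0 j := hx0.2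
    have hjn : x0 j ≤ ‖x0‖ := (le_abs_self _).trans (EuclideanSpace.norm_eq x0 ▸ by
      rw [← Real.sqrt_sq_eq_abs]
      refine Real.sqrt_le_sqrt ?_
      have := Finset.single_le_sum (f := fun i => ‖x0 i‖ ^ 2) (fun _ _ => sq_nonneg _) (Finset.mem_univ j)
      simpa using this)
    have hv1 := hM x0 hx0.1
    have hv2 := hM (rfx j x0) (by simpa [norm_rfx] using hx0n)
    have ht : 0 ≤ K * (x0 j * (2 * d - x0 j)) := by
      have : 0 ≤ 2 * d - x0 j := by linarith
      positivity
    have hlt : ‖x0‖ < d := by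
      refine lt_of_le_of_ne hx0n fun h => ?_
      have : ψ x0 ≤ 0 := by
        simp only [hψ, h]
        have e1 : -M / d ^ 2 * d ^ 2 = -M := by field_simp
        rw [e1]
        have a1 := le_abs_self (v x0)
        have a2 := neg_abs_le (v (rfx j x0))
        linarith
      linarith
    have hjt : 0 < x0 j := by
      refine lt_of_le_of_ne hx0j fun h => ?_
      have hr : rfx j x0 = x0 := by simp [rfx, ← h]
      have : ψ x0 ≤ 0 := by
        simp only [hψ, ← h, hr]
        have : 0 ≤ M / d ^ 2 * ‖x0‖ ^ 2 := by positivity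
        have e1 : -M / d ^ 2 * ‖x0‖ ^ 2 = - (M / d ^ 2 * ‖x0‖ ^ 2) := by ring
        rw [e1]
        nlinarith
      linarith
    have hloc : IsLocalMax ψ x0 := by
      have hnb : G ∈ 𝓝 x0 := by
        have h1 : ball (0 : EE n) d ∩ {x | 0 < x j} ∈ 𝓝 x0 :=
          (isOpen_ball.inter (isOpen_lt continuous_const hcc)).mem_nhds ⟨by simpa using hlt, hjt⟩
        refine mem_of_superset h1 fun y hy => ⟨ball_subset_closedBall hy.1, ?_⟩
        have hy2 : 0 < y j := hy.2
        exact hy2.le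
      exact hmax.isLocalMax hnb
    have hle : lap ψ x0 ≤ 0 := Finset.sum_nonpos fun k _ => pd_pd_nonpos_of_isLocalMax hψc hloc k
    rw [hlap] at hle
    have l1 := hF x0 (by simpa using hlt)
    have l2 := hF (rfx j x0) (by simpa [norm_rfx] using hlt)
    have e2 : -M / d ^ 2 * (2 * n) + K * 2 = F + e / d := by
      rw [hKdef]; field_simp; ring
    have : 0 < e / d := by positivity
    have a1 := neg_abs_le (lap v x0)
    have a2 := le_abs_self (lap v (rfx j x0))
    linarith
  -- derivative at zero
  have hψ0 : ψ 0 = 0 := by simp [hψ, rfx]; ring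
  have hder := hasDerivAt_line (g := ψ) (x := 0) j 0 (hψc.differentiable (by norm_num) _)
  have hpd : pd j ψ 0 = pd j v 0 - 2 * d * K := by
    have dd : ∀ {g : EE n → ℝ}, ContDiff ℝ 2 g → DifferentiableAt ℝ g 0 := fun h =>
      h.differentiable (by norm_num) 0
    rw [hψ, pd_add (dd ((c1.add c2').add c3')) (dd (c4'.add c5')), pd_add (dd (c1.add c2')) (dd c3'),
      pd_add (dd c1) (dd c2'), pd_add (dd c4') (dd c5'), pd_const_mul _ (dd hv), pd_const_mul _ (dd c2),
      pd_const_mul _ (dd c3), pd_const_mul _ (dd c4), pd_const_mul _ (dd c5), pd_normsq, pd_coord,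
      pd_sq (dd c4), pd_rfx _ _ (hv.differentiable (by norm_num) _)]
    simp [rfx]
    ring
  have hle : pd j ψ 0 ≤ 0 := by
    by_contra hpos
    push Not at hpos
    simp only [zero_smul, add_zero] at hder
    have hs := hder.tendsto_slope_zero_right
    have hev := hs.eventually (lt_mem_nhds hpos)
    have hev2 : ∀ᶠ t in 𝓝[>] (0:ℝ), t < d := by
      filter_upwards [Ioo_mem_nhdsGT hd] with t ht using ht.2
    obtain ⟨t, ⟨ht1, ht2⟩, ht3⟩ := ((hev.and hev2).and self_mem_nhdsWithin).exists
    have ht3 : 0 < t := ht3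
    simp only [zero_add, zero_smul, hψ0, sub_zero, smul_eq_mul] at ht1
    have hmem : t • (ee j : EE n) ∈ G := by
      refine ⟨?_, ?_⟩
      · simp [norm_smul, abs_of_pos ht3, ht2.le]
      · simp [ht3.le]
    have := hmax hmem
    have this : ψ (t • ee j) ≤ ψ x0 := this
    have h5 : 0 < ψ (t • ee j) := by
      have := mul_pos ht3 ht1
      rwa [mul_inv_cancel_left₀ ht3.ne'] at this
    linarith
  rw [hpd] at hle
  have e3 : 2 * d * K = 2 * n * M / d + F * d + e := by
    rw [hKdef]; field_simp
  linarith

lemma grad_est {v : EE n → ℝ} (hv : ContDiff ℝ 2 v) {p : EE n} {d M F : ℝ} (hd : 0 < d)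
    (hM : ∀ x ∈ closedBall p d, |v x| ≤ M) (hF : ∀ x ∈ ball p d, |lap v x| ≤ F)
    (j : Fin n) : |pd j v p| ≤ 2 * n * M / d + F * d := by
  have key : ∀ c : ℝ, |c| = 1 → c * pd j v p ≤ 2 * n * M / d + F * d := by
    intro c hc
    have h := grad_est_aux (v := fun y => c * v (p + (1:ℝ) • y)) (contDiff_rescale hv c 1 p) hd (M := M) (F := F)
      (fun x hx => by
        rw [abs_mul, hc, one_mul]; exact hM _ (by simpa using hx))
      (fun x hx => by
        rw [lap_rescale hv, abs_mul]; simp only [mul_one, hc, one_mul]; exact hF _ (by simpa using hx)) j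
    rw [pd_rescale _ _ _ _ _ _ (hv.differentiable (by norm_num) _)] at h
    simpa using h
  refine abs_le'.2 ⟨?_, ?_⟩
  · simpa using key 1 (by simp)
  · simpa using key (-1) (by simp)


lemma norm_fderiv_le_gr2 (g : EE n → ℝ) (x : EE n) : ‖fderiv ℝ g x‖ ≤ Real.sqrt (gr2 g x) := by
  refine ContinuousLinearMap.opNorm_le_bound _ (Real.sqrt_nonneg _) fun v => ?_
  rw [Real.norm_eq_abs]
  refine abs_le_of_sq_le_sq ?_ (by positivity)
  rw [mul_pow, Real.sq_sqrt (gr2_nonneg g x), fderiv_apply_eq_sum, ← sum_sq_eq_norm, mul_comm]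
  exact Finset.sum_mul_sq_le_sq_mul_sq _ _ _

lemma gr2_pd_le_hs2 (u : EE n → ℝ) (x : EE n) (i : Fin n) : gr2 (pd i u) x ≤ hs2 u x :=
  Finset.single_le_sum (f := fun i => gr2 (pd i u) x) (fun _ _ => gr2_nonneg _ _) (Finset.mem_univ i)

lemma pd_lip {u : EE n → ℝ} (hu : ContDiff ℝ 3 u) {s : Set (EE n)} (hs : Convex ℝ s) {B : ℝ}
    (hB : ∀ x ∈ s, Real.sqrt (hs2 u x) ≤ B) {x y : EE n} (hx : x ∈ s) (hy : y ∈ s) (i : Fin n) :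
    |pd i u y - pd i u x| ≤ B * ‖y - x‖ := by
  refine Convex.norm_image_sub_le_of_norm_fderiv_le (𝕜 := ℝ)
    (fun z _ => (u_c1 hu i).differentiable (by norm_num) z) (fun z hz => ?_) hs hx hy
  exact (norm_fderiv_le_gr2 _ _).trans ((Real.sqrt_le_sqrt (gr2_pd_le_hs2 u z i)).trans (hB z hz))

lemma sqrt_hs2_le {u : EE n → ℝ} {x : EE n} {b : ℝ} (hb : 0 ≤ b) (h : ∀ i j, |pd j (pd i u) x| ≤ b) :
    Real.sqrt (hs2 u x) ≤ n * b := by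
  rw [Real.sqrt_le_left (by positivity)]
  unfold hs2
  have : ∀ i j, (pd j (pd i u) x) ^ 2 ≤ b ^ 2 := fun i j => sq_le_sq' (abs_le.1 (h i j)).1 (abs_le.1 (h i j)).2
  calc ∑ i, ∑ j, (pd j (pd i u) x) ^ 2 ≤ ∑ _i : Fin n, ∑ _j : Fin n, b ^ 2 :=
        Finset.sum_le_sum fun i _ => Finset.sum_le_sum fun j _ => this i j
    _ = (n * b) ^ 2 := by simp; ring

lemma hess_est1 (hn : 0 < n) {u : EE n → ℝ} (hu : ContDiff ℝ 3 u) {ε M : ℝ} (he0 : 0 ≤ ε) (he : ε ≤ 1)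
    (hM : 0 ≤ M) (hD : ∀ x ∈ ball (0 : EE n) 1, DI u ε x)
    (hg : ∀ x ∈ ball (0 : EE n) 1, gr2 u x ≤ M ^ 2) {y : EE n} (hy : ‖y‖ ≤ 1) :
    (1 - ‖y‖) * Real.sqrt (hs2 u y) ≤ 17 * n ^ 3 * M := by
  have hc : Continuous (fun y : EE n => (1 - ‖y‖) * Real.sqrt (hs2 u y)) :=
    (continuous_const.sub continuous_norm).mul (cont_hs2 hu).sqrt
  obtain ⟨y0, hy0, hmax⟩ := (isCompact_closedBall (0 : EE n) 1).exists_isMaxOn ⟨0, by simp⟩ hc.continuousOn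
  refine (hmax (by simpa using hy : y ∈ closedBall (0 : EE n) 1)).trans ?_
  simp only
  set δ := 1 - ‖y0‖ with hδ
  set Q := δ * Real.sqrt (hs2 u y0) with hQ
  have hn1 : (1:ℝ) ≤ n := by exact_mod_cast hn
  have hδ0 : 0 ≤ δ := by have : ‖y0‖ ≤ 1 := by simpa using hy0
                         linarith
  rcases hδ0.eq_or_lt with h0 | hpos
  · rw [hQ, ← h0, zero_mul]; positivity
  have hδ1 : δ ≤ 1 := by rw [hδ]; linarith [norm_nonneg y0]
  have hQ0 : 0 ≤ Q := by positivity
  set θ : ℝ := 1 / (4 * n) with hθ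
  have hθ0 : 0 < θ := by positivity
  have hθ1 : θ ≤ 1 / 4 := by rw [hθ]; gcongr; linarith
  have hnear : ∀ z ∈ closedBall y0 (θ * δ), δ / 2 ≤ 1 - ‖z‖ := by
    intro z hz
    have h1 : ‖z‖ ≤ ‖y0‖ + θ * δ := by
      have := norm_le_norm_add_norm_sub y0 z
      have h2 : ‖z - y0‖ ≤ θ * δ := by simpa [dist_eq_norm] using hz
      have h3 := norm_le_norm_add_norm_sub' z y0
      linarith
    nlinarith
  have hin : ∀ z ∈ closedBall y0 (θ * δ), z ∈ ball (0 : EE n) 1 := fun z hz => by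
    have := hnear z hz
    simp; linarith
  have hh : ∀ z ∈ closedBall y0 (θ * δ), Real.sqrt (hs2 u z) ≤ 2 * Q / δ := by
    intro z hz
    have h1 := hnear z hz
    have h2 : (1 - ‖z‖) * Real.sqrt (hs2 u z) ≤ Q := hmax (ball_subset_closedBall (hin z hz))
    rw [le_div_iff₀ hpos]
    have h3 := mul_le_mul_of_nonneg_right h1 (Real.sqrt_nonneg (hs2 u z))
    linarith
  have hb : ∀ i j, |pd j (pd i u) y0| ≤ 2 * n * M / (θ * δ) + (M + 2 * Q / δ) * (θ * δ) := by
    intro i j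
    refine grad_est (u_c1 hu i) (by positivity) (fun x hx => ?_) (fun x hx => ?_) j
    · exact abs_le_of_sq_le_sq ((pd_sq_le_gr2 u x i).trans (hg x (hin x hx))) hM
    · have hx' := ball_subset_closedBall hx
      have h1 : 0 ≤ M + 2 * Q / δ := by positivity
      refine abs_le_of_sq_le_sq ?_ h1
      have h2 : (lap (pd i u) x) ^ 2 ≤ ε ^ 2 * (gr2 u x + hs2 u x) :=
        (Finset.single_le_sum (f := fun i => (lap (pd i u) x) ^ 2) (fun _ _ => sq_nonneg _)
          (Finset.mem_univ i)).trans (hD x (hin x hx'))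
      have h3 : hs2 u x ≤ (2 * Q / δ) ^ 2 := by
        rw [← Real.sqrt_le_left (by positivity)]; exact hh x hx'
      have h4 := hg x (hin x hx')
      have h5 : 0 ≤ M * (2 * Q / δ) := by positivity
      have h6 : ε ^ 2 ≤ 1 := by nlinarith
      have h7 : ε ^ 2 * (gr2 u x + hs2 u x) ≤ 1 * (gr2 u x + hs2 u x) :=
        mul_le_mul_of_nonneg_right h6 (add_nonneg (gr2_nonneg _ _) (hs2_nonneg _ _))
      nlinarith
  have h1 := sqrt_hs2_le (by positivity) hb
  have h2 : Q ≤ δ * (n * (2 * n * M / (θ * δ) + (M + 2 * Q / δ) * (θ * δ))) :=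
    mul_le_mul_of_nonneg_left h1 hδ0
  have h3 : δ * (n * (2 * n * M / (θ * δ) + (M + 2 * Q / δ) * (θ * δ)))
      = 8 * n ^ 3 * M + M * δ ^ 2 / 4 + Q * δ / 2 := by
    rw [hθ]; field_simp; ring
  have h4 : M * δ ^ 2 ≤ M := mul_le_of_le_one_right hM (pow_le_one₀ hδ0 hδ1)
  have h5 : Q * δ ≤ Q := by nlinarith
  have h6 : M ≤ n ^ 3 * M := le_mul_of_one_le_left hM (one_le_pow₀ hn1)
  linarith

lemma hess_est (hn : 0 < n) {u : EE n → ℝ} (hu : ContDiff ℝ 3 u) {p : EE n} {s K M : ℝ} (hs0 : 0 < s)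
    (hs : s ≤ 1) (hK : 0 ≤ K) (hKs : K * s ≤ 1) (hM : 0 ≤ M) (hD : ∀ x ∈ ball p s, DI u K x)
    (hg : ∀ x ∈ ball p s, gr2 u x ≤ M ^ 2) {y : EE n} (hy : y ∈ closedBall p (s / 2)) :
    s * Real.sqrt (hs2 u y) ≤ 34 * n ^ 3 * M := by
  have hmem : ∀ x ∈ ball (0 : EE n) 1, p + s • x ∈ ball p s := by
    intro x hx
    simp [norm_smul, abs_of_pos hs0] at hx ⊢
    exact mul_lt_of_lt_one_right hs0 hx
  set y' : EE n := s⁻¹ • (y - p) with hy'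
  have hyy : p + s • y' = y := by simp [hy', smul_smul, hs0.ne']
  have hyn : ‖y'‖ ≤ 1 / 2 := by
    rw [hy', norm_smul, norm_inv, Real.norm_eq_abs, abs_of_pos hs0]
    have : ‖y - p‖ ≤ s / 2 := by simpa [dist_eq_norm] using hy
    rw [inv_mul_le_iff₀ hs0]; linarith
  have h := hess_est1 hn (contDiff_rescale hu 1 s p) (ε := K * s) (M := s * M) (by positivity) hKs
    (by positivity) (fun x hx => DI_rescale hu 1 s (by rw [abs_of_pos hs0]; exact hs) p x (hD _ (hmem x hx)))
    (fun x hx => by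
      rw [gr2_rescale (hu.of_le (by norm_num)), one_mul, mul_pow]
      exact mul_le_mul_of_nonneg_left (hg _ (hmem x hx)) (by positivity)) (y := y') (by linarith)
  rw [hs2_rescale (hu.of_le (by norm_num)), hyy, Real.sqrt_mul (by positivity),
    Real.sqrt_sq (by positivity)] at h
  have h1 : (1/2 : ℝ) * (1 * s * s * Real.sqrt (hs2 u y)) ≤ 17 * n ^ 3 * (s * M) :=
    (mul_le_mul_of_nonneg_right (by linarith) (by positivity)).trans h
  have h2 : s * (s * Real.sqrt (hs2 u y)) ≤ s * (34 * n ^ 3 * M) := by linarith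
  exact le_of_mul_le_mul_left h2 hs0

/-- volume of unit ball -/
def om (n : ℕ) : ℝ := (volume (ball (0 : EE n) 1)).toReal

lemma om_pos (n : ℕ) : 0 < om n :=
  ENNReal.toReal_pos (measure_ball_pos _ _ one_pos).ne' measure_ball_lt_top.ne

lemma vol_ball (x : EE n) {r : ℝ} (hr : 0 < r) : (volume (ball x r)).toReal = r ^ n * om n := by
  rw [Measure.addHaar_ball_of_pos volume x hr, ENNReal.toReal_mul, om, ENNReal.toReal_ofReal (by positivity)]
  simp

lemma exists_big_pd (hn : 0 < n) (u : EE n → ℝ) (x : EE n) :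
    ∃ i, gr2 u x ≤ n ^ 2 * (pd i u x) ^ 2 := by
  by_contra h
  push Not at h
  have hn1 : (1:ℝ) ≤ n := by exact_mod_cast hn
  have : Nonempty (Fin n) := ⟨⟨0, hn⟩⟩
  have h1 : ∑ i : Fin n, (n:ℝ) ^ 2 * (pd i u x) ^ 2 < ∑ _i : Fin n, gr2 u x :=
    Finset.sum_lt_sum_of_nonempty Finset.univ_nonempty fun i _ => h i
  rw [← Finset.mul_sum] at h1
  simp at h1
  have h2 : (n:ℝ) ^ 2 * gr2 u x < n * gr2 u x := h1
  have h3 := gr2_nonneg u x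
  nlinarith [mul_nonneg (by linarith : (0:ℝ) ≤ n - 1) h3]

lemma sup_L2 (hn : 0 < n) : ∃ C : ℝ, 0 < C ∧ ∀ u : EE n → ℝ, ContDiff ℝ 3 u → ∀ ε : ℝ, 0 ≤ ε → ε ≤ 1 →
    (∀ x ∈ ball (0 : EE n) 1, DI u ε x) → ∀ x ∈ closedBall (0 : EE n) (1/2),
      gr2 u x ≤ C * ∫ y in ball (0 : EE n) 1, gr2 u y := by
  have hn1 : (1:ℝ) ≤ n := by exact_mod_cast hn
  set κ : ℝ := 1 / (136 * n ^ 4 * 2 ^ n) with hκ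
  have hκ0 : 0 < κ := by positivity
  have hom := om_pos n
  have hκ1 : κ ≤ 1 / 4 := by
    rw [hκ]
    have : (1:ℝ) ≤ n ^ 4 * 2 ^ n := one_le_mul_of_one_le_of_one_le (one_le_pow₀ hn1) (one_le_pow₀ (by norm_num))
    gcongr; linarith
  refine ⟨2 ^ n * (4 * n ^ 2 / (κ ^ n * om n)), by positivity, ?_⟩
  intro u hu ε he0 he hD x hx
  have hcg := cont_gr2 hu
  have hc : Continuous (fun y : EE n => (1 - ‖y‖) ^ n * gr2 u y) := by fun_prop
  obtain ⟨y0, hy0, hmax⟩ := (isCompact_closedBall (0 : EE n) 1).exists_isMaxOn ⟨0, by simp⟩ hc.continuousOn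
  set δ := 1 - ‖y0‖ with hδ
  set Q := δ ^ n * gr2 u y0 with hQ
  have hδ0 : 0 ≤ δ := by have : ‖y0‖ ≤ 1 := by simpa using hy0
                         linarith
  have hδ1 : δ ≤ 1 := by rw [hδ]; linarith [norm_nonneg y0]
  have hxn : ‖x‖ ≤ 1 / 2 := by simpa using hx
  have hxQ : gr2 u x ≤ 2 ^ n * Q := by
    have h1 : (1 - ‖x‖) ^ n * gr2 u x ≤ Q := hmax (closedBall_subset_closedBall (by norm_num) hx)
    have h2 : (1 / 2 : ℝ) ^ n * gr2 u x ≤ Q :=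
      (mul_le_mul_of_nonneg_right (pow_le_pow_left₀ (by norm_num) (by linarith) n) (gr2_nonneg _ _)).trans h1
    rw [one_div, inv_pow, inv_mul_le_iff₀ (by positivity)] at h2
    exact h2
  refine hxQ.trans ?_
  rw [mul_assoc]
  refine mul_le_mul_of_nonneg_left ?_ (by positivity)
  have hint0 : 0 ≤ ∫ y in ball (0 : EE n) 1, gr2 u y := integral_nonneg fun y => gr2_nonneg u y
  rcases hδ0.eq_or_lt with h0 | hpos
  · rw [hQ, ← h0, zero_pow hn.ne', zero_mul]; positivity
  set A := Real.sqrt (gr2 u y0) with hA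
  have hA2 : A ^ 2 = gr2 u y0 := Real.sq_sqrt (gr2_nonneg _ _)
  have hA0 : 0 ≤ A := Real.sqrt_nonneg _
  have hnear : ∀ z ∈ ball y0 (δ / 2), δ / 2 ≤ 1 - ‖z‖ := by
    intro z hz
    have h2 : ‖z - y0‖ < δ / 2 := by simpa [dist_eq_norm] using hz
    have h3 := norm_le_norm_add_norm_sub' z y0
    linarith
  have hin : ∀ z ∈ ball y0 (δ / 2), z ∈ ball (0 : EE n) 1 := fun z hz => by
    have := hnear z hz
    simp; linarith
  have hg : ∀ z ∈ ball y0 (δ / 2), gr2 u z ≤ (2 ^ n * A) ^ 2 := by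
    intro z hz
    have h1 : (1 - ‖z‖) ^ n * gr2 u z ≤ Q := hmax (ball_subset_closedBall (hin z hz))
    have h2 : (δ / 2) ^ n * gr2 u z ≤ Q :=
      (mul_le_mul_of_nonneg_right (pow_le_pow_left₀ (by positivity) (hnear z hz) n) (gr2_nonneg _ _)).trans h1
    rw [hQ, div_pow, div_mul_eq_mul_div, div_le_iff₀ (by positivity)] at h2
    have h3 : gr2 u z ≤ 2 ^ n * gr2 u y0 := by
      have : δ ^ n * gr2 u z ≤ δ ^ n * (2 ^ n * gr2 u y0) := by linarith
      exact le_of_mul_le_mul_left this (by positivity)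
    rw [mul_pow, hA2]
    refine h3.trans (mul_le_mul_of_nonneg_right ?_ (gr2_nonneg _ _))
    exact le_self_pow₀ (one_le_pow₀ (by norm_num)) (by norm_num)
  have hhess : ∀ z ∈ closedBall y0 (δ / 2 / 2), Real.sqrt (hs2 u z) ≤ 68 * n ^ 3 * 2 ^ n * A / δ := by
    intro z hz
    have := hess_est hn hu (p := y0) (s := δ / 2) (by positivity) (by linarith) he0 (by nlinarith)
      (by positivity) (fun x hx => hD x (hin x hx)) hg hz
    rw [le_div_iff₀ hpos]; linarith
  obtain ⟨i, hi⟩ := exists_big_pd hn u y0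
  have hi' : A ≤ n * |pd i u y0| := by
    refine le_of_sq_le_sq ?_ (by positivity)
    rw [hA2, mul_pow, sq_abs]; exact hi
  have hlow : ∀ z ∈ ball y0 (κ * δ), A ^ 2 / (4 * n ^ 2) ≤ gr2 u z := by
    intro z hz
    have hzz : ‖z - y0‖ < κ * δ := by simpa [dist_eq_norm] using hz
    have hz' : z ∈ closedBall y0 (δ / 2 / 2) := by
      simp [dist_eq_norm]; nlinarith
    have h1 := pd_lip hu (convex_closedBall y0 (δ / 2 / 2)) hhess (mem_closedBall_self (by positivity)) hz' i
    have h2 : 68 * n ^ 3 * 2 ^ n * A / δ * ‖z - y0‖ ≤ 68 * n ^ 3 * 2 ^ n * A / δ * (κ * δ) := by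
      gcongr
    have h3 : 68 * n ^ 3 * 2 ^ n * A / δ * (κ * δ) = A / (2 * n) := by
      rw [hκ]; field_simp; ring
    have h4 : A / n ≤ |pd i u y0| := by rw [div_le_iff₀ (by positivity)]; linarith
    have h5 : |pd i u y0| ≤ |pd i u z| + |pd i u z - pd i u y0| := by
      have := abs_sub_abs_le_abs_sub (pd i u y0) (pd i u z)
      rw [abs_sub_comm] at this
      linarith
    have h6 : A / (2 * n) ≤ |pd i u z| := by
      have : A / n = A / (2 * n) + A / (2 * n) := by field_simp; norm_num
      linarith
    calc A ^ 2 / (4 * n ^ 2) = (A / (2 * n)) ^ 2 := by ring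
      _ ≤ |pd i u z| ^ 2 := by gcongr
      _ ≤ gr2 u z := by rw [sq_abs]; exact pd_sq_le_gr2 u z i
  have hsub : ball y0 (κ * δ) ⊆ ball (0 : EE n) 1 := fun z hz =>
    hin z (ball_subset_ball (by nlinarith) hz)
  have hI : ∀ s : Set (EE n), s ⊆ closedBall 0 1 → IntegrableOn (gr2 u) s := fun s hs =>
    (hcg.continuousOn.integrableOn_compact (isCompact_closedBall 0 1)).mono_set hs
  have hIntg : A ^ 2 / (4 * n ^ 2) * ((κ * δ) ^ n * om n) ≤ ∫ y in ball (0 : EE n) 1, gr2 u y := by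
    calc A ^ 2 / (4 * n ^ 2) * ((κ * δ) ^ n * om n) = ∫ _y in ball y0 (κ * δ), A ^ 2 / (4 * n ^ 2) := by
          rw [setIntegral_const, measureReal_def, vol_ball _ (by positivity), smul_eq_mul, mul_comm]
      _ ≤ ∫ y in ball y0 (κ * δ), gr2 u y :=
          setIntegral_mono_on (integrableOn_const measure_ball_lt_top.ne)
            (hI _ (hsub.trans ball_subset_closedBall)) measurableSet_ball hlow
      _ ≤ _ := setIntegral_mono_set (hI _ ball_subset_closedBall)
          (ae_of_all _ fun y => gr2_nonneg u y) hsub.eventuallyLE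
  rw [hQ, ← hA2, div_mul_eq_mul_div, le_div_iff₀ (by positivity)]
  rw [div_mul_eq_mul_div, div_le_iff₀ (by positivity), mul_pow] at hIntg
  linarith


lemma sup_dbl (hn : 0 < n) : ∃ C : ℝ, 0 < C ∧ ∀ u : EE n → ℝ, ContDiff ℝ 3 u → ∀ K R Γ : ℝ, 0 ≤ K →
    R ≤ 1 → K * R ≤ 1 → (∀ x ∈ ball (0 : EE n) R, DI u K x) → 0 < Hf u R → Gam u R ≤ Γ →
    ∀ s : ℝ, 0 < s → 4 * s ≤ R → ∃ x ∈ closedBall (0 : EE n) (s / 8), 0 < gr2 u x ∧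
      ∀ y ∈ closedBall (0 : EE n) s, gr2 u y ≤ C * 32 ^ Γ * gr2 u x := by
  obtain ⟨C, hC0, hC⟩ := sup_L2 hn
  have hom := om_pos n
  refine ⟨C * om n, by positivity, ?_⟩
  intro u hu K R Γ hK hR hKR hD hH hΓ s hs hsR
  have hcg := cont_gr2 hu
  obtain ⟨x, hx, hmax⟩ := (isCompact_closedBall (0 : EE n) (s / 8)).exists_isMaxOn
    ⟨0, by simp; positivity⟩ hcg.continuousOn
  have hI : ∀ r, IntegrableOn (gr2 u) (ball (0 : EE n) r) := fun r =>
    (hcg.continuousOn.integrableOn_compact (isCompact_closedBall 0 r)).mono_set ball_subset_closedBall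
  -- lower bound
  have hlow : Hf u (s / 8) ≤ gr2 u x * ((s / 8) ^ 4 * ((s / 8) ^ n * om n)) := by
    have h1 : Hf u (s / 8) ≤ ∫ y, (ball (0 : EE n) (s / 8)).indicator (fun _ => gr2 u x * (s / 8) ^ 4) y := by
      refine integral_mono (J_integrable (by norm_num) _ hcg)
        ((integrableOn_const measure_ball_lt_top.ne).integrable_indicator measurableSet_ball) fun y => ?_
      by_cases hy : y ∈ ball (0 : EE n) (s / 8)
      · simp only [indicator_of_mem hy]
        have h2 : gr2 u y ≤ gr2 u x := hmax (ball_subset_closedBall hy)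
        have h3 : wt (s / 8) y ^ 2 ≤ (s / 8) ^ 4 := by
          have := pow_le_pow_left₀ (wt_nonneg (s / 8) y) (wt_le (s / 8) y) 2
          calc _ ≤ _ := this
            _ = _ := by ring
        exact mul_le_mul h2 h3 (sq_nonneg _) (gr2_nonneg _ _)
      · simp only [indicator_of_notMem hy]
        rw [wt_eq_zero (by positivity) (by simpa using hy)]; simp
    rw [integral_indicator measurableSet_ball, setIntegral_const, measureReal_def,
      vol_ball _ (by positivity), smul_eq_mul] at h1
    linarith
  obtain ⟨hpos, hdbl⟩ := doubling hu hK hR hKR hD hH hΓ (r := s / 8) (r' := 4 * s) (by positivity)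
    (by linarith) hsR
  have hx0 : 0 < gr2 u x := by
    by_contra h
    have h0 : gr2 u x = 0 := le_antisymm (not_lt.1 h) (gr2_nonneg _ _)
    rw [h0, zero_mul] at hlow
    linarith
  refine ⟨x, hx, hx0, fun y hy => ?_⟩
  have hup : 144 * s ^ 4 * ∫ z in ball (0 : EE n) (2 * s), gr2 u z ≤ Hf u (4 * s) := by
    rw [← integral_const_mul, ← integral_indicator measurableSet_ball]
    refine integral_mono (IntegrableOn.integrable_indicator (show IntegrableOn (fun z => 144 * s ^ 4 * gr2 u z) (ball (0 : EE n) (2 * s)) volume from (hI (2 * s)).const_mul _) measurableSet_ball)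
      (J_integrable (by norm_num) _ hcg) fun z => ?_
    by_cases hz : z ∈ ball (0 : EE n) (2 * s)
    · simp only [indicator_of_mem hz]
      have hz' : ‖z‖ < 2 * s := by simpa using hz
      have h1 : 12 * s ^ 2 ≤ wt (4 * s) z := by
        rw [wt_eq (by linarith)]; nlinarith [norm_nonneg z]
      have h2 : (12 * s ^ 2) ^ 2 ≤ wt (4 * s) z ^ 2 := by gcongr
      have h3 := mul_le_mul_of_nonneg_left h2 (gr2_nonneg u z)
      nlinarith
    · simp only [indicator_of_notMem hz]
      exact mul_nonneg (gr2_nonneg u z) (sq_nonneg _)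
  have h2s : 0 < 2 * s := by positivity
  set u' : EE n → ℝ := fun y => 1 * u (0 + (2 * s) • y) with hu'
  have hsup := hC u' (contDiff_rescale hu 1 (2 * s) 0) (K * (2 * s)) (by positivity) (by nlinarith)
    (fun x hx => DI_rescale hu 1 (2 * s) (by rw [abs_of_pos h2s]; linarith) 0 x (hD _ (by
      simp [norm_smul, abs_of_pos hs] at hx ⊢; nlinarith [norm_nonneg x])))
    ((2 * s)⁻¹ • y) (by
      simp only [mem_closedBall, dist_zero_right] at hy ⊢
      rw [norm_smul, norm_inv, Real.norm_eq_abs, abs_of_pos h2s, inv_mul_le_iff₀ h2s]; linarith)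
  have hgr : ∀ z, gr2 u' z = (2 * s) ^ 2 * gr2 u ((2 * s) • z) := fun z => by
    rw [hu', gr2_rescale (hu.of_le (by norm_num))]; simp
  simp_rw [hgr] at hsup
  rw [integral_const_mul, smul_smul, mul_inv_cancel₀ h2s.ne', one_smul,
    Measure.setIntegral_comp_smul_of_pos volume (gr2 u) _ h2s, _root_.smul_ball h2s.ne', smul_zero] at hsup
  simp only [finrank_euclideanSpace, Fintype.card_fin, Real.norm_eq_abs, abs_of_pos h2s, mul_one,
    smul_eq_mul] at hsup
  set Iv := ∫ z in ball (0 : EE n) (2 * s), gr2 u z with hIv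
  have h3 : gr2 u y ≤ C * (((2 * s) ^ n)⁻¹ * Iv) := by
    have : (2 * s) ^ 2 * gr2 u y ≤ (2 * s) ^ 2 * (C * (((2 * s) ^ n)⁻¹ * Iv)) := by linarith
    exact le_of_mul_le_mul_left this (by positivity)
  have h32 : Hf u (4 * s) ≤ 32 ^ Γ * Hf u (s / 8) := by
    have e : s / 8 / (4 * s) = (32 : ℝ)⁻¹ := by field_simp; norm_num
    rw [e, Real.inv_rpow (by norm_num), ← div_eq_mul_inv, div_le_iff₀ (by positivity)] at hdbl
    linarith
  have h4 : 144 * s ^ 4 * Iv ≤ 32 ^ Γ * (gr2 u x * ((s / 8) ^ 4 * ((s / 8) ^ n * om n))) :=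
    hup.trans (h32.trans (mul_le_mul_of_nonneg_left hlow (by positivity)))
  have h5 : Iv ≤ 32 ^ Γ * gr2 u x * ((2 * s) ^ n * om n) := by
    have h6 : (s / 8) ^ n ≤ (2 * s) ^ n := pow_le_pow_left₀ (by positivity) (by linarith) n
    have h7 : 32 ^ Γ * (gr2 u x * ((s / 8) ^ 4 * ((s / 8) ^ n * om n)))
        ≤ 32 ^ Γ * (gr2 u x * ((144 * s ^ 4) * ((2 * s) ^ n * om n))) := by
      gcongr
      rw [div_pow]
      have : 0 < s ^ 4 := by positivity
      linarith
    have h8 : 144 * s ^ 4 * Iv ≤ 144 * s ^ 4 * (32 ^ Γ * gr2 u x * ((2 * s) ^ n * om n)) :=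
      (h4.trans h7).trans (le_of_eq (by ring))
    exact le_of_mul_le_mul_left h8 (by positivity)
  calc gr2 u y ≤ C * (((2 * s) ^ n)⁻¹ * Iv) := h3
    _ ≤ C * (((2 * s) ^ n)⁻¹ * (32 ^ Γ * gr2 u x * ((2 * s) ^ n * om n))) := by gcongr
    _ = _ := by field_simp


lemma lap_sq_le (u : EE n → ℝ) (x : EE n) : (lap u x) ^ 2 ≤ n * hs2 u x := by
  unfold lap
  have h := sq_sum_le_card_mul_sum_sq (s := Finset.univ) (f := fun j : Fin n => pd j (pd j u) x)
  simp only [Finset.card_univ, Fintype.card_fin] at h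
  refine h.trans ?_
  gcongr
  unfold hs2
  refine Finset.sum_le_sum fun i _ => ?_
  exact pd_sq_le_gr2 (pd i u) x i

/-- the constant of the level estimate -/
def clev (n : ℕ) : ℝ := n * (2 * J 2 (1/2) (fun _ : EE n => (1:ℝ)) + 4 * n * J 1 (1/2) (fun _ : EE n => (1:ℝ)))

lemma clev_nonneg : 0 ≤ clev n := by
  have h1 : 0 ≤ J 2 (1/2) (fun _ : EE n => (1:ℝ)) := J_nonneg _ _ fun _ => zero_le_one
  have h2 : 0 ≤ J 1 (1/2) (fun _ : EE n => (1:ℝ)) := J_nonneg _ _ fun _ => zero_le_one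
  unfold clev; positivity

lemma abs_arctan_le (t : ℝ) : |Real.arctan t| ≤ 2 := by
  have h1 := Real.arctan_lt_pi_div_two t
  have h2 := Real.neg_pi_div_two_lt_arctan t
  have h3 := Real.pi_le_four
  rw [abs_le]; constructor <;> linarith

lemma level_est_aux {u : EE n → ℝ} (hu : ContDiff ℝ 3 u) {B δ : ℝ} (hB : 0 ≤ B) (hδ : 0 < δ)
    (hh : ∀ x ∈ ball (0 : EE n) (1/2), hs2 u x ≤ B ^ 2)
    (hl : ∀ x ∈ ball (0 : EE n) (1/2), ∀ i, |lap (pd i u) x| ≤ B) :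
    J 2 (1/2) (fun x => ∑ i, ∑ j, (δ⁻¹ / (1 + (pd i u x / δ) ^ 2)) * (pd j (pd i u) x) ^ 2) ≤ B * clev n := by
  have hpos : ∀ (i : Fin n) x, (0:ℝ) < 1 + (pd i u x / δ) ^ 2 := fun i x => by positivity
  have hc1 := fun i => u_c1 hu i
  have hc2 := fun i j => u_c2 hu i j
  have cc1 := fun i => u_cc1 hu i
  have cc2 := fun i j => u_cc2 hu i j
  have cc3 := fun i j k => u_cc3 hu i j k
  have cl := fun i => cont_lap hu i
  have hcβ : ∀ i, Continuous (fun x => δ⁻¹ / (1 + (pd i u x / δ) ^ 2)) := fun i =>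
    continuous_const.div (by have := cc1 i; fun_prop) (fun x => (hpos i x).ne')
  have hat : ∀ i, ContDiff ℝ 1 (fun x => Real.arctan (pd i u x / δ)) := fun i =>
    Real.contDiff_arctan.comp (((hc1 i).of_le (by norm_num)).div_const δ)
  have hpd : ∀ i j x, pd j (fun y => Real.arctan (pd i u y / δ) * pd j (pd i u) y) x
      = Real.arctan (pd i u x / δ) * pd j (pd j (pd i u)) x
        + (δ⁻¹ / (1 + (pd i u x / δ) ^ 2)) * (pd j (pd i u) x) ^ 2 := by
    intro i j x
    rw [pd_mul ((hat i).differentiable (by norm_num) x) ((hc2 i j).differentiable (by norm_num) x)]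
    have := pd_comp (φ := fun t => Real.arctan (t / δ)) (g := pd i u) (x := x)
      (((hasDerivAt_id _).div_const δ).arctan) ((hc1 i).differentiable (by norm_num) x) j
    rw [this]
    ring
  have hcs : ∀ i, Continuous (fun x => ∑ j, (δ⁻¹ / (1 + (pd i u x / δ) ^ 2)) * (pd j (pd i u) x) ^ 2) :=
    fun i => continuous_finsetSum _ fun j _ => (hcβ i).mul ((cc2 i j).pow 2)
  have hcl : ∀ i, Continuous (fun x => Real.arctan (pd i u x / δ) * lap (pd i u) x) :=
    fun i => (hat i).continuous.mul (cl i)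
  have key : ∀ i, J 2 (1/2) (fun x => ∑ j, (δ⁻¹ / (1 + (pd i u x / δ) ^ 2)) * (pd j (pd i u) x) ^ 2)
      ≤ B * (2 * J 2 (1/2) (fun _ : EE n => (1:ℝ)) + 4 * n * J 1 (1/2) (fun _ : EE n => (1:ℝ))) := by
    intro i
    have e1 : J 2 (1/2) (fun x => ∑ j, pd j (fun y => Real.arctan (pd i u y / δ) * pd j (pd i u) y) x)
        = J 2 (1/2) (fun x => Real.arctan (pd i u x / δ) * lap (pd i u) x)
          + J 2 (1/2) (fun x => ∑ j, (δ⁻¹ / (1 + (pd i u x / δ) ^ 2)) * (pd j (pd i u) x) ^ 2) := by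
      rw [← J_add two_ne_zero _ (hcl i) (hcs i)]
      congr 1; ext x
      simp_rw [hpd]
      rw [Finset.sum_add_distrib, lap, Finset.mul_sum]
    have e2 : J 2 (1/2) (fun x => ∑ j, pd j (fun y => Real.arctan (pd i u y / δ) * pd j (pd i u) y) x)
        = ∑ j, 4 * J 1 (1/2) (fun x => x j * (Real.arctan (pd i u x / δ) * pd j (pd i u) x)) := by
      rw [J_sum _ (by norm_num) _ (fun j _ => continuous_pd ((hat i).mul (hc2 i j)) j)]
      refine Finset.sum_congr rfl fun j _ => ?_
      have := J_ibp 0 (1/2) ((hat i).mul (hc2 i j)) j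
      norm_num at this ⊢
      exact this
    have e3 : ∀ j, 4 * J 1 (1/2) (fun x => x j * (Real.arctan (pd i u x / δ) * pd j (pd i u) x))
        ≤ 4 * (B * J 1 (1/2) (fun _ : EE n => (1:ℝ))) := by
      intro j
      refine mul_le_mul_of_nonneg_left ?_ zero_le_four
      rw [← J_const_mul]
      refine J_mono (by norm_num) (by norm_num) ?_ (by fun_prop) fun x hx => ?_
      · exact (cont_coord hu j).mul ((hat i).continuous.mul (cc2 i j))
      · have h1 : |x j| ≤ 1/2 := by
          have := PiLp.norm_apply_le x j
          rw [Real.norm_eq_abs] at this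
          have h' : ‖x‖ < 1/2 := by simpa using hx
          linarith
        have h2 := abs_arctan_le (pd i u x / δ)
        have h3 : |pd j (pd i u) x| ≤ B := abs_le_of_sq_le_sq ((pd_sq_le_hs2 u x i j).trans (hh x hx)) hB
        calc _ ≤ |x j * (Real.arctan (pd i u x / δ) * pd j (pd i u) x)| := le_abs_self _
          _ = |x j| * (|Real.arctan (pd i u x / δ)| * |pd j (pd i u) x|) := by rw [abs_mul, abs_mul]
          _ ≤ 1/2 * (2 * B) := by gcongr
          _ = B * 1 := by ring
    have e4 : -J 2 (1/2) (fun x => Real.arctan (pd i u x / δ) * lap (pd i u) x)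
        ≤ B * 2 * J 2 (1/2) (fun _ : EE n => (1:ℝ)) := by
      rw [← J_const_mul, ← neg_one_mul, ← J_const_mul]
      refine J_mono (by norm_num) (by norm_num) ?_ (by fun_prop) fun x hx => ?_
      · exact continuous_const.mul ((hat i).continuous.mul (cl i))
      · have h2 := abs_arctan_le (pd i u x / δ)
        have h3 := hl x hx i
        calc _ ≤ |-1 * (Real.arctan (pd i u x / δ) * lap (pd i u) x)| := le_abs_self _
          _ = |Real.arctan (pd i u x / δ)| * |lap (pd i u) x| := by rw [abs_mul, abs_mul]; simp
          _ ≤ 2 * B := by gcongr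
          _ = B * 2 * 1 := by ring
    have e5 := Finset.sum_le_sum (s := Finset.univ) fun j (_ : j ∈ Finset.univ) => e3 j
    rw [← e2, e1] at e5
    simp only [Finset.sum_const, Finset.card_univ, Fintype.card_fin, nsmul_eq_mul] at e5
    linarith
  rw [J_sum _ two_ne_zero _ (fun i _ => hcs i)]
  have := Finset.sum_le_sum (s := Finset.univ) fun i (_ : i ∈ Finset.univ) => key i
  simp only [Finset.sum_const, Finset.card_univ, Fintype.card_fin, nsmul_eq_mul] at this
  refine this.trans (le_of_eq ?_)
  unfold clev; ring

lemma level_est (hn : 0 < n) {u : EE n → ℝ} (hu : ContDiff ℝ 3 u) {B δ l : ℝ} (hB : 0 ≤ B) (hδ : 0 < δ) (hl0 : 0 < l)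
    (hh : ∀ x ∈ ball (0 : EE n) (1/2), hs2 u x ≤ B ^ 2)
    (hl : ∀ x ∈ ball (0 : EE n) (1/2), ∀ i, |lap (pd i u) x| ≤ B)
    (hlam : ∀ x ∈ ball (0 : EE n) (1/4), l ≤ |lap u x|) :
    (volume (ball (0 : EE n) (1/4) ∩ {x | gr2 u x < δ ^ 2})).toReal ≤ 64 * n * B * clev n / l ^ 2 * δ := by
  have hn' : (0:ℝ) < n := by exact_mod_cast hn
  have h := level_est_aux hu hB hδ hh hl
  set Φ : EE n → ℝ := fun x => ∑ i, ∑ j, (δ⁻¹ / (1 + (pd i u x / δ) ^ 2)) * (pd j (pd i u) x) ^ 2 with hΦ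
  have hΦc : Continuous Φ := continuous_finsetSum _ fun i _ => continuous_finsetSum _ fun j _ => by
    refine (continuous_const.div ?_ (fun x => ?_)).mul ((u_cc2 hu i j).pow 2)
    · have := u_cc1 hu i; fun_prop
    · positivity
  have hΦ0 : ∀ x, 0 ≤ Φ x := fun x => Finset.sum_nonneg fun i _ => Finset.sum_nonneg fun j _ => by positivity
  set A := ball (0 : EE n) (1/4) ∩ {x | gr2 u x < δ ^ 2} with hA
  have hAm : MeasurableSet A := (isOpen_ball.inter (isOpen_lt (cont_gr2 hu) continuous_const)).measurableSet
  have hAf : volume A ≠ ⊤ := (measure_mono inter_subset_left).trans_lt measure_ball_lt_top |>.ne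
  have h1 : ∫ x, A.indicator (fun _ => l ^ 2 / (64 * n * δ)) x ≤ J 2 (1/2) Φ := by
    refine integral_mono ((integrableOn_const hAf).integrable_indicator hAm)
      (J_integrable (by norm_num) _ hΦc) fun x => ?_
    by_cases hx : x ∈ A
    · simp only [indicator_of_mem hx]
      have hx1 : ‖x‖ < 1/4 := by simpa using hx.1
      have hx2 : gr2 u x < δ ^ 2 := hx.2
      have hw : (1:ℝ)/32 ≤ wt (1/2) x ^ 2 := by
        have : (3:ℝ)/16 ≤ wt (1/2) x := by
          rw [wt_eq (by linarith)]; nlinarith [norm_nonneg x]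
        nlinarith
      have h2 : (1 / (2 * δ)) * hs2 u x ≤ Φ x := by
        rw [hΦ]; unfold hs2
        simp only [Finset.mul_sum]
        refine Finset.sum_le_sum fun i _ => Finset.sum_le_sum fun j _ => ?_
        refine mul_le_mul_of_nonneg_right ?_ (sq_nonneg _)
        have : (pd i u x / δ) ^ 2 ≤ 1 := by
          rw [div_pow, div_le_one (by positivity)]
          exact (pd_sq_le_gr2 u x i).trans hx2.le
        rw [show 1 / (2 * δ) = δ⁻¹ / 2 by field_simp]
        gcongr
        linarith
      have h3 : l ^ 2 / n ≤ hs2 u x := by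
        rw [div_le_iff₀ hn']
        have h4 := hlam x hx.1
        have h5 : l ^ 2 ≤ |lap u x| ^ 2 := by gcongr
        rw [sq_abs] at h5
        linarith [lap_sq_le u x]
      calc l ^ 2 / (64 * n * δ) = (1 / (2 * δ)) * (l ^ 2 / n) * (1/32) := by field_simp; norm_num
        _ ≤ Φ x * wt (1/2) x ^ 2 := by
          refine mul_le_mul (le_trans ?_ h2) hw (by norm_num) (hΦ0 x)
          gcongr
    · simp only [indicator_of_notMem hx]
      exact mul_nonneg (hΦ0 x) (sq_nonneg _)
  rw [integral_indicator hAm, setIntegral_const, measureReal_def, smul_eq_mul] at h1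
  have h6 := h1.trans h
  rw [← le_div_iff₀ (by positivity)] at h6
  refine h6.trans (le_of_eq ?_)
  field_simp


/-- covering by finitely many balls of radius at most `δ` with total `(n-1)`-content at most `M` -/
def Cov (S : Set (EE n)) (δ M : ℝ) : Prop :=
  ∃ t : Finset (EE n × ℝ), (S ⊆ ⋃ p ∈ t, closedBall p.1 p.2) ∧ (∀ p ∈ t, 0 < p.2 ∧ p.2 ≤ δ) ∧
    ∑ p ∈ t, p.2 ^ (n - 1) ≤ M

lemma exists_sep_cover {S : Set (EE n)} {δ N : ℝ} (hδ : 0 ≤ δ)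
    (h : ∀ t : Finset (EE n), (t : Set (EE n)) ⊆ S → (∀ x ∈ t, ∀ y ∈ t, x ≠ y → δ < dist x y) →
      (t.card : ℝ) ≤ N) :
    ∃ t : Finset (EE n), (t : Set (EE n)) ⊆ S ∧ (t.card : ℝ) ≤ N ∧ S ⊆ ⋃ x ∈ t, closedBall x δ := by
  classical
  set P : Set ℕ := {k | ∃ t : Finset (EE n), (t : Set (EE n)) ⊆ S ∧
    (∀ x ∈ t, ∀ y ∈ t, x ≠ y → δ < dist x y) ∧ t.card = k} with hP
  have hb : BddAbove P := by
    refine ⟨⌈N⌉₊, ?_⟩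
    rintro k ⟨t, h1, h2, rfl⟩
    exact_mod_cast (h t h1 h2).trans (Nat.le_ceil N)
  have hne : P.Nonempty := ⟨0, ∅, by simp, by simp, by simp⟩
  obtain ⟨t, h1, h2, h3⟩ := Nat.sSup_mem hne hb
  refine ⟨t, h1, h t h1 h2, fun y hy => ?_⟩
  by_contra hcon
  simp only [mem_iUnion, mem_closedBall, not_exists, not_le] at hcon
  have hyt : y ∉ t := fun hyt => by
    have h5 := hcon y hyt
    rw [dist_self] at h5
    linarith
  have h4 : (insert y t).card ∈ P := by
    refine ⟨insert y t, ?_, ?_, rfl⟩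
    · intro z hz
      simp at hz
      rcases hz with rfl | hz
      exacts [hy, h1 hz]
    · intro a ha b hb hab
      rw [Finset.mem_insert] at ha hb
      rcases ha with rfl | ha <;> rcases hb with rfl | hb
      · exact absurd rfl hab
      · exact hcon b hb
      · rw [dist_comm]; exact hcon a ha
      · exact h2 a ha b hb hab
  have h5 := le_csSup hb h4
  rw [Finset.card_insert_of_notMem hyt, ← h3] at h5
  omega

lemma caseA_cover (hn : 0 < n) {u : EE n → ℝ} (hu : ContDiff ℝ 3 u) {B C1 : ℝ} (hB : 0 < B) (hC1 : 0 ≤ C1)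
    (hh : ∀ x ∈ ball (0 : EE n) (1/2), Real.sqrt (hs2 u x) ≤ B)
    (hv : ∀ τ > 0, (volume (ball (0 : EE n) (1/4) ∩ {x | gr2 u x < τ ^ 2})).toReal ≤ C1 * τ)
    {δ : ℝ} (hδ : 0 < δ) :
    Cov ({x | gr2 u x = 0} ∩ closedBall (0 : EE n) (1/8)) δ (C1 * n * B * 2 ^ n / om n) := by
  classical
  have hom := om_pos n
  have hn' : (1:ℝ) ≤ n := by exact_mod_cast hn
  set d := min δ (1/8) with hd
  have hd0 : 0 < d := lt_min hδ (by norm_num)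
  have hd8 : d ≤ 1/8 := min_le_right _ _
  set S := {x | gr2 u x = 0} ∩ closedBall (0 : EE n) (1/8) with hS
  have hcard : ∀ t : Finset (EE n), (t : Set (EE n)) ⊆ S → (∀ x ∈ t, ∀ y ∈ t, x ≠ y → d < dist x y) →
      (t.card : ℝ) ≤ C1 * n * B * 2 ^ n / om n / d ^ (n - 1) := by
    intro t htS hsep
    have hsub : (⋃ x ∈ t, ball x (d / 2)) ⊆ ball (0 : EE n) (1/4) ∩ {x | gr2 u x < (n * B * d) ^ 2} := by
      intro y hy
      simp only [mem_iUnion] at hy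
      obtain ⟨x, hx, hxy⟩ := hy
      have hxS := htS hx
      have hx8 : ‖x‖ ≤ 1/8 := by simpa using hxS.2
      have hyx : ‖y - x‖ < d / 2 := by simpa [dist_eq_norm] using hxy
      have hy4 : ‖y‖ < 1/4 := by
        have : ‖y‖ ≤ ‖y - x‖ + ‖x‖ := by simpa using norm_add_le (y - x) x
        linarith
      refine ⟨by simpa using hy4, ?_⟩
      have hx0 : ∀ i, pd i u x = 0 := fun i => by
        have := pd_sq_le_gr2 u x i
        rw [show gr2 u x = 0 from hxS.1] at this
        exact pow_eq_zero_iff (two_ne_zero) |>.1 (le_antisymm this (sq_nonneg _))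
      have hi : ∀ i, (pd i u y) ^ 2 ≤ (B * (d / 2)) ^ 2 := fun i => by
        have h1 := pd_lip hu (convex_ball (0 : EE n) (1/2)) hh (x := x) (y := y)
          (by simp; linarith) (by simp; linarith) i
        rw [hx0 i, sub_zero] at h1
        rw [← sq_abs]
        gcongr
        exact h1.trans (by gcongr)
      have h2 : gr2 u y ≤ n * (B * (d / 2)) ^ 2 := by
        unfold gr2
        refine (Finset.sum_le_sum fun i _ => hi i).trans ?_
        simp
      change gr2 u y < _
      refine h2.trans_lt ?_
      have : 0 < (B * d) ^ 2 := by positivity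
      nlinarith
    have hdisj : ((t : Set (EE n))).PairwiseDisjoint (fun x => ball x (d / 2)) := by
      intro x hx y hy hxy
      exact ball_disjoint_ball (by have := hsep x hx y hy hxy; linarith)
    have hvol : volume (⋃ x ∈ t, ball x (d / 2)) = ∑ x ∈ t, volume (ball x (d / 2)) :=
      measure_biUnion_finset hdisj fun x _ => measurableSet_ball
    have hfin : volume (ball (0 : EE n) (1/4) ∩ {x | gr2 u x < (n * B * d) ^ 2}) ≠ ⊤ :=
      ((measure_mono inter_subset_left).trans_lt measure_ball_lt_top).ne
    have h3 := ENNReal.toReal_mono hfin (measure_mono hsub)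
    rw [hvol, ENNReal.toReal_sum (fun x _ => measure_ball_lt_top.ne)] at h3
    simp_rw [vol_ball _ (half_pos hd0)] at h3
    rw [Finset.sum_const, nsmul_eq_mul] at h3
    have h4 := h3.trans (hv (n * B * d) (by positivity))
    rw [le_div_iff₀ (by positivity), le_div_iff₀ (by positivity)]
    obtain ⟨m, rfl⟩ : ∃ m, n = m + 1 := ⟨n - 1, by omega⟩
    simp only [Nat.add_sub_cancel]
    rw [div_pow] at h4
    have h5 : (t.card : ℝ) * d ^ m * om (m + 1) * d ≤ C1 * ((m + 1 : ℕ) : ℝ) * B * 2 ^ (m + 1) * d := by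
      have h6 : (t.card : ℝ) * (d ^ (m + 1) / 2 ^ (m + 1) * om (m + 1)) * 2 ^ (m + 1)
          ≤ C1 * (((m + 1 : ℕ) : ℝ) * B * d) * 2 ^ (m + 1) := by gcongr
      have h7 : (t.card : ℝ) * (d ^ (m + 1) / 2 ^ (m + 1) * om (m + 1)) * 2 ^ (m + 1)
        = (t.card : ℝ) * d ^ m * om (m + 1) * d := by field_simp; ring
      linarith
    exact le_of_mul_le_mul_right h5 hd0
  obtain ⟨t, htS, htc, hcov⟩ := exists_sep_cover hd0.le hcard
  refine ⟨t.image (fun x => (x, d)), ?_, ?_, ?_⟩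
  · intro x hx
    have := hcov hx
    simp only [mem_iUnion] at this ⊢
    obtain ⟨y, hy, hxy⟩ := this
    exact ⟨(y, d), Finset.mem_image_of_mem _ hy, hxy⟩
  · intro p hp
    obtain ⟨y, hy, rfl⟩ := Finset.mem_image.1 hp
    exact ⟨hd0, min_le_left _ _⟩
  · rw [Finset.sum_image (by intro x _ y _ h; simpa using h)]
    simp only [Finset.sum_const, nsmul_eq_mul]
    rwa [le_div_iff₀ (by positivity)] at htc

lemma caseA (hn : 0 < n) {Λ l : ℝ} (hΛ : 0 < Λ) (hl : 0 < l) : ∃ ε > 0, ε ≤ 1 ∧ ∃ C > 0,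
    ∀ u : EE n → ℝ, ContDiff ℝ 3 u → (∀ x ∈ ball (0 : EE n) 1, DI u ε x) →
    (∀ x ∈ ball (0 : EE n) 1, gr2 u x ≤ Λ ^ 2) → l ≤ |lap u 0| → ∀ δ > 0,
    Cov ({x | gr2 u x = 0} ∩ closedBall (0 : EE n) (1/8)) δ C := by
  have hn' : (1:ℝ) ≤ n := by exact_mod_cast hn
  have hom := om_pos n
  set B0 : ℝ := 34 * n ^ 3 * Λ with hB0
  have hB0p : 0 < B0 := by positivity
  set B : ℝ := B0 + Λ with hB
  have hBp : 0 < B := by positivity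
  set C1 : ℝ := 64 * n * B * clev n / (l / 2) ^ 2 with hC1
  have hC1p : 0 ≤ C1 := by have := clev_nonneg (n := n); positivity
  refine ⟨min 1 (l / B), by positivity, min_le_left _ _, C1 * n * B * 2 ^ n / om n + 1, by positivity, ?_⟩
  intro u hu hD hg hlap δ hδ
  set ε := min 1 (l / B) with hε
  have hε0 : 0 < ε := by positivity
  have hε1 : ε ≤ 1 := min_le_left _ _
  have hεB : ε * B ≤ l := by
    have := min_le_right 1 (l / B)
    rwa [← hε, le_div_iff₀ hBp] at this
  have hh : ∀ x ∈ ball (0 : EE n) (1/2), Real.sqrt (hs2 u x) ≤ B0 := by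
    intro x hx
    have := hess_est hn hu (p := 0) (s := 1) one_pos le_rfl hε0.le (by linarith) hΛ.le hD hg
      (y := x) (ball_subset_closedBall hx)
    linarith
  have hh2 : ∀ x ∈ ball (0 : EE n) (1/2), hs2 u x ≤ B0 ^ 2 := fun x hx =>
    (Real.sqrt_le_left hB0p.le).1 (hh x hx)
  have hL : ∀ x ∈ ball (0 : EE n) (1/2), ∑ i, (lap (pd i u) x) ^ 2 ≤ (ε * B) ^ 2 := by
    intro x hx
    have hx1 : x ∈ ball (0 : EE n) 1 := ball_subset_ball (by norm_num) hx
    have h1 := hD x hx1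
    unfold DI at h1
    have h2 := hg x hx1
    have h3 := hh2 x hx
    refine h1.trans ?_
    rw [mul_pow]
    gcongr
    nlinarith
  have hl2 : ∀ x ∈ ball (0 : EE n) (1/4), l / 2 ≤ |lap u x| := by
    intro x hx
    have hx4 : ‖x‖ < 1/4 := by simpa using hx
    have h1 : ‖lap u x - lap u 0‖ ≤ (ε * B) * ‖x - 0‖ := by
      refine Convex.norm_image_sub_le_of_norm_fderiv_le (𝕜 := ℝ) (s := ball (0 : EE n) (1/2))
        (fun z _ => (contDiff_lap hu (m := 1) (by norm_num)).differentiable (by norm_num) z) (fun z hz => ?_)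
        (convex_ball _ _) (by simp) (ball_subset_ball (by norm_num) hx)
      refine (norm_fderiv_le_gr2 _ _).trans ?_
      rw [Real.sqrt_le_left (by positivity)]
      refine le_trans (le_of_eq ?_) (hL z hz)
      unfold gr2
      exact Finset.sum_congr rfl fun i _ => by rw [lap_pd hu]
    rw [sub_zero, Real.norm_eq_abs] at h1
    have h2 : |lap u 0| ≤ |lap u x| + |lap u x - lap u 0| := by
      have := abs_sub_abs_le_abs_sub (lap u 0) (lap u x)
      rw [abs_sub_comm] at this; linarith
    have h3 : ε * B * ‖x‖ ≤ l * (1/4) := by gcongr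
    linarith
  have hv : ∀ τ > 0, (volume (ball (0 : EE n) (1/4) ∩ {x | gr2 u x < τ ^ 2})).toReal ≤ C1 * τ := by
    intro τ hτ
    refine level_est hn hu hBp.le hτ (half_pos hl) (fun x hx => (hh2 x hx).trans ?_) (fun x hx i => ?_) hl2
    · gcongr; linarith
    · refine abs_le_of_sq_le_sq ?_ hBp.le
      refine (Finset.single_le_sum (f := fun i => (lap (pd i u) x) ^ 2) (fun _ _ => sq_nonneg _)
        (Finset.mem_univ i)).trans ((hL x hx).trans ?_)
      gcongr
      nlinarith
  obtain ⟨t, h1, h2, h3⟩ := caseA_cover hn hu hBp hC1p (fun x hx => (hh x hx).trans (by linarith)) hv hδ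
  exact ⟨t, h1, h2, h3.trans (by linarith)⟩


lemma rank_aux {M : EE n →L[ℝ] (Fin n → ℝ)} (hsym : ∀ i j, M (ee j) i = M (ee i) j)
    (htr : ∑ i, M (ee i) i = 0) (hne : ∃ i j, M (ee j) i ≠ 0) :
    Module.finrank ℝ (LinearMap.ker M.toLinearMap) + 2 ≤ n := by
  have h1 := LinearMap.finrank_range_add_finrank_ker M.toLinearMap
  rw [finrank_euclideanSpace, Fintype.card_fin] at h1
  by_contra hcon
  have h2 : Module.finrank ℝ (LinearMap.range M.toLinearMap) ≤ 1 := by omega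
  rw [finrank_le_one_iff] at h2
  obtain ⟨v, hv⟩ := h2
  have h3 : ∀ j, ∃ c : ℝ, ∀ i, M (ee j) i = c * (v : Fin n → ℝ) i := by
    intro j
    obtain ⟨c, hc⟩ := hv ⟨M (ee j), LinearMap.mem_range_self _ _⟩
    refine ⟨c, fun i => ?_⟩
    have := congrArg (fun w : LinearMap.range M.toLinearMap => (w : Fin n → ℝ) i) hc
    simpa using this.symm
  choose c hc using h3
  have h4 : ∑ i, ∑ j, (M (ee j) i) ^ 2 = 0 := by
    have : ∀ i j, (M (ee j) i) ^ 2 = M (ee i) i * M (ee j) j := by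
      intro i j
      rw [sq]
      conv_lhs => rw [hsym i j]
      nth_rw 2 [← hsym i j]
      rw [hc, hc, hc, hc]; ring
    simp_rw [this, ← Finset.mul_sum, htr]
    simp
  obtain ⟨i, j, hij⟩ := hne
  have h5 := (Finset.sum_eq_zero_iff_of_nonneg (fun i _ => Finset.sum_nonneg fun j _ => sq_nonneg _)).1 h4 i (Finset.mem_univ i)
  have h6 := (Finset.sum_eq_zero_iff_of_nonneg (fun j _ => sq_nonneg _)).1 h5 j (Finset.mem_univ j)
  exact hij (pow_eq_zero_iff two_ne_zero |>.1 h6)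

lemma local_null {h : EE n → ℝ} (hh : ContDiff ℝ 2 h) {z : EE n} (hl : lap h z = 0) (hz : hs2 h z ≠ 0) :
    ∃ U ∈ 𝓝 z, μH[(n : ℝ) - 1] ({x | gr2 h x = 0} ∩ U) = 0 := by
  have hc1 : ∀ i, ContDiff ℝ 1 (pd i h) := fun i => contDiff_pd hh (by norm_num) i
  set M : EE n →L[ℝ] (Fin n → ℝ) := ContinuousLinearMap.pi (fun i => fderiv ℝ (pd i h) z) with hM
  have hMe : ∀ i j, M (ee j) i = pd j (pd i h) z := fun i j => rfl
  set G : EE n → (Fin n → ℝ) := fun x i => pd i h x with hG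
  have hGd : HasStrictFDerivAt G M z := by
    rw [hasStrictFDerivAt_pi']
    intro i
    exact (hc1 i).contDiffAt.hasStrictFDerivAt (by norm_num)
  have hrank : Module.finrank ℝ (LinearMap.ker M.toLinearMap) + 2 ≤ n := by
    refine rank_aux (fun i j => ?_) ?_ ?_
    · rw [hMe, hMe, pd_comm hh]
    · exact hl
    · by_contra hcon
      push Not at hcon
      apply hz
      unfold hs2
      refine Finset.sum_eq_zero fun i _ => Finset.sum_eq_zero fun j _ => ?_
      rw [← hMe, hcon]; norm_num
  set W := LinearMap.ker M.toLinearMap with hW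
  set P : EE n →L[ℝ] W := W.orthogonalProjectionOnto with hP
  have hinj : LinearMap.ker (P.prod M).toLinearMap = ⊥ := by
    rw [LinearMap.ker_eq_bot']
    intro x hx
    have hx' : (P x, M x) = 0 := hx
    have h1 : P x = 0 := congrArg Prod.fst hx'
    have h2 : M x = 0 := congrArg Prod.snd hx'
    have h3 : x ∈ W := h2
    have h4 := Submodule.orthogonalProjectionOnto_mem_subspace_eq_self (K := W) ⟨x, h3⟩
    have h5 : P x = ⟨x, h3⟩ := h4
    rw [h1] at h5
    exact (congrArg Subtype.val h5).symm
  obtain ⟨K, hK0, hK⟩ := LinearMap.exists_antilipschitzWith (P.prod M).toLinearMap hinj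
  have hc : (0 : NNReal) < 1 / (2 * K) := by positivity
  obtain ⟨U, hU, hapx⟩ := hGd.approximates_deriv_on_nhds (c := 1 / (2 * K)) (Or.inr hc)
  refine ⟨U, hU, ?_⟩
  set S := {x | gr2 h x = 0} ∩ U with hS
  have hG0 : ∀ x ∈ S, G x = 0 := fun x hx => by
    ext i
    have := pd_sq_le_gr2 h x i
    rw [show gr2 h x = 0 from hx.1] at this
    exact pow_eq_zero_iff two_ne_zero |>.1 (le_antisymm this (sq_nonneg _))
  have hanti : AntilipschitzWith K (fun x : S => P (x : EE n)) := by
    refine AntilipschitzWith.of_le_mul_dist fun x y => ?_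
    have h1 := hK.le_mul_dist (x : EE n) y
    have h2 := hapx x x.2.2 y y.2.2
    rw [hG0 x x.2, hG0 y y.2, sub_zero, zero_sub, norm_neg] at h2
    change dist (x : EE n) y ≤ K * dist (P x, M x) (P y, M y) at h1
    rw [Prod.dist_eq] at h1
    change dist (x : EE n) y ≤ K * dist (P x) (P y)
    rcases le_total (dist (P x) (P y)) (dist (M x) (M y)) with h3 | h3
    · rw [max_eq_right h3, dist_eq_norm (M x), ← map_sub] at h1
      have h4 : (K : ℝ) * ‖M ((x : EE n) - y)‖ ≤ K * ((1 / (2 * K) : NNReal) * ‖(x : EE n) - y‖) := by gcongr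
      have h5 : (K : ℝ) * ((1 / (2 * K) : NNReal) * ‖(x : EE n) - y‖) = ‖(x : EE n) - y‖ / 2 := by
        have : (K : ℝ) ≠ 0 := by positivity
        push_cast; field_simp
      rw [h5] at h4
      rw [dist_eq_norm] at h1 ⊢
      have : (0:ℝ) ≤ K * dist (P x) (P y) := by positivity
      linarith [norm_nonneg ((x : EE n) - y)]
    · rwa [max_eq_left h3] at h1
  have hdim : dimH S ≤ (Module.finrank ℝ W : ℝ≥0∞) := by
    have h1 : dimH S = dimH (univ : Set S) := by
      have := (isometry_subtype_coe (s := S)).dimH_image univ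
      rw [← this]; simp
    rw [h1]
    refine (hanti.le_dimH_image univ).trans ?_
    refine (dimH_mono (subset_univ _)).trans ?_
    rw [Real.dimH_univ_eq_finrank]
  have hlt : dimH S < ((n - 1 : ℕ) : NNReal) := by
    refine hdim.trans_lt ?_
    have : Module.finrank ℝ W < n - 1 := by omega
    rw [ENNReal.coe_natCast]
    exact_mod_cast this
  have := hausdorffMeasure_of_dimH_lt hlt
  rw [NNReal.coe_natCast, Nat.cast_sub (by omega), Nat.cast_one] at this
  exact this

/-- iterated partial derivatives -/
def itd : List (Fin n) → (EE n → ℝ) → EE n → ℝ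
  | [], g => g
  | j :: l, g => pd j (itd l g)

lemma contDiff_itd {g : EE n → ℝ} (hg : ContDiff ℝ ((⊤ : ℕ∞) : WithTop ℕ∞) g) (l : List (Fin n)) :
    ContDiff ℝ ((⊤ : ℕ∞) : WithTop ℕ∞) (itd l g) := by
  induction l with
  | nil => exact hg
  | cons j l ih => exact contDiff_pd ih (by simp) j

lemma lap_itd {g : EE n → ℝ} (hg : ContDiff ℝ ((⊤ : ℕ∞) : WithTop ℕ∞) g) {U : Set (EE n)} (hU : IsOpen U)
    (h : ∀ x ∈ U, lap g x = 0) (l : List (Fin n)) : ∀ x ∈ U, lap (itd l g) x = 0 := by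
  induction l with
  | nil => exact h
  | cons j l ih =>
    intro x hx
    have hc := contDiff_itd hg l
    change lap (pd j (itd l g)) x = 0
    rw [lap_pd (contDiff_infty.1 hc 3), pd]
    have : lap (itd l g) =ᶠ[𝓝 x] fun _ => 0 := by
      filter_upwards [hU.mem_nhds hx] with y hy using ih y hy
    rw [this.fderiv_eq]; simp

lemma taylor_zero {g : EE n → ℝ} (hg : ContDiff ℝ ((⊤ : ℕ∞) : WithTop ℕ∞) g) (z : EE n)
    {P : List (Fin n) → Prop} (hP : ∀ j l, P l → P (j :: l)) (h : ∀ l, P l → itd l g z = 0) (N : ℕ) :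
    ∀ l, P l → ∃ C, 0 ≤ C ∧ ∀ y ∈ closedBall z 1, |itd l g y| ≤ C * ‖y - z‖ ^ N := by
  induction N with
  | zero =>
    intro l _
    obtain ⟨C, hC⟩ := (isCompact_closedBall z 1).exists_bound_of_continuousOn (contDiff_itd hg l).continuous.continuousOn
    exact ⟨max C 0, le_max_right _ _, fun y hy => by simpa using Or.inl (hC y hy)⟩
  | succ N ih =>
    intro l hl
    choose C hC0 hC using fun j => ih (j :: l) (hP j l hl)
    refine ⟨∑ j, C j, Finset.sum_nonneg fun j _ => hC0 j, fun y hy => ?_⟩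
    have hy1 : ‖y - z‖ ≤ 1 := by simpa [dist_eq_norm] using hy
    have hmv := Convex.norm_image_sub_le_of_norm_fderiv_le (𝕜 := ℝ) (f := itd l g) (s := closedBall z ‖y - z‖)
      (C := (∑ j, C j) * ‖y - z‖ ^ N) (x := z) (y := y)
      (fun x _ => (contDiff_itd hg l).differentiable (by simp) x) (fun x hx => ?_)
      (convex_closedBall _ _) (by simp) (by simp [dist_eq_norm])
    · rw [h l hl, sub_zero, Real.norm_eq_abs] at hmv
      refine hmv.trans (le_of_eq (by ring))
    · have hx' : ‖x - z‖ ≤ ‖y - z‖ := by simpa [dist_eq_norm] using hx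
      refine ContinuousLinearMap.opNorm_le_bound _ (mul_nonneg (Finset.sum_nonneg fun j _ => hC0 j) (by positivity)) fun v => ?_
      rw [fderiv_apply_eq_sum, Real.norm_eq_abs]
      refine (Finset.abs_sum_le_sum_abs _ _).trans ?_
      rw [Finset.sum_mul, Finset.sum_mul]
      refine Finset.sum_le_sum fun j _ => ?_
      rw [abs_mul, mul_comm]
      have h1 : |v j| ≤ ‖v‖ := by simpa using PiLp.norm_apply_le v j
      have h2 := hC j x (by simp only [mem_closedBall, dist_eq_norm]; linarith)
      have h3 : C j * ‖x - z‖ ^ N ≤ C j * ‖y - z‖ ^ N := by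
        have := hC0 j
        gcongr
      exact mul_le_mul (h2.trans h3) h1 (abs_nonneg _) (mul_nonneg (hC0 j) (by positivity))


lemma Hf_pos {u : EE n → ℝ} (hu : ContDiff ℝ 3 u) {R : ℝ} {x : EE n} (hx : ‖x‖ < R) (h : gr2 u x ≠ 0) :
    0 < Hf u R := by
  have hc : Continuous (fun x : EE n => gr2 u x * wt R x ^ 2) := (cont_gr2 hu).mul ((continuous_wt R).pow 2)
  refine (hc.integral_pos_of_hasCompactSupport_nonneg_nonzero
    (hasCompactSupport_wt R 2 two_ne_zero).mul_left (fun y => mul_nonneg (gr2_nonneg _ _) (sq_nonneg _)) (x := x) ?_)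
  refine mul_ne_zero h (pow_ne_zero _ ?_)
  rw [wt_eq hx.le]
  nlinarith [norm_nonneg x]

lemma finite_order {g : EE n → ℝ} (hg : ContDiff ℝ ((⊤ : ℕ∞) : WithTop ℕ∞) g)
    (hl : ∀ x ∈ ball (0 : EE n) (3/4), lap g x = 0) {x z : EE n} (hx : x ∈ closedBall (0 : EE n) (1/8))
    (hz : z ∈ closedBall (0 : EE n) (1/8)) (hgx : gr2 g x ≠ 0) : ∃ l, l ≠ [] ∧ itd l g z ≠ 0 := by
  by_contra hcon
  push Not at hcon
  have hg3 : ContDiff ℝ 3 g := contDiff_infty.1 hg 3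
  have hx' : ‖x‖ ≤ 1/8 := by simpa using hx
  have hz' : ‖z‖ ≤ 1/8 := by simpa using hz
  set u : EE n → ℝ := fun y => 1 * g (z + (1:ℝ) • y) with hu
  have hu3 : ContDiff ℝ 3 u := contDiff_rescale hg3 1 1 z
  have hgr : ∀ y, gr2 u y = gr2 g (z + y) := fun y => by
    rw [hu, gr2_rescale (hg3.of_le (by norm_num))]; simp
  have hDI : ∀ y ∈ ball (0 : EE n) (1/2), DI u 0 y := by
    intro y hy
    have hy' : ‖y‖ < 1/2 := by simpa using hy
    have hmem : z + y ∈ ball (0 : EE n) (3/4) := by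
      have := norm_add_le z y
      simp only [mem_ball, dist_zero_right]; linarith
    have := DI_rescale hg3 (K := 0) 1 1 (by simp) z y (by
      unfold DI
      rw [one_smul]
      have : ∀ i, lap (pd i g) (z + y) = 0 := fun i => lap_itd hg isOpen_ball hl [i] _ hmem
      simp [this])
    rw [zero_mul] at this
    exact this
  have hpos : 0 < Hf u (1/2) := by
    refine Hf_pos hu3 (x := x - z) ?_ ?_
    · have := norm_sub_le x z; linarith
    · rw [hgr]; simpa using hgx
  set Γ := Gam u (1/2) with hΓ
  have hd := fun r (h0 : 0 < r) (h1 : r ≤ 1/2) =>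
    (doubling hu3 le_rfl (by norm_num) (by norm_num) hDI hpos (le_refl Γ) h0 h1 le_rfl).2
  obtain ⟨N, hN⟩ := exists_nat_ge (Γ + 1)
  choose C hC0 hC using fun i => taylor_zero hg z (P := fun l => l ≠ []) (fun j l _ => by simp) hcon N [i] (by simp)
  set D : ℝ := ∑ i, (C i) ^ 2 with hD
  have hD0 : 0 ≤ D := Finset.sum_nonneg fun i _ => sq_nonneg _
  have hom := om_pos n
  have hup : ∀ r, 0 < r → r ≤ 1/2 → Hf u r ≤ D * om n * r ^ N := by
    intro r h0 h1
    have h2 : Hf u r ≤ ∫ y, (ball (0 : EE n) r).indicator (fun _ => D * r ^ N) y := by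
      refine integral_mono (J_integrable (by norm_num) _ (cont_gr2 hu3))
        ((integrableOn_const measure_ball_lt_top.ne).integrable_indicator measurableSet_ball) fun y => ?_
      by_cases hy : y ∈ ball (0 : EE n) r
      · simp only [indicator_of_mem hy]
        have hy' : ‖y‖ < r := by simpa using hy
        have h3 : wt r y ^ 2 ≤ 1 := by
          have a1 := wt_le r y
          have a2 := wt_nonneg r y
          exact pow_le_one₀ a2 (by nlinarith)
        have h4 : gr2 u y ≤ D * r ^ N := by
          rw [hgr, hD, Finset.sum_mul]
          refine Finset.sum_le_sum fun i _ => ?_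
          have h5 := hC i (z + y) (by simp; linarith)
          rw [add_sub_cancel_left] at h5
          change |pd i g (z + y)| ≤ _ at h5
          rw [← sq_abs]
          have h6 : |pd i g (z + y)| ^ 2 ≤ (C i * ‖y‖ ^ N) ^ 2 := by gcongr
          refine h6.trans ?_
          rw [mul_pow]
          gcongr
          have h7 : ‖y‖ ^ N ≤ r ^ N := by gcongr
          have h8 : ‖y‖ ^ N ≤ 1 := pow_le_one₀ (norm_nonneg _) (by linarith)
          have h9 : 0 ≤ ‖y‖ ^ N := by positivity
          nlinarith
        calc gr2 u y * wt r y ^ 2 ≤ gr2 u y * 1 := mul_le_mul_of_nonneg_left h3 (gr2_nonneg _ _)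
          _ ≤ _ := by linarith
      · simp only [indicator_of_notMem hy]
        rw [wt_eq_zero h0.le (by simpa using hy)]; simp
    rw [integral_indicator measurableSet_ball, setIntegral_const, measureReal_def, vol_ball _ h0, smul_eq_mul] at h2
    refine h2.trans ?_
    have : r ^ n ≤ 1 := pow_le_one₀ h0.le (by linarith)
    calc r ^ n * om n * (D * r ^ N) ≤ 1 * om n * (D * r ^ N) := by gcongr
      _ = _ := by ring
  have hfin : ∀ r, 0 < r → r ≤ 1/2 → Hf u (1/2) * 2 ^ Γ ≤ D * om n * r := by
    intro r h0 h1
    have h2 := (hd r h0 h1).trans (hup r h0 h1)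
    have e : r / (1/2) = r * 2 := by ring
    rw [e, Real.mul_rpow h0.le (by norm_num)] at h2
    have h3 : r ^ N ≤ r ^ Γ * r := by
      have : r ^ (N : ℝ) ≤ r ^ (Γ + 1) := Real.rpow_le_rpow_of_exponent_ge h0 (by linarith) hN
      rwa [Real.rpow_natCast, Real.rpow_add h0, Real.rpow_one] at this
    have hr : 0 < r ^ Γ := Real.rpow_pos_of_pos h0 _
    have h4 : r ^ Γ * (Hf u (1/2) * 2 ^ Γ) ≤ r ^ Γ * (D * om n * r) := by
      have : D * om n * r ^ N ≤ D * om n * (r ^ Γ * r) := by gcongr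
      linarith
    exact le_of_mul_le_mul_left h4 hr
  set c := Hf u (1/2) * 2 ^ Γ with hc
  have hc0 : 0 < c := mul_pos hpos (Real.rpow_pos_of_pos (by norm_num) _)
  set T := D * om n with hT
  have hT0 : 0 ≤ T := by positivity
  have := hfin (min (1/2) (c / (2 * (T + 1)))) (by positivity) (min_le_left _ _)
  have h2 : T * min (1/2) (c / (2 * (T + 1))) ≤ T * (c / (2 * (T + 1))) := by gcongr; exact min_le_right _ _
  have h3 : T * (c / (2 * (T + 1))) ≤ c / 2 := by
    rw [mul_div_assoc', div_le_div_iff₀ (by positivity) (by norm_num)]; nlinarith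
  linarith

theorem harm_null {g : EE n → ℝ} (hg : ContDiff ℝ ((⊤ : ℕ∞) : WithTop ℕ∞) g)
    (hl : ∀ x ∈ ball (0 : EE n) (3/4), lap g x = 0) {x : EE n} (hx : x ∈ closedBall (0 : EE n) (1/8))
    (hgx : gr2 g x ≠ 0) : μH[(n : ℝ) - 1] ({y | gr2 g y = 0} ∩ closedBall (0 : EE n) (1/8)) = 0 := by
  have hpd0 : ∀ (h : EE n → ℝ) z, (∀ i, pd i h z = 0) → gr2 h z = 0 := fun h z hi => by simp [gr2, hi]
  have hsub : {y | gr2 g y = 0} ∩ closedBall (0 : EE n) (1/8) ⊆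
      ⋃ l : List (Fin n), {z | gr2 (itd l g) z = 0 ∧ hs2 (itd l g) z ≠ 0 ∧ z ∈ ball (0 : EE n) (3/4)} := by
    rintro z ⟨hz1, hz2⟩
    obtain ⟨l, hl0, hlz⟩ := finite_order hg hl hx hz2 hgx
    classical
    have hex : ∃ k, ∃ l : List (Fin n), l.length = k ∧ l ≠ [] ∧ itd l g z ≠ 0 := ⟨_, l, rfl, hl0, hlz⟩
    obtain ⟨l, hk, hl0, hlz⟩ := Nat.find_spec hex
    have hmin : ∀ l' : List (Fin n), l'.length < l.length → l' ≠ [] → itd l' g z = 0 := by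
      intro l' h1 h2
      by_contra h3
      exact Nat.find_min hex (h1.trans_eq hk) ⟨l', rfl, h2, h3⟩
    rw [mem_iUnion]
    match l, hl0, hlz, hmin with
    | [j], _, hlz, _ =>
      exfalso
      apply hlz
      have := pd_sq_le_gr2 g z j
      rw [show gr2 g z = 0 from hz1] at this
      exact pow_eq_zero_iff two_ne_zero |>.1 (le_antisymm this (sq_nonneg _))
    | j :: k :: l, _, hlz, hmin =>
      refine ⟨l, hpd0 _ _ fun i => hmin (i :: l) (by simp) (by simp), fun h0 => hlz ?_,
        closedBall_subset_ball (by norm_num) hz2⟩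
      have := pd_sq_le_hs2 (itd l g) z k j
      rw [h0] at this
      exact pow_eq_zero_iff two_ne_zero |>.1 (le_antisymm this (sq_nonneg _))
  refine measure_mono_null hsub (measure_iUnion_null fun l => ?_)
  refine measure_null_of_locally_null _ fun z hz => ?_
  obtain ⟨U, hU, h0⟩ := local_null (contDiff_infty.1 (contDiff_itd hg l) 2) (lap_itd hg isOpen_ball hl l z hz.2.2) hz.2.1
  refine ⟨_, inter_mem_nhdsWithin _ hU, measure_mono_null ?_ h0⟩
  rintro y ⟨hy1, hy2⟩
  exact ⟨hy1.1, hy2⟩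


lemma sum_image_le' {ι : Type*} [DecidableEq (EE n × ℝ)] (s : Finset ι) (f : ι → EE n × ℝ) (w : EE n × ℝ → ℝ)
    (hw : ∀ i ∈ s, 0 ≤ w (f i)) : ∑ p ∈ s.image f, w p ≤ ∑ i ∈ s, w (f i) := by
  classical
  have h := Finset.sum_fiberwise_of_maps_to (s := s) (t := s.image f) (g := f)
    (fun i hi => Finset.mem_image_of_mem f hi) (fun i => w (f i))
  rw [← h]
  refine Finset.sum_le_sum fun p hp => ?_
  obtain ⟨i, hi, rfl⟩ := Finset.mem_image.1 hp
  refine Finset.single_le_sum (f := fun j => w (f j)) (fun j hj => hw j (Finset.mem_filter.1 hj).1)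
    (Finset.mem_filter.2 ⟨hi, rfl⟩)

lemma null_cover (hn : 0 < n) {Z : Set (EE n)} (hZ : IsCompact Z)
    (h0 : μH[(n : ℝ) - 1] Z = 0) {δ η : ℝ} (hδ : 0 < δ) (hη : 0 < η) :
    ∃ t : Finset (EE n × ℝ), (Z ⊆ ⋃ p ∈ t, ball p.1 p.2) ∧ (∀ p ∈ t, 0 < p.2 ∧ p.2 ≤ δ) ∧
    ∑ p ∈ t, p.2 ^ (n - 1) ≤ η := by
  classical
  rcases Nat.lt_or_ge 1 n with hn1 | hn1
  swap
  · have hn1 : n = 1 := by omega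
    subst hn1
    have hZe : Z = ∅ := by
      by_contra hne
      obtain ⟨z, hz⟩ := Set.nonempty_iff_ne_empty.2 hne
      have h1 := measure_mono_null (singleton_subset_iff.2 hz) h0
      simp only [Nat.cast_one, sub_self] at h1
      rw [Measure.hausdorffMeasure_zero_singleton] at h1
      exact one_ne_zero h1
    exact ⟨∅, by simp [hZe], by simp, by simpa using hη.le⟩
  obtain ⟨m, rfl⟩ : ∃ m, n = m + 2 := ⟨n - 2, by omega⟩
  simp only [show m + 2 - 1 = m + 1 by omega]
  have hd : ((m + 2 : ℕ) : ℝ) - 1 = ((m + 1 : ℕ) : ℝ) := by push_cast; ring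
  rw [hd] at h0
  set d := m + 1 with hdd
  rw [Measure.hausdorffMeasure_apply] at h0
  simp only [ENNReal.iSup_eq_zero] at h0
  set η' : ℝ := η / (2 * 2 ^ d) with hη'
  have hη'0 : 0 < η' := by positivity
  have h1 := h0 (ENNReal.ofReal (δ / 2)) (by simpa using hδ)
  have h2 : (⨅ (t : ℕ → Set (EE (m + 2))) (_ : Z ⊆ ⋃ n, t n) (_ : ∀ n, ediam (t n) ≤ ENNReal.ofReal (δ / 2)),
      ∑' n, ⨆ _ : (t n).Nonempty, ediam (t n) ^ ((d : ℕ) : ℝ)) < ENNReal.ofReal η' := by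
    rw [h1]; simpa using hη'0
  simp only [iInf_lt_iff] at h2
  obtain ⟨t, htZ, htd, hts⟩ := h2
  have hfin : ∀ i, ediam (t i) ≠ ⊤ := fun i => ((htd i).trans_lt ENNReal.ofReal_lt_top).ne
  set D : ℕ → ℝ := fun i => (ediam (t i)).toReal with hD
  have hD0 : ∀ i, 0 ≤ D i := fun i => ENNReal.toReal_nonneg
  have hDle : ∀ i, D i ≤ δ / 2 := fun i => ENNReal.toReal_le_of_le_ofReal (by positivity) (htd i)
  set κ : ℝ := min (min 1 (δ / 2)) η' with hκ
  have hκ0 : 0 < κ := by positivity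
  have hκ1 : κ ≤ 1 := (min_le_left _ _).trans (min_le_left _ _)
  have hκδ : κ ≤ δ / 2 := (min_le_left _ _).trans (min_le_right _ _)
  have hκη : κ ≤ η' := min_le_right _ _
  set r : ℕ → ℝ := fun i => D i + κ * (1/2) ^ (i + 1) with hr
  have hp : ∀ i : ℕ, (0:ℝ) < (1/2) ^ (i + 1) ∧ (1/2 : ℝ) ^ (i + 1) ≤ 1 := fun i =>
    ⟨by positivity, pow_le_one₀ (by norm_num) (by norm_num)⟩
  have hr0 : ∀ i, 0 < r i := fun i => add_pos_of_nonneg_of_pos (hD0 i) (mul_pos hκ0 (hp i).1)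
  have hrδ : ∀ i, r i ≤ δ := fun i => by
    have := mul_le_of_le_one_right hκ0.le (hp i).2
    have := hDle i
    simp only [hr]; linarith
  set c : ℕ → EE (m + 2) := fun i => if h : (t i).Nonempty then h.some else 0 with hc
  have hsub : ∀ i, t i ⊆ ball (c i) (r i) := by
    intro i x hx
    have hne : (t i).Nonempty := ⟨x, hx⟩
    have hci : c i ∈ t i := by simp only [hc, dif_pos hne]; exact hne.some_mem
    have h3 := edist_le_ediam_of_mem hx hci
    have h4 : dist x (c i) ≤ D i := by
      rw [dist_edist]; exact ENNReal.toReal_mono (hfin i) h3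
    rw [mem_ball]
    have := mul_pos hκ0 (hp i).1
    simp only [hr]; linarith
  obtain ⟨s, hs⟩ := hZ.elim_finite_subcover (fun i => ball (c i) (r i)) (fun i => isOpen_ball)
    (htZ.trans (iUnion_mono hsub))
  -- only the nonempty pieces
  set s' := s.filter (fun i => (t i).Nonempty) with hs'
  have hcov : Z ⊆ ⋃ i ∈ s, ball (c i) (r i) := hs
  have hsum1 : ∑ i ∈ s, (if (t i).Nonempty then D i ^ d else 0) ≤ η' := by
    have h5 : ∑ i ∈ s, (⨆ _ : (t i).Nonempty, ediam (t i) ^ ((d : ℕ) : ℝ)) ≤ ENNReal.ofReal η' :=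
      (ENNReal.sum_le_tsum s).trans hts.le
    have h6 := ENNReal.toReal_le_of_le_ofReal hη'0.le h5
    rw [ENNReal.toReal_sum] at h6
    · refine le_trans (le_of_eq ?_) h6
      refine Finset.sum_congr rfl fun i _ => ?_
      by_cases hne : (t i).Nonempty
      · simp [hne, hD]
      · simp [hne]
    · intro i hi
      exact ((Finset.single_le_sum (f := fun i => ⨆ _ : (t i).Nonempty, ediam (t i) ^ ((d : ℕ) : ℝ))
        (fun _ _ => zero_le) hi).trans h5).trans_lt ENNReal.ofReal_lt_top |>.ne
  have hDd : ∀ i, D i ^ d ≤ (if (t i).Nonempty then D i ^ d else 0) := by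
    intro i
    by_cases hne : (t i).Nonempty
    · simp [hne]
    · have : D i = 0 := by
        simp [hD, Set.not_nonempty_iff_eq_empty.1 hne]
      simp [hne, this, hdd]
  have hgeo : ∑ i ∈ s, ((1:ℝ)/2) ^ (i + 1) ≤ 1 := by
    have h7 : HasSum (fun i : ℕ => ((1:ℝ)/2) ^ (i + 1)) 1 := by
      have := (hasSum_geometric_two).mul_right (1/2 : ℝ)
      norm_num at this
      simpa [pow_succ] using this
    exact sum_le_hasSum s (fun i _ => (hp i).1.le) h7
  refine ⟨s.image (fun i => (c i, r i)), ?_, ?_, ?_⟩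
  · intro z hz
    have := hcov hz
    simp only [mem_iUnion] at this ⊢
    obtain ⟨i, hi, hzi⟩ := this
    exact ⟨(c i, r i), Finset.mem_image_of_mem _ hi, hzi⟩
  · intro p hp
    obtain ⟨i, hi, rfl⟩ := Finset.mem_image.1 hp
    exact ⟨hr0 i, hrδ i⟩
  · refine (sum_image_le' s (fun i => (c i, r i)) (fun p => p.2 ^ d) (fun i _ => (pow_pos (hr0 i) d).le)).trans ?_
    have hterm : ∀ i, r i ^ d ≤ 2 ^ d * ((if (t i).Nonempty then D i ^ d else 0) + κ * (1/2) ^ (i + 1)) := by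
      intro i
      set q := κ * (1/2) ^ (i + 1) with hq
      have hq0 : 0 ≤ q := by positivity
      have hq1 : q ≤ 1 := by
        have := mul_le_of_le_one_right hκ0.le (hp i).2; linarith
      have h8 : q ^ d ≤ q := by
        have := pow_le_of_le_one hq0 hq1 (n := d) (by omega); exact this
      have h9 : (D i + q) ^ d ≤ 2 ^ d * (D i ^ d + q ^ d) := by
        have h10 : D i + q ≤ 2 * max (D i) q := by
          linarith [le_max_left (D i) q, le_max_right (D i) q]
        have h11 : (max (D i) q) ^ d ≤ D i ^ d + q ^ d := by
          rcases max_choice (D i) q with h | h <;> rw [h]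
          · linarith [pow_nonneg hq0 d]
          · linarith [pow_nonneg (hD0 i) d]
        calc (D i + q) ^ d ≤ (2 * max (D i) q) ^ d := pow_le_pow_left₀ (add_nonneg (hD0 i) hq0) h10 d
          _ = 2 ^ d * (max (D i) q) ^ d := mul_pow _ _ _
          _ ≤ _ := by gcongr
      refine h9.trans ?_
      gcongr
      exact hDd i
    refine (Finset.sum_le_sum fun i _ => hterm i).trans ?_
    rw [← Finset.mul_sum, Finset.sum_add_distrib, ← Finset.mul_sum]
    have : κ * ∑ i ∈ s, ((1:ℝ)/2) ^ (i + 1) ≤ η' := by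
      calc _ ≤ κ * 1 := by gcongr
        _ ≤ η' := by linarith
    calc _ ≤ 2 ^ d * (η' + η') := by gcongr
      _ = η := by rw [hη']; field_simp; ring


lemma glue_deriv_zero {t : ℝ} (ht : t ≤ 0) : deriv expNegInvGlue t = 0 := by
  apply IsLocalMin.deriv_eq_zero
  filter_upwards with s
  rw [expNegInvGlue.zero_of_nonpos ht]
  exact expNegInvGlue.nonneg s

lemma exists_mollifier (hn : 0 < n) : ∃ ρ κ : EE n → ℝ, ContDiff ℝ ((⊤ : ℕ∞) : WithTop ℕ∞) ρ ∧
    ContDiff ℝ ((⊤ : ℕ∞) : WithTop ℕ∞) κ ∧ (∀ y, 1/8 < ‖y‖ → ρ y = 0) ∧ (∀ y, 1/8 < ‖y‖ → κ y = 0) ∧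
    (∀ y, ρ (-y) = ρ y) ∧ (∫ y, ρ y = 1) ∧ (∀ j y, pd j κ y = - (y j) * ρ y) := by
  set G := expNegInvGlue with hG
  have hGs : ContDiff ℝ ((⊤ : ℕ∞) : WithTop ℕ∞) G := expNegInvGlue.contDiff
  have hG's : ContDiff ℝ ((⊤ : ℕ∞) : WithTop ℕ∞) (deriv G) :=
    ((contDiff_infty_iff_deriv (f := G)).1 hGs).2
  have hin : ContDiff ℝ ((⊤ : ℕ∞) : WithTop ℕ∞) (fun y : EE n => 1 - 64 * ‖y‖ ^ 2) :=
    contDiff_const.sub (contDiff_const.mul (contDiff_norm_sq ℝ))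
  set q : EE n → ℝ := fun y => 128 * deriv G (1 - 64 * ‖y‖ ^ 2) with hq
  set k : EE n → ℝ := fun y => G (1 - 64 * ‖y‖ ^ 2) with hk
  have hqs : ContDiff ℝ ((⊤ : ℕ∞) : WithTop ℕ∞) q := contDiff_const.mul (hG's.comp hin)
  have hks : ContDiff ℝ ((⊤ : ℕ∞) : WithTop ℕ∞) k := hGs.comp hin
  have hneg : ∀ y : EE n, 1/8 < ‖y‖ → 1 - 64 * ‖y‖ ^ 2 ≤ 0 := fun y hy => by nlinarith
  have hq0 : ∀ y, 1/8 < ‖y‖ → q y = 0 := fun y hy => by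
    simp only [hq]; rw [glue_deriv_zero (hneg y hy), mul_zero]
  have hk0 : ∀ y, 1/8 < ‖y‖ → k y = 0 := fun y hy => expNegInvGlue.zero_of_nonpos (hneg y hy)
  have hpd : ∀ j y, pd j k y = - (y j) * q y := by
    intro j y
    have h1 := pd_comp (φ := G) (g := fun y : EE n => 1 - 64 * ‖y‖ ^ 2) (x := y)
      ((hGs.differentiable (by simp)) _).hasDerivAt ((hin.differentiable (by simp)) y) j
    have h2 : pd j (fun y : EE n => 1 - 64 * ‖y‖ ^ 2) y = - (128 * y j) := by
      have hd : DifferentiableAt ℝ (fun y : EE n => ‖y‖ ^ 2) y :=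
        ((contDiff_norm_sq ℝ (n := 1)).differentiable (by simp)) y
      rw [pd_sub (differentiableAt_const _) (hd.const_mul _), pd_const, pd_const_mul _ hd, pd_normsq]
      ring
    rw [hk, h1, h2]; simp only [hq]; ring
  have hqnn : ∀ y, 0 ≤ q y := fun y => mul_nonneg (by norm_num) (expNegInvGlue.monotone.deriv_nonneg)
  have hqc : HasCompactSupport q := HasCompactSupport.intro (isCompact_closedBall (0 : EE n) (1/8))
    (fun y hy => hq0 y (by simpa using hy))
  have hpos : 0 < ∫ y, q y := by
    obtain ⟨c, hc, hc2⟩ := exists_deriv_eq_slope G (zero_lt_one)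
      (hGs.continuous.continuousOn) ((hGs.differentiable (by simp)).differentiableOn)
    have hG1 : 0 < G 1 := expNegInvGlue.pos_of_pos one_pos
    have hG0 : G 0 = 0 := expNegInvGlue.zero
    have hy : q ((Real.sqrt (1 - c) / 8) • ee ⟨0, hn⟩) ≠ 0 := by
      simp only [hq]
      have : 1 - 64 * ‖(Real.sqrt (1 - c) / 8) • ee (⟨0, hn⟩ : Fin n)‖ ^ 2 = c := by
        rw [norm_smul]
        simp only [EuclideanSpace.norm_single, norm_one, mul_one, Real.norm_eq_abs, sq_abs, div_pow]
        rw [Real.sq_sqrt (by linarith [hc.2])]; ring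
      rw [this, hc2, hG0]
      simp; exact hG1.ne'
    exact (hqs.continuous).integral_pos_of_hasCompactSupport_nonneg_nonzero hqc hqnn hy
  refine ⟨fun y => (∫ y, q y)⁻¹ * q y, fun y => (∫ y, q y)⁻¹ * k y, contDiff_const.mul hqs,
    contDiff_const.mul hks, fun y hy => by simp [hq0 y hy], fun y hy => by simp [hk0 y hy],
    fun y => by simp [hq], ?_, ?_⟩
  · rw [integral_const_mul, inv_mul_cancel₀ hpos.ne']
  · intro j y
    rw [pd_const_mul _ ((hks.differentiable (by simp)) y), hpd]; ring

/-- convolution -/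
def cv (F κ : EE n → ℝ) (x : EE n) : ℝ := ∫ t, F t * κ (x - t)

lemma cv_eq (F κ : EE n → ℝ) : cv F κ = convolution F κ (ContinuousLinearMap.mul ℝ ℝ) volume := by
  ext x; simp [cv, convolution]

lemma cv_contDiff {F κ : EE n → ℝ} (hF : Continuous F) (hκ : ContDiff ℝ ((⊤ : ℕ∞) : WithTop ℕ∞) κ)
    (hc : HasCompactSupport κ) : ContDiff ℝ ((⊤ : ℕ∞) : WithTop ℕ∞) (cv F κ) := by
  rw [cv_eq]
  exact hc.contDiff_convolution_right _ hF.locallyIntegrable hκ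

lemma pd_hcs {κ : EE n → ℝ} (hc : HasCompactSupport κ) (j : Fin n) : HasCompactSupport (pd j κ) :=
  HasCompactSupport.fderiv_apply ℝ hc _

lemma cv_int {F κ : EE n → ℝ} (hF : Continuous F) (hκ : Continuous κ)
    (hc : HasCompactSupport κ) (x : EE n) : Integrable (fun t => F t * κ (x - t)) := by
  have := hc.convolutionExists_right (ContinuousLinearMap.mul ℝ ℝ) (μ := volume) hF.locallyIntegrable hκ x
  simpa [ConvolutionExistsAt] using this

lemma cv_pd {F κ : EE n → ℝ} (hF : Continuous F) (hκ : ContDiff ℝ 1 κ)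
    (hc : HasCompactSupport κ) (j : Fin n) : pd j (cv F κ) = cv F (pd j κ) := by
  ext x
  rw [cv_eq]
  have h := hc.hasFDerivAt_convolution_right (ContinuousLinearMap.mul ℝ ℝ) (μ := volume)
    hF.locallyIntegrable hκ x
  rw [hasFDerivAt_pd_eq h]
  have h2 := ((hc.fderiv ℝ).convolutionExists_right ((ContinuousLinearMap.mul ℝ ℝ).precompR (EE n))
    (μ := volume) hF.locallyIntegrable (hκ.continuous_fderiv (by norm_num)) x)
  rw [convolution, ContinuousLinearMap.integral_apply h2.integrable]
  simp [cv, pd]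

lemma cv_pd_left {F κ : EE n → ℝ} (hF : ContDiff ℝ 1 F) (hκ : ContDiff ℝ 1 κ)
    (hc : HasCompactSupport κ) (j : Fin n) (x : EE n) : cv F (pd j κ) x = cv (pd j F) κ x := by
  have hG : ContDiff ℝ 1 (fun t => κ (x - t)) := hκ.comp (contDiff_const.sub contDiff_id)
  have hGc : HasCompactSupport (fun t => κ (x - t)) :=
    hc.comp_homeomorph (Homeomorph.subLeft x)
  have h := integral_by_parts hF hG hGc j
  have h2 : ∀ t, pd j (fun t => κ (x - t)) t = - pd j κ (x - t) := by
    intro t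
    have := (hκ.differentiable (by norm_num) (x - t)).hasFDerivAt.comp t
      ((hasFDerivAt_id t).const_sub x)
    rw [show (fun t => κ (x - t)) = κ ∘ (fun t => x - t) from rfl, hasFDerivAt_pd_eq this]
    simp [pd]
  simp only [h2, mul_neg, integral_neg, neg_neg] at h
  exact h.symm

lemma cv_diff {F F' κ : EE n → ℝ} (hF : Continuous F) (hF' : Continuous F') (hκ : Continuous κ)
    (hs : ∀ y, 1/8 < ‖y‖ → κ y = 0) {η : ℝ} 
    (hη : ∀ y ∈ closedBall (0 : EE n) (7/8), |F y - F' y| ≤ η) {x : EE n} (hx : ‖x‖ ≤ 3/4) :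
    |cv F κ x - cv F' κ x| ≤ η * ∫ y, |κ y| := by
  have hc : HasCompactSupport κ := HasCompactSupport.intro (isCompact_closedBall (0 : EE n) (1/8))
    (fun y hy => hs y (by simpa using hy))
  have h1 := cv_int hF hκ hc x
  have h2 := cv_int hF' hκ hc x
  unfold cv
  rw [← integral_sub h1 h2, ← integral_sub_left_eq_self (fun y => |κ y|) volume x, ← integral_const_mul]
  have hi : Integrable (fun t => |κ (x - t)|) :=
    (hκ.abs.comp (continuous_const.sub continuous_id)).integrable_of_hasCompactSupport
      ((hc.comp_left (g := fun t : ℝ => |t|) (by simp)).comp_homeomorph (Homeomorph.subLeft x))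
  refine (abs_integral_le_integral_abs).trans (integral_mono (h1.sub h2).abs (hi.const_mul η) ?_)
  intro t
  by_cases ht : 1/8 < ‖x - t‖
  · simp [hs _ ht]
  · simp only [Pi.sub_apply]
    rw [← sub_mul, abs_mul]
    refine mul_le_mul_of_nonneg_right (hη t ?_) (abs_nonneg _)
    have := norm_sub_norm_le t x
    rw [norm_sub_rev] at this
    simp; linarith

lemma mean_est {ρ κ : EE n → ℝ} (hρ : ContDiff ℝ ((⊤ : ℕ∞) : WithTop ℕ∞) ρ)
    (hκ : ContDiff ℝ ((⊤ : ℕ∞) : WithTop ℕ∞) κ) (hρ0 : ∀ y, 1/8 < ‖y‖ → ρ y = 0)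
    (hκ0 : ∀ y, 1/8 < ‖y‖ → κ y = 0) (hev : ∀ y, ρ (-y) = ρ y) (h1 : ∫ y, ρ y = 1)
    (hpd : ∀ j y, pd j κ y = - (y j) * ρ y) {v : EE n → ℝ} (hv : ContDiff ℝ 2 v) {F : ℝ}
    (x : EE n) (hF : ∀ y ∈ closedBall x (1/8), |lap v y| ≤ F) :
    |cv v ρ x - v x| ≤ F * ∫ y, |κ y| := by
  have hcρ : HasCompactSupport ρ := HasCompactSupport.intro (isCompact_closedBall (0 : EE n) (1/8))
    (fun y hy => hρ0 y (by simpa using hy))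
  have hcκ : HasCompactSupport κ := HasCompactSupport.intro (isCompact_closedBall (0 : EE n) (1/8))
    (fun y hy => hκ0 y (by simpa using hy))
  have hF0 : 0 ≤ F := (abs_nonneg _).trans (hF x (by simp))
  set m : ℝ → ℝ := fun s => ∫ y, v (x + s • y) * ρ y with hm
  have hvc : Continuous v := hv.continuous
  have hρc : Continuous ρ := hρ.continuous
  have hκc : Continuous κ := hκ.continuous
  have hm1 : m 1 = cv v ρ x := by
    simp only [hm, cv, one_smul]
    rw [← integral_sub_left_eq_self (fun t => v t * ρ (x - t)) volume x,
      ← integral_neg_eq_self (fun t => v (x - t) * ρ (x - (x - t)))]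
    refine integral_congr_ae (ae_of_all _ fun y => ?_)
    simp [hev]
  have hm0 : m 0 = v x := by
    simp only [hm, zero_smul, add_zero]
    rw [integral_const_mul, h1, mul_one]
  have hdv : Continuous (fderiv ℝ v) := hv.continuous_fderiv (by norm_num)
  have hder : ∀ s, HasDerivAt m (∫ y, fderiv ℝ v (x + s • y) y * ρ y) s := by
    intro s
    obtain ⟨B, hB⟩ := ((isCompact_closedBall (0:ℝ) (|s| + 1)).prod
      (isCompact_closedBall (0 : EE n) (1/8))).exists_bound_of_continuousOn
      (f := fun p : ℝ × EE n => fderiv ℝ v (x + p.1 • p.2) p.2 * ρ p.2)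
      (by
        apply Continuous.continuousOn
        exact ((hdv.comp (by fun_prop)).clm_apply continuous_snd).mul (hρc.comp continuous_snd))
    refine (hasDerivAt_integral_of_dominated_loc_of_deriv_le
      (bound := fun y => (closedBall (0 : EE n) (1/8)).indicator (fun _ => B) y)
      (F' := fun s y => fderiv ℝ v (x + s • y) y * ρ y) (ball_mem_nhds s one_pos) ?_ ?_ ?_ ?_ ?_ ?_).2
    · exact Eventually.of_forall fun s => Continuous.aestronglyMeasurable (by fun_prop)
    · exact Continuous.integrable_of_hasCompactSupport (by fun_prop) hcρ.mul_left
    · exact Continuous.aestronglyMeasurable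
        (((hdv.comp (by fun_prop)).clm_apply continuous_id).mul hρc)
    · refine ae_of_all _ fun y r hr => ?_
      by_cases hy : y ∈ closedBall (0 : EE n) (1/8)
      · rw [indicator_of_mem hy]
        refine hB (r, y) ⟨?_, hy⟩
        simp only [mem_closedBall, mem_ball, Real.dist_eq, sub_zero] at hr ⊢
        have := abs_add_le (r - s) s
        simp only [sub_add_cancel] at this
        linarith
      · rw [indicator_of_notMem hy, hρ0 y (by simpa using hy)]; simp
    · rw [integrable_indicator_iff measurableSet_closedBall]
      exact integrableOn_const (measure_closedBall_lt_top.ne)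
    · refine ae_of_all _ fun y r _ => ?_
      have hl : HasDerivAt (fun r : ℝ => x + r • y) y r := by
        simpa using ((hasDerivAt_id r).smul_const y).const_add x
      exact ((hv.differentiable (by norm_num) (x + r • y)).hasFDerivAt.comp_hasDerivAt r hl).mul_const _
  have hval : ∀ s, ∫ y, fderiv ℝ v (x + s • y) y * ρ y = s * ∫ y, lap v (x + s • y) * κ y := by
    intro s
    have e1 : ∀ y, fderiv ℝ v (x + s • y) y * ρ y = ∑ j, - (pd j v (x + s • y) * pd j κ y) := by
      intro y
      rw [fderiv_apply_eq_sum, Finset.sum_mul]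
      refine Finset.sum_congr rfl fun j _ => ?_
      rw [hpd]; ring
    have hc1 : ∀ j, ContDiff ℝ 1 (fun y => 1 * pd j v (x + s • y)) := fun j =>
      contDiff_rescale (contDiff_pd hv (by norm_num) j) 1 s x
    have hκ1 : ContDiff ℝ 1 κ := hκ.of_le (by exact_mod_cast le_top)
    have e2 : ∀ j, ∫ y, - (pd j v (x + s • y) * pd j κ y) = ∫ y, s * (pd j (pd j v) (x + s • y) * κ y) := by
      intro j
      have := integral_by_parts (hc1 j) hκ1 hcκ j
      rw [pd_rescale_fun (contDiff_pd hv (by norm_num) j)] at this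
      rw [integral_neg]
      simp only [one_mul] at this
      rw [← this]
      exact integral_congr_ae (ae_of_all _ fun y => by ring)
    have hci : ∀ j, Continuous (pd j κ) := fun j => (contDiff_pd (m := 0) hκ1 (by norm_num) j).continuous
    have hcj : ∀ j, Continuous (pd j (pd j v)) := fun j =>
      (contDiff_pd (m := 0) (contDiff_pd (m := 1) hv (by norm_num) j) (by norm_num) j).continuous
    have hcj' : ∀ j, Continuous (pd j v) := fun j => (contDiff_pd (m := 1) hv (by norm_num) j).continuous
    simp_rw [e1]
    rw [integral_finset_sum]
    · simp_rw [e2]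
      rw [← integral_finset_sum, ← integral_const_mul]
      · refine integral_congr_ae (ae_of_all _ fun y => ?_)
        simp only [lap, Finset.sum_mul, Finset.mul_sum]
      · intro j _
        refine Continuous.integrable_of_hasCompactSupport ?_ (hcκ.mul_left.mul_left)
        exact continuous_const.mul (((hcj j).comp (by fun_prop)).mul hκc)
    · intro j _
      refine (Continuous.integrable_of_hasCompactSupport ?_ ((pd_hcs hcκ j).mul_left)).neg
      exact ((hcj' j).comp (by fun_prop)).mul (hci j)
  have hbd : ∀ s ∈ Icc (0:ℝ) 1, ‖∫ y, fderiv ℝ v (x + s • y) y * ρ y‖ ≤ F * ∫ y, |κ y| := by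
    intro s hs
    rw [hval, norm_mul, Real.norm_eq_abs, abs_of_nonneg hs.1]
    have hIntg : Integrable (fun y => |κ y|) := hκc.abs.integrable_of_hasCompactSupport
      (hcκ.comp_left (g := fun t : ℝ => |t|) (by simp))
    have : ‖∫ y, lap v (x + s • y) * κ y‖ ≤ ∫ y, F * |κ y| := by
      refine norm_integral_le_of_norm_le (hIntg.const_mul F) (ae_of_all _ fun y => ?_)
      by_cases hy : 1/8 < ‖y‖
      · simp [hκ0 y hy]
      · rw [norm_mul]
        refine mul_le_mul_of_nonneg_right (hF _ ?_) (abs_nonneg _)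
        simp only [mem_closedBall, dist_self_add_left, norm_smul, Real.norm_eq_abs, abs_of_nonneg hs.1]
        push Not at hy
        nlinarith [hs.2, norm_nonneg y]
    rw [integral_const_mul] at this
    calc _ ≤ 1 * ‖∫ y, lap v (x + s • y) * κ y‖ := by
          exact mul_le_mul_of_nonneg_right hs.2 (norm_nonneg _)
      _ ≤ _ := by rw [one_mul]; exact this
  have := (convex_Icc (0:ℝ) 1).norm_image_sub_le_of_norm_hasDerivWithin_le
    (fun s _ => (hder s).hasDerivWithinAt) hbd (left_mem_Icc.2 zero_le_one) (right_mem_Icc.2 zero_le_one)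
  rw [hm1, hm0] at this
  simpa using this


lemma lip_of_gr2 {u : EE n → ℝ} (hu : ContDiff ℝ 1 u) {s : Set (EE n)} (hs : Convex ℝ s) {B : ℝ} (hB0 : 0 ≤ B)
    (hB : ∀ x ∈ s, gr2 u x ≤ B ^ 2) {x y : EE n} (hx : x ∈ s) (hy : y ∈ s) :
    |u y - u x| ≤ B * ‖y - x‖ := by
  refine Convex.norm_image_sub_le_of_norm_fderiv_le (𝕜 := ℝ)
    (fun z _ => hu.differentiable (by norm_num) z) (fun z hz => ?_) hs hx hy
  refine (norm_fderiv_le_gr2 _ _).trans ?_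
  rw [← Real.sqrt_sq hB0]
  exact Real.sqrt_le_sqrt (hB z hz)

lemma seq_compact {u : ℕ → EE n → ℝ} (hu : ∀ k, ContDiff ℝ 1 (u k)) {Λ : ℝ} (hΛ : 0 ≤ Λ)
    (hg : ∀ k, ∀ x ∈ ball (0 : EE n) 1, gr2 (u k) x ≤ Λ ^ 2) :
    ∃ φ : ℕ → ℕ, StrictMono φ ∧ ∃ h : EE n → ℝ, Continuous h ∧ ∀ η > 0, ∀ᶠ k in atTop,
      ∀ y ∈ closedBall (0 : EE n) (7/8), |(u (φ k) y - u (φ k) 0) - h y| ≤ η := by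
  have hsub : ∀ y ∈ closedBall (0 : EE n) (7/8), y ∈ ball (0 : EE n) 1 := fun y hy => by
    simp at hy ⊢; linarith
  let X := closedBall (0 : EE n) (7/8)
  have : CompactSpace X := isCompact_iff_compactSpace.1 (isCompact_closedBall _ _)
  have hl : ∀ k, ∀ x ∈ X, ∀ y ∈ X, |u k y - u k x| ≤ Λ * ‖y - x‖ := fun k x hx y hy =>
    lip_of_gr2 (hu k) (convex_ball _ _) hΛ (hg k) (hsub x hx) (hsub y hy)
  let F : ℕ → BoundedContinuousFunction X ℝ := fun k => BoundedContinuousFunction.mkOfCompact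
    ⟨fun x => u k x - u k 0, ((hu k).continuous.comp continuous_subtype_val).sub continuous_const⟩
  have hFv : ∀ k x, F k x = u k x - u k 0 := fun k x => rfl
  have hcomp := BoundedContinuousFunction.arzela_ascoli (closedBall (0:ℝ) Λ) (isCompact_closedBall _ _) (range F)
    (by
      rintro _ x ⟨k, rfl⟩
      rw [hFv, mem_closedBall, Real.dist_eq, sub_zero]
      refine (hl k 0 (mem_closedBall_self (by norm_num)) x x.2).trans ?_
      have : ‖(x : EE n) - 0‖ ≤ 7/8 := by rw [sub_zero]; exact mem_closedBall_zero_iff.1 x.2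
      nlinarith)
    (by
      apply UniformEquicontinuous.equicontinuous
      refine LipschitzWith.uniformEquicontinuous _ (Real.toNNReal Λ) ?_
      rintro ⟨_, k, rfl⟩
      refine LipschitzWith.of_dist_le_mul fun x y => ?_
      rw [Real.coe_toNNReal _ hΛ]
      simp only [hFv, Real.dist_eq, sub_sub_sub_cancel_right]
      have := hl k y y.2 x x.2
      rwa [← dist_eq_norm] at this)
  obtain ⟨a, -, φ, hφ, ha⟩ := hcomp.tendsto_subseq (x := F) (fun k => subset_closure ⟨k, rfl⟩)
  obtain ⟨h, hh⟩ := ContinuousMap.exists_restrict_eq (s := X) isClosed_closedBall a.toContinuousMap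
  refine ⟨φ, hφ, h, h.continuous, fun η hη => ?_⟩
  filter_upwards [(Metric.tendsto_nhds.1 ha) η hη] with k hk y hy
  have h1 : h y = a ⟨y, hy⟩ := by
    have := congrArg (fun f => f (⟨y, hy⟩ : X)) hh
    simpa using this
  rw [h1, ← Real.dist_eq]
  exact (BoundedContinuousFunction.dist_coe_le_dist (f := F (φ k)) (g := a) (⟨y, hy⟩ : X)).trans hk.le

lemma bounds_aux (hn : 0 < n) {u : EE n → ℝ} (hu : ContDiff ℝ 3 u) {ε Λ : ℝ} (he0 : 0 ≤ ε) (he : ε ≤ 1)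
    (hΛ : 0 ≤ Λ) (hD : ∀ x ∈ ball (0 : EE n) 1, DI u ε x)
    (hg : ∀ x ∈ ball (0 : EE n) 1, gr2 u x ≤ Λ ^ 2) (h0 : |lap u 0| ≤ ε) {D : ℝ} 
    (hDD : D = Real.sqrt (Λ ^ 2 + (136 * n ^ 3 * Λ) ^ 2)) {y : EE n} (hy : y ∈ closedBall (0 : EE n) (7/8)) :
    (∀ j, |lap (pd j u) y| ≤ ε * D) ∧ |lap u y| ≤ ε * (1 + D) := by
  have hsub : ∀ y ∈ closedBall (0 : EE n) (7/8), y ∈ ball (0 : EE n) 1 := fun y hy => by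
    simp at hy ⊢; linarith
  have hD0 : 0 ≤ D := hDD ▸ Real.sqrt_nonneg _
  have hsq : ∀ y ∈ closedBall (0 : EE n) (7/8), ∑ i, (lap (pd i u) y) ^ 2 ≤ (ε * D) ^ 2 := by
    intro y hy
    refine (hD y (hsub y hy)).trans ?_
    rw [mul_pow, hDD, Real.sq_sqrt (by positivity)]
    refine mul_le_mul_of_nonneg_left (add_le_add (hg y (hsub y hy)) ?_) (sq_nonneg _)
    have hy' : ‖y‖ ≤ 7/8 := by simpa using hy
    have h1 := hess_est1 hn hu he0 he hΛ hD hg (y := y) (by linarith)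
    have h2 : Real.sqrt (hs2 u y) ≤ 136 * n ^ 3 * Λ := by
      nlinarith [Real.sqrt_nonneg (hs2 u y)]
    calc hs2 u y = Real.sqrt (hs2 u y) ^ 2 := (Real.sq_sqrt (hs2_nonneg _ _)).symm
      _ ≤ _ := pow_le_pow_left₀ (Real.sqrt_nonneg _) h2 2
  refine ⟨fun j => ?_, ?_⟩
  · refine abs_le_of_sq_le_sq ?_ (by positivity)
    exact (Finset.single_le_sum (f := fun i => (lap (pd i u) y) ^ 2) (fun _ _ => sq_nonneg _)
      (Finset.mem_univ j)).trans (hsq y hy)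
  · have h1 := lip_of_gr2 (u := lap u) (contDiff_lap hu (by norm_num)) (convex_closedBall (0 : EE n) (7/8))
      (B := ε * D) (by positivity) (fun x hx => by
        refine le_trans (le_of_eq ?_) (hsq x hx)
        unfold gr2
        exact Finset.sum_congr rfl fun i _ => by rw [lap_pd hu]) (mem_closedBall_self (by norm_num)) hy
    have hy' : ‖y - 0‖ ≤ 1 := by rw [sub_zero]; linarith [mem_closedBall_zero_iff.1 hy]
    have h2 : ε * D * ‖y - 0‖ ≤ ε * D := mul_le_of_le_one_right (by positivity) hy'
    have h3 := abs_add_le (lap u y - lap u 0) (lap u 0)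
    rw [sub_add_cancel] at h3
    linarith

lemma limit_harm (hn : 0 < n) {u : ℕ → EE n → ℝ} (hu : ∀ k, ContDiff ℝ 3 (u k)) {Λ : ℝ} (hΛ : 0 ≤ Λ)
    (hD : ∀ k : ℕ, ∀ x ∈ ball (0 : EE n) 1, DI (u k) (1 / ((k : ℝ) + 1)) x)
    (hg : ∀ k, ∀ x ∈ ball (0 : EE n) 1, gr2 (u k) x ≤ Λ ^ 2)
    (h0 : ∀ k : ℕ, |lap (u k) 0| ≤ 1 / ((k : ℝ) + 1)) :
    ∃ g : EE n → ℝ, ContDiff ℝ ((⊤ : ℕ∞) : WithTop ℕ∞) g ∧ (∀ x ∈ ball (0 : EE n) (3/4), lap g x = 0) ∧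
    ∀ e > 0, ∃ k, ∀ x, ‖x‖ ≤ 3/4 → ∀ j, |pd j g x - pd j (u k) x| ≤ e := by
  obtain ⟨φ, hφ, h, hh, hconv⟩ := seq_compact (fun k => (hu k).of_le (by norm_num)) hΛ hg
  obtain ⟨ρ, κ, hρ, hκ, hρ0, hκ0, hev, h1, hpd⟩ := exists_mollifier hn
  obtain ⟨D, hDD⟩ : ∃ D, D = Real.sqrt (Λ ^ 2 + (136 * (n:ℝ) ^ 3 * Λ) ^ 2) := ⟨_, rfl⟩
  have hD0 : 0 ≤ D := hDD ▸ Real.sqrt_nonneg _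
  have hcρ : HasCompactSupport ρ := HasCompactSupport.intro (isCompact_closedBall (0 : EE n) (1/8))
    (fun y hy => hρ0 y (by simpa using hy))
  set I : ℝ := 1 + ∫ y, |κ y| with hI
  have hκI : ∫ y, |κ y| ≤ I := by simp [hI]
  have hI0 : 0 ≤ ∫ y, |κ y| := integral_nonneg fun _ => abs_nonneg _
  set eps : ℕ → ℝ := fun k => 1 / ((φ k : ℝ) + 1) with heps
  have heps0 : ∀ k, 0 ≤ eps k := fun k => by positivity
  have heps1 : ∀ k, eps k ≤ 1 := fun k => by
    rw [heps]; simp only; rw [div_le_one (by positivity)]; linarith [(Nat.cast_nonneg (φ k) : (0:ℝ) ≤ φ k)]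
  have hepst : Tendsto eps atTop (𝓝 0) :=
    tendsto_one_div_add_atTop_nhds_zero_nat.comp hφ.tendsto_atTop
  have hb := fun k (y : EE n) (hy : y ∈ closedBall (0 : EE n) (7/8)) =>
    bounds_aux hn (hu (φ k)) (heps0 k) (heps1 k) hΛ (hD (φ k)) (hg (φ k)) (h0 (φ k)) hDD hy
  set U : ℕ → EE n → ℝ := fun k y => u (φ k) y - u (φ k) 0 with hU
  have hUs : ∀ k, ContDiff ℝ 3 (U k) := fun k => (hu _).sub contDiff_const
  have hUpd : ∀ k j, pd j (U k) = pd j (u (φ k)) := fun k j => by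
    ext x
    rw [hU]; simp only
    rw [pd_sub ((hu _).differentiable (by norm_num) x) (differentiableAt_const _), pd_const, sub_zero]
  have hρ1 : ContDiff ℝ 1 ρ := hρ.of_le (by exact_mod_cast le_top)
  have hpρ : ∀ j, ContDiff ℝ ((⊤ : ℕ∞) : WithTop ℕ∞) (pd j ρ) := fun j => contDiff_pd hρ (by simp) j
  have hpρ1 : ∀ j, ContDiff ℝ 1 (pd j ρ) := fun j => (hpρ j).of_le (by exact_mod_cast le_top)
  have hpρc : ∀ j, HasCompactSupport (pd j ρ) := fun j => pd_hcs hcρ j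
  have hsupp : ∀ (f : EE n → ℝ), (∀ y, 1/8 < ‖y‖ → f y = 0) → ∀ j y, 1/8 < ‖y‖ → pd j f y = 0 := by
    intro f hf j y hy
    have : f =ᶠ[𝓝 y] fun _ => 0 := by
      filter_upwards [(isOpen_lt continuous_const continuous_norm).mem_nhds hy] with z hz using hf z hz
    rw [pd, this.fderiv_eq]; simp
  have hppc : ∀ j, Continuous (pd j (pd j ρ)) := fun j => (contDiff_pd (m := 0) (hpρ1 j) (by norm_num) j).continuous
  have hsubx : ∀ x : EE n, ‖x‖ ≤ 3/4 → ∀ y ∈ closedBall x (1/8), y ∈ closedBall (0 : EE n) (7/8) := by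
    intro x hx y hy
    rw [mem_closedBall_zero_iff]
    rw [mem_closedBall, dist_eq_norm] at hy
    have := norm_sub_norm_le y x
    linarith
  refine ⟨cv h ρ, cv_contDiff hh hρ hcρ, ?_, ?_⟩
  · intro x hx
    have hx' : ‖x‖ ≤ 3/4 := by simp at hx; linarith
    set P : ℝ := ∑ j : Fin n, (∫ y, |pd j (pd j ρ) y|) + (1 + D) * ∫ y, |ρ y| with hP
    have hP0 : 0 ≤ P := add_nonneg (Finset.sum_nonneg fun j _ => integral_nonneg fun _ => abs_nonneg _)
      (mul_nonneg (by positivity) (integral_nonneg fun _ => abs_nonneg _))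
    have hest : ∀ e > 0, |lap (cv h ρ) x| ≤ e * P := by
      intro e he
      obtain ⟨k, hk1, hk2⟩ := ((hconv _ he).and (hepst.eventually (gt_mem_nhds he))).exists
      have hlap : lap (cv h ρ) x = ∑ j, cv h (pd j (pd j ρ)) x := by
        unfold lap
        refine Finset.sum_congr rfl fun j _ => ?_
        rw [cv_pd hh hρ1 hcρ, cv_pd hh (hpρ1 j) (hpρc j)]
      have hlapU : cv (lap (u (φ k))) ρ x = ∑ j, cv (U k) (pd j (pd j ρ)) x := by
        have : ∀ j, cv (U k) (pd j (pd j ρ)) x = cv (pd j (pd j (u (φ k)))) ρ x := fun j => by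
          rw [cv_pd_left ((hUs k).of_le (by norm_num)) (hpρ1 j) (hpρc j), hUpd,
            cv_pd_left ((u_c1 (hu (φ k)) j).of_le (by norm_num)) hρ1 hcρ]
        simp_rw [this]
        unfold cv lap
        rw [← integral_finsetSum]
        · simp_rw [Finset.sum_mul]
        · intro j _
          exact cv_int (u_c2 (hu (φ k)) j j).continuous hρ.continuous hcρ x
      have e1 : ∀ j, |cv h (pd j (pd j ρ)) x - cv (U k) (pd j (pd j ρ)) x| ≤ e * ∫ y, |pd j (pd j ρ) y| :=
        fun j => cv_diff hh (hUs k).continuous (hppc j) (hsupp _ (hsupp ρ hρ0 j) j)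
          (fun y hy => by rw [abs_sub_comm]; exact hk1 y hy) hx'
      have hlc : Continuous (lap (u (φ k))) := (contDiff_lap (m := 1) (hu (φ k)) (by norm_num)).continuous
      have e2 := cv_diff (F' := fun _ => 0) hlc continuous_const hρ.continuous hρ0
        (fun y hy => by
          rw [sub_zero]
          exact ((hb k y hy).2).trans (mul_le_mul_of_nonneg_right hk2.le (by positivity))) hx'
      have e3 : cv (fun _ => 0) ρ x = 0 := by simp [cv]
      rw [e3, sub_zero] at e2
      have e4 : lap (cv h ρ) x = ∑ j, (cv h (pd j (pd j ρ)) x - cv (U k) (pd j (pd j ρ)) x)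
          + cv (lap (u (φ k))) ρ x := by
        rw [hlap, hlapU, Finset.sum_sub_distrib]; ring
      rw [e4, hP, mul_add, Finset.mul_sum]
      refine (abs_add_le _ _).trans (add_le_add ((Finset.abs_sum_le_sum_abs _ _).trans
        (Finset.sum_le_sum fun j _ => e1 j)) (e2.trans (le_of_eq (by ring))))
    by_contra hne
    have hpos : 0 < |lap (cv h ρ) x| := abs_pos.2 hne
    have h2 := hest (|lap (cv h ρ) x| / (2 * (P + 1))) (by positivity)
    have h3 : |lap (cv h ρ) x| / (2 * (P + 1)) * P < |lap (cv h ρ) x| := by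
      rw [div_mul_eq_mul_div, div_lt_iff₀ (by positivity)]
      nlinarith
    linarith
  · intro e he
    set Q : ℝ := ∑ j : Fin n, ∫ y, |pd j ρ y| with hQ
    have hQ0 : ∀ j : Fin n, 0 ≤ ∫ y, |pd j ρ y| := fun j => integral_nonneg fun _ => abs_nonneg _
    have hQQ : 0 ≤ Q := Finset.sum_nonneg fun j _ => hQ0 j
    have hη : 0 < e / (2 * (Q + 1)) := by positivity
    have ht : Tendsto (fun k => eps k * D * ∫ y, |κ y|) atTop (𝓝 0) := by
      simpa using (hepst.mul_const D).mul_const (∫ y, |κ y|)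
    obtain ⟨k, hk1, hk2⟩ := ((hconv _ hη).and (ht.eventually (gt_mem_nhds (half_pos he)))).exists
    refine ⟨φ k, fun x hx j => ?_⟩
    have e1 := cv_diff (κ := pd j ρ) hh (hUs k).continuous (hpρ j).continuous (hsupp ρ hρ0 j)
      (fun y hy => by rw [abs_sub_comm]; exact hk1 y hy) hx
    have e2 := mean_est hρ hκ hρ0 hκ0 hev h1 hpd (u_c1 (hu (φ k)) j) x
      (fun y hy => (hb k y (hsubx x hx y hy)).1 j)
    rw [cv_pd hh hρ1 hcρ]
    rw [cv_pd_left ((hUs k).of_le (by norm_num)) hρ1 hcρ, hUpd] at e1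
    have e3 : e / (2 * (Q + 1)) * ∫ y, |pd j ρ y| ≤ e / 2 := by
      have : ∫ y, |pd j ρ y| ≤ Q + 1 :=
        (Finset.single_le_sum (fun j _ => hQ0 j) (Finset.mem_univ j)).trans (by simp [hQ])
      calc _ ≤ e / (2 * (Q + 1)) * (Q + 1) := by gcongr
        _ = e / 2 := by field_simp
    have := abs_sub_le (cv h (pd j ρ) x) (cv (pd j (u (φ k))) ρ x) (pd j (u (φ k)) x)
    linarith

/-- Case B: small Laplacian at the centre. -/
theorem caseB (hn : 0 < n) {Λ : ℝ} (hΛ : 0 < Λ) : ∃ ε > 0, ε ≤ 1 ∧ ∀ u : EE n → ℝ, ContDiff ℝ 3 u →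
    (∀ x ∈ ball (0 : EE n) 1, DI u ε x) → (∀ x ∈ ball (0 : EE n) 1, gr2 u x ≤ Λ ^ 2) →
    (∃ x ∈ closedBall (0 : EE n) (1/8), 1 ≤ gr2 u x) → |lap u 0| ≤ ε →
    Cov ({x | gr2 u x = 0} ∩ closedBall (0 : EE n) (1/8)) (1/32) ((1/16) ^ (n - 1)) := by
  by_contra hcon
  push Not at hcon
  have hk := fun k : ℕ => hcon (1 / ((k : ℝ) + 1)) (by positivity) (by
    rw [div_le_one (by positivity)]; linarith [(Nat.cast_nonneg k : (0:ℝ) ≤ k)])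
  choose u hu hD hg hx h0 hC using hk
  obtain ⟨g, hgs, hgl, hga⟩ := limit_harm hn hu hΛ.le hD hg h0
  have hn' : (0:ℝ) < n := by exact_mod_cast hn
  have hcl : ∀ x ∈ closedBall (0 : EE n) (1/8), ‖x‖ ≤ 3/4 := fun x hx => by
    simp at hx; linarith
  have hgc : Continuous (gr2 g) := by
    unfold gr2
    exact continuous_finset_sum _ fun i _ => ((contDiff_pd (m := 0) hgs (by simp) i).continuous).pow 2
  -- nontrivial gradient
  have hnz : ∃ x ∈ closedBall (0 : EE n) (1/8), gr2 g x ≠ 0 := by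
    obtain ⟨k, hk⟩ := hga (1 / (2 * n)) (by positivity)
    obtain ⟨x, hxb, hx1⟩ := hx k
    refine ⟨x, hxb, fun h => ?_⟩
    have hz : ∀ j, pd j g x = 0 := fun j => by
      have := pd_sq_le_gr2 g x j
      rw [h] at this
      exact pow_eq_zero_iff (two_ne_zero) |>.1 (le_antisymm this (sq_nonneg _))
    have : gr2 (u k) x ≤ ∑ j : Fin n, (1 / (2 * (n:ℝ))) ^ 2 := by
      refine Finset.sum_le_sum fun j _ => ?_
      have := hk x (hcl x hxb) j
      rw [hz j, zero_sub, abs_neg] at this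
      exact sq_le_sq' (abs_le.1 this).1 (abs_le.1 this).2
    rw [Finset.sum_const, Finset.card_univ, Fintype.card_fin, nsmul_eq_mul] at this
    have h4 : (n:ℝ) * (1 / (2 * (n:ℝ))) ^ 2 = 1 / (4 * n) := by field_simp; norm_num
    have h5 : 1 / (4 * (n:ℝ)) < 1 := by
      rw [div_lt_one (by positivity)]
      have : (1:ℝ) ≤ n := by exact_mod_cast hn
      linarith
    linarith
  obtain ⟨x0, hx0, hgx0⟩ := hnz
  have hnull := harm_null hgs hgl hx0 hgx0
  have hZ : IsCompact ({y | gr2 g y = 0} ∩ closedBall (0 : EE n) (1/8)) :=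
    (isCompact_closedBall _ _).inter_left (isClosed_eq hgc continuous_const)
  obtain ⟨t, ht1, ht2, ht3⟩ := null_cover hn hZ hnull (δ := 1/32) (η := (1/16) ^ (n-1)) (by norm_num) (by positivity)
  set O : Set (EE n) := ⋃ p ∈ t, ball p.1 p.2 with hO
  have hOo : IsOpen O := isOpen_biUnion fun p _ => isOpen_ball
  have hW : IsCompact (closedBall (0 : EE n) (1/8) \ O) := (isCompact_closedBall _ _).diff hOo
  have hc : ∃ c > 0, ∀ x ∈ closedBall (0 : EE n) (1/8) \ O, c ≤ gr2 g x := by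
    rcases (closedBall (0 : EE n) (1/8) \ O).eq_empty_or_nonempty with he | hne
    · exact ⟨1, one_pos, by rw [he]; simp⟩
    · obtain ⟨y, hy, hmin⟩ := hW.exists_isMinOn hne hgc.continuousOn
      refine ⟨gr2 g y, lt_of_le_of_ne (gr2_nonneg _ _) (fun h => ?_), fun x hx => hmin hx⟩
      exact hy.2 (ht1 ⟨h.symm, hy.1⟩)
  obtain ⟨c, hc0, hc⟩ := hc
  obtain ⟨k, hk⟩ := hga (Real.sqrt (c / (2 * n))) (by positivity)
  refine hC k ⟨t, ?_, ht2, ht3⟩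
  rintro x ⟨hx1, hx2⟩
  have hxO : x ∈ O := by
    by_contra hxO
    have h1 := hc x ⟨hx2, hxO⟩
    have hz : ∀ j, pd j (u k) x = 0 := fun j => by
      have := pd_sq_le_gr2 (u k) x j
      rw [show gr2 (u k) x = 0 from hx1] at this
      exact pow_eq_zero_iff (two_ne_zero) |>.1 (le_antisymm this (sq_nonneg _))
    have : gr2 g x ≤ ∑ j : Fin n, (Real.sqrt (c / (2 * n))) ^ 2 := by
      refine Finset.sum_le_sum fun j _ => ?_
      have := hk x (hcl x hx2) j
      rw [hz j, sub_zero] at this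
      exact sq_le_sq' (abs_le.1 this).1 (abs_le.1 this).2
    rw [Finset.sum_const, Finset.card_univ, Fintype.card_fin, nsmul_eq_mul,
      Real.sq_sqrt (by positivity)] at this
    have h4 : (n:ℝ) * (c / (2 * (n:ℝ))) = c / 2 := by field_simp
    linarith
  simp only [hO, mem_iUnion] at hxO ⊢
  obtain ⟨p, hp, hxp⟩ := hxO
  exact ⟨p, hp, ball_subset_closedBall hxp⟩


lemma Cov.mono {S T : Set (EE n)} {δ M N : ℝ} (h : Cov T δ M) (hS : S ⊆ T) (hM : M ≤ N) : Cov S δ N := by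
  obtain ⟨t, h1, h2, h3⟩ := h
  exact ⟨t, hS.trans h1, h2, h3.trans hM⟩

lemma Cov.union {S T : Set (EE n)} {δ M N : ℝ} (h : Cov S δ M) (h' : Cov T δ N) :
    Cov (S ∪ T) δ (M + N) := by
  classical
  obtain ⟨t, h1, h2, h3⟩ := h
  obtain ⟨t', h1', h2', h3'⟩ := h'
  refine ⟨t ∪ t', ?_, ?_, ?_⟩
  · rw [Finset.set_biUnion_union]
    exact union_subset_union h1 h1'
  · intro p hp
    rcases Finset.mem_union.1 hp with h | h
    exacts [h2 p h, h2' p h]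
  · have := Finset.sum_union_inter (s₁ := t) (s₂ := t') (f := fun p : EE n × ℝ => p.2 ^ (n - 1))
    have h4 : 0 ≤ ∑ p ∈ t ∩ t', p.2 ^ (n - 1) := Finset.sum_nonneg fun p hp =>
      pow_nonneg (h2 p (Finset.mem_inter.1 hp).1).1.le _
    linarith

lemma Cov.empty {δ : ℝ} : Cov (∅ : Set (EE n)) δ 0 := ⟨∅, by simp, by simp, by simp⟩

lemma Cov.biUnion {ι : Type*} (t : Finset ι) (T : ι → Set (EE n)) {δ : ℝ} (M : ι → ℝ)
    (h : ∀ i ∈ t, Cov (T i) δ (M i)) : Cov (⋃ i ∈ t, T i) δ (∑ i ∈ t, M i) := by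
  classical
  induction t using Finset.induction_on with
  | empty => simpa using Cov.empty
  | insert a s ha ih =>
    rw [Finset.set_biUnion_insert, Finset.sum_insert ha]
    exact (h a (by simp)).union (ih fun i hi => h i (by simp [hi]))

lemma Cov.rescale {S T : Set (EE n)} {δ M s : ℝ} (q : EE n) (hs : 0 < s) (h : Cov T δ M)
    (hS : ∀ x ∈ S, s⁻¹ • (x - q) ∈ T) : Cov S (s * δ) (s ^ (n - 1) * M) := by
  classical
  obtain ⟨t, h1, h2, h3⟩ := h
  refine ⟨t.image (fun p => (q + s • p.1, s * p.2)), ?_, ?_, ?_⟩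
  · intro x hx
    have := h1 (hS x hx)
    simp only [mem_iUnion] at this ⊢
    obtain ⟨p, hp, hxp⟩ := this
    refine ⟨_, Finset.mem_image_of_mem _ hp, ?_⟩
    rw [mem_closedBall, dist_eq_norm] at hxp ⊢
    have e : x - (q + s • p.1) = s • (s⁻¹ • (x - q) - p.1) := by
      rw [smul_sub, smul_smul, mul_inv_cancel₀ hs.ne', one_smul]; abel
    simp only
    rw [e, norm_smul, Real.norm_eq_abs, abs_of_pos hs]
    exact mul_le_mul_of_nonneg_left hxp hs.le
  · intro p hp
    obtain ⟨p', hp', rfl⟩ := Finset.mem_image.1 hp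
    exact ⟨mul_pos hs (h2 p' hp').1, mul_le_mul_of_nonneg_left (h2 p' hp').2 hs.le⟩
  · refine (sum_image_le' t _ (fun p => p.2 ^ (n - 1)) ?_).trans ?_
    · intro p hp
      exact pow_nonneg (mul_pos hs (h2 p hp).1).le _
    · simp only [mul_pow]
      rw [← Finset.mul_sum]
      exact mul_le_mul_of_nonneg_left h3 (by positivity)

lemma Cov.hausdorff (hn : 0 < n) {S : Set (EE n)} {M : ℝ} (h : ∀ δ > 0, Cov S δ M) :
    μH[(n : ℝ) - 1] S < ⊤ := by
  have hd : (n : ℝ) - 1 = ((n - 1 : ℕ) : ℝ) := by rw [Nat.cast_sub hn]; simp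
  have h' := fun k : ℕ => h (1 / ((k:ℝ) + 1)) (by positivity)
  choose t h1 h2 h3 using h'
  have hr : Tendsto (fun k : ℕ => ENNReal.ofReal (2 * (1 / ((k:ℝ) + 1)))) atTop (𝓝 0) := by
    have := (tendsto_one_div_add_atTop_nhds_zero_nat (𝕜 := ℝ)).const_mul 2
    rw [mul_zero] at this
    simpa using ENNReal.tendsto_ofReal this
  have hdiam : ∀ k, ∀ p : t k, ediam (closedBall (p : EE n × ℝ).1 (p : EE n × ℝ).2) ≤
      ENNReal.ofReal (2 * (p : EE n × ℝ).2) := by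
    intro k p
    rw [← Metric.closedEBall_ofReal (h2 k p p.2).1.le, ENNReal.ofReal_mul (by norm_num)]
    simpa using ediam_closedEBall_le (x := (p : EE n × ℝ).1) (r := ENNReal.ofReal (p : EE n × ℝ).2)
  have key := Measure.hausdorffMeasure_le_liminf_sum ((n:ℝ) - 1) S (l := atTop) (ι := fun k => t k) _ hr
    (fun k p => closedBall (p : EE n × ℝ).1 (p : EE n × ℝ).2) (Eventually.of_forall fun k p => ?_)
    (Eventually.of_forall fun k => ?_)
  · refine key.trans_lt (lt_of_le_of_lt ?_ (ENNReal.ofReal_lt_top (r := 2 ^ (n - 1) * M)))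
    refine (liminf_le_liminf (v := fun _ => ENNReal.ofReal (2 ^ (n - 1) * M)) (Eventually.of_forall fun k => ?_)).trans ?_
    · refine (Finset.sum_le_sum (g := fun p : t k => ENNReal.ofReal ((2 * (p : EE n × ℝ).2) ^ (n - 1))) fun p _ => ?_).trans ?_
      · rw [hd, ENNReal.rpow_natCast, ENNReal.ofReal_pow (by linarith [(h2 k p p.2).1])]
        exact pow_le_pow_left' (hdiam k p) _
      · rw [← ENNReal.ofReal_sum_of_nonneg (fun p _ => pow_nonneg (by linarith [(h2 k p p.2).1]) _)]
        apply ENNReal.ofReal_le_ofReal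
        rw [Finset.sum_coe_sort (t k) (fun p : EE n × ℝ => (2 * p.2) ^ (n - 1))]
        simp only [mul_pow]
        rw [← Finset.mul_sum]
        exact mul_le_mul_of_nonneg_left (h3 k) (by positivity)
    · simp
  · exact (hdiam k p).trans (ENNReal.ofReal_le_ofReal (by linarith [(h2 k p p.2).2]))
  · refine (h1 k).trans ?_
    intro x hx
    simp only [mem_iUnion] at hx ⊢
    obtain ⟨p, hp, hxp⟩ := hx
    exact ⟨⟨p, hp⟩, hxp⟩

/-- translate of a function -/
def tr (u : EE n → ℝ) (q : EE n) : EE n → ℝ := fun y => 1 * u (q + (1 : ℝ) • y)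

lemma tr_contDiff {u : EE n → ℝ} {k : WithTop ℕ∞} (hu : ContDiff ℝ k u) (q : EE n) : ContDiff ℝ k (tr u q) :=
  contDiff_rescale hu 1 1 q

lemma gr2_tr {u : EE n → ℝ} (hu : ContDiff ℝ 1 u) (q x : EE n) : gr2 (tr u q) x = gr2 u (q + x) := by
  show gr2 (fun y => 1 * u (q + (1 : ℝ) • y)) x = _
  rw [gr2_rescale hu]; simp

lemma hs2_tr {u : EE n → ℝ} (hu : ContDiff ℝ 2 u) (q x : EE n) : hs2 (tr u q) x = hs2 u (q + x) := by
  show hs2 (fun y => 1 * u (q + (1 : ℝ) • y)) x = _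
  rw [hs2_rescale hu]; simp

lemma DI_tr {u : EE n → ℝ} (hu : ContDiff ℝ 3 u) {K : ℝ} {q x : EE n} (h : DI u K (q + x)) :
    DI (tr u q) K x := by
  have : DI (tr u q) (K * 1) x := DI_rescale hu (K := K) 1 1 (by simp) q x (by simpa using h)
  rwa [mul_one] at this

lemma DI_mono {u : EE n → ℝ} {K L : ℝ} (hK : 0 ≤ K) (hKL : K ≤ L) {x : EE n} (h : DI u K x) : DI u L x := by
  unfold DI at *
  refine h.trans (mul_le_mul_of_nonneg_right (pow_le_pow_left₀ hK hKL 2) ?_)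
  exact add_nonneg (gr2_nonneg _ _) (hs2_nonneg _ _)

lemma step (hn : 0 < n) {K R Γ : ℝ} (hK : 0 ≤ K) (hR0 : 0 < R) (hR : R ≤ 1) (hKR : K * R ≤ 1) :
    ∃ t0 > 0, ∃ C1 > 0, ∀ u : EE n → ℝ, ContDiff ℝ 3 u → ∀ q : EE n,
      (∀ x ∈ ball q R, DI u K x) → 0 < Hf (tr u q) R → Gam (tr u q) R ≤ Γ → ∀ t, 0 < t → t ≤ t0 →
      (∀ δ > 0, Cov ({x | gr2 u x = 0} ∩ closedBall q t) δ (C1 * t ^ (n - 1))) ∨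
      Cov ({x | gr2 u x = 0} ∩ closedBall q t) (t / 4) ((t / 2) ^ (n - 1)) := by
  obtain ⟨C, hC0, hC⟩ := sup_dbl hn
  set Λ : ℝ := Real.sqrt (C * 32 ^ Γ) with hΛ
  have hCG : 0 < C * (32:ℝ) ^ Γ := by positivity
  have hΛ0 : 0 < Λ := Real.sqrt_pos.2 hCG
  obtain ⟨εB, hεB0, hεB1, hB⟩ := caseB hn hΛ0
  obtain ⟨εA, hεA0, hεA1, CA, hCA0, hA⟩ := caseA hn hΛ0 hεB0
  set ε := min εA εB with hε
  have hε0 : 0 < ε := lt_min hεA0 hεB0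
  refine ⟨min (R / 32) (ε / (8 * (K + 1))), by positivity, CA * 8 ^ (n - 1), by positivity, ?_⟩
  intro u hu q hD hH hG t ht0 ht
  obtain ⟨s, hs⟩ : ∃ s, s = 8 * t := ⟨_, rfl⟩
  have hs0 : 0 < s := by linarith
  have hsR : 4 * s ≤ R := by have := ht.trans (min_le_left _ _); linarith
  have hKs : K * s ≤ ε := by
    have := ht.trans (min_le_right _ _)
    rw [le_div_iff₀ (by positivity)] at this
    nlinarith
  have hu1 : ContDiff ℝ 1 u := hu.of_le (by norm_num)
  obtain ⟨x, hx, hx0, hxm⟩ := hC (tr u q) (tr_contDiff hu q) K R Γ hK hR hKR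
    (fun x hx => DI_tr hu (hD _ (by simpa using hx))) hH hG s hs0 hsR
  rw [gr2_tr hu1] at hx0 hxm
  set A := Real.sqrt (gr2 u (q + x)) with hAdef
  have hA0 : 0 < A := Real.sqrt_pos.2 hx0
  have hA2 : A ^ 2 = gr2 u (q + x) := Real.sq_sqrt hx0.le
  set w : EE n → ℝ := fun y => (1 / (s * A)) * u (q + s • y) with hw
  have hws : ContDiff ℝ 3 w := contDiff_rescale hu _ _ _
  have hgw : ∀ y, gr2 w y = gr2 u (q + s • y) / A ^ 2 := by
    intro y
    rw [hw, gr2_rescale hu1]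
    field_simp
  have hDw : ∀ y ∈ ball (0 : EE n) 1, DI w ε y := by
    intro y hy
    refine DI_mono (by positivity) hKs (DI_rescale hu _ s (by rw [abs_of_pos hs0]; linarith) q y (hD _ ?_))
    rw [mem_ball, dist_self_add_left, norm_smul, Real.norm_eq_abs, abs_of_pos hs0]
    have : ‖y‖ < 1 := by simpa using hy
    nlinarith
  have hgl : ∀ y ∈ ball (0 : EE n) 1, gr2 w y ≤ Λ ^ 2 := by
    intro y hy
    have h1 := hxm (s • y) (by
      rw [mem_closedBall_zero_iff, norm_smul, Real.norm_eq_abs, abs_of_pos hs0]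
      have : ‖y‖ < 1 := by simpa using hy
      nlinarith)
    rw [gr2_tr hu1, ← hA2] at h1
    rw [hgw, hΛ, Real.sq_sqrt hCG.le, div_le_iff₀ (by positivity)]
    exact h1
  have hsc : ∀ z ∈ {x | gr2 u x = 0} ∩ closedBall q t,
      s⁻¹ • (z - q) ∈ {x | gr2 w x = 0} ∩ closedBall (0 : EE n) (1/8) := by
    rintro z ⟨hz1, hz2⟩
    refine ⟨?_, ?_⟩
    · show gr2 w _ = 0
      rw [hgw, smul_smul, mul_inv_cancel₀ hs0.ne', one_smul, add_sub_cancel, show gr2 u z = 0 from hz1, zero_div]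
    · rw [mem_closedBall_zero_iff, norm_smul, norm_inv, Real.norm_eq_abs, abs_of_pos hs0,
        inv_mul_le_iff₀ hs0]
      rw [mem_closedBall, dist_eq_norm] at hz2
      linarith
  rcases le_total εB |lap w 0| with hl | hl
  · left
    intro δ hδ
    have h1 := hA w hws (fun y hy => DI_mono hε0.le (min_le_left _ _) (hDw y hy)) hgl hl (δ / s) (by positivity)
    have h2 := h1.rescale q hs0 hsc
    rw [mul_div_cancel₀ _ hs0.ne'] at h2
    refine h2.mono subset_rfl (le_of_eq ?_)
    rw [hs, mul_pow]; ring
  · right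
    have h1 := hB w hws (fun y hy => DI_mono hε0.le (min_le_right _ _) (hDw y hy)) hgl
      ⟨s⁻¹ • x, ?_, ?_⟩ hl
    · have h2 := h1.rescale q hs0 hsc
      rw [show s * (1/32) = t / 4 by rw [hs]; ring] at h2
      refine h2.mono subset_rfl (le_of_eq ?_)
      rw [← mul_pow, hs]; congr 1; ring
    · rw [mem_closedBall_zero_iff, norm_smul, norm_inv, Real.norm_eq_abs, abs_of_pos hs0,
        inv_mul_le_iff₀ hs0]
      have := mem_closedBall_zero_iff.1 hx
      linarith
    · rw [hgw, smul_smul, mul_inv_cancel₀ hs0.ne', one_smul, hA2, div_self hx0.ne']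

lemma scales {Z Q : Set (EE n)} {t0 C1 : ℝ} (hC1 : 0 < C1)
    (hst : ∀ q ∈ Q, ∀ t, 0 < t → t ≤ t0 → (∀ δ > 0, Cov (Z ∩ closedBall q t) δ (C1 * t ^ (n - 1))) ∨
      Cov (Z ∩ closedBall q t) (t / 4) ((t / 2) ^ (n - 1))) (k : ℕ) {δ : ℝ} (hδ : 0 < δ) :
    ∀ q ∈ Q, ∀ t, 0 < t → t ≤ t0 → t ≤ 2 ^ k * δ →
      Cov (Z ∩ Q ∩ closedBall q t) δ (max C1 1 * t ^ (n - 1)) := by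
  induction k with
  | zero =>
    intro q _ t ht _ htδ
    refine ⟨{(q, t)}, ?_, ?_, ?_⟩
    · simp
    · simp only [Finset.mem_singleton, forall_eq]
      exact ⟨ht, by simpa using htδ⟩
    · simp only [Finset.sum_singleton]
      exact le_mul_of_one_le_left (by positivity) (le_max_right _ _)
  | succ k ih =>
    intro q hq t ht ht0 htδ
    rcases hst q hq t ht ht0 with h | h
    · exact (h δ hδ).mono (by intro x hx; exact ⟨hx.1.1, hx.2⟩)
        (mul_le_mul_of_nonneg_right (le_max_left _ _) (by positivity))
    · obtain ⟨T, h1, h2, h3⟩ := h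
      have hc : ∀ p ∈ T, Cov (Z ∩ Q ∩ closedBall q t ∩ closedBall p.1 p.2) δ
          (max C1 1 * (2 * p.2) ^ (n - 1)) := by
        intro p hp
        obtain ⟨hp0, hp4⟩ := h2 p hp
        rcases (Z ∩ Q ∩ closedBall q t ∩ closedBall p.1 p.2).eq_empty_or_nonempty with he | ⟨y, hy⟩
        · rw [he]
          exact Cov.empty.mono subset_rfl (by positivity)
        · refine (ih y hy.1.1.2 (2 * p.2) (by linarith) (by linarith) ?_).mono ?_ le_rfl
          · rw [pow_succ] at htδ; linarith
          · intro z hz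
            refine ⟨hz.1.1, ?_⟩
            have a1 := mem_closedBall.1 hz.2
            have a2 := mem_closedBall'.1 hy.2
            rw [mem_closedBall]
            linarith [dist_triangle z p.1 y]
      have := Cov.biUnion T _ _ hc
      refine this.mono ?_ ?_
      · intro x hx
        have := h1 ⟨hx.1.1, hx.2⟩
        simp only [mem_iUnion] at this ⊢
        obtain ⟨p, hp, hxp⟩ := this
        exact ⟨p, hp, hx, hxp⟩
      · rw [← Finset.mul_sum]
        refine mul_le_mul_of_nonneg_left ?_ (by positivity)
        simp only [mul_pow]
        rw [← Finset.mul_sum]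
        refine (mul_le_mul_of_nonneg_left h3 (by positivity)).trans (le_of_eq ?_)
        rw [← mul_pow]; congr 1; ring

theorem local_fin (hn : 0 < n) {u : EE n → ℝ} (hu : ContDiff ℝ 3 u) {K R Γ : ℝ} (hK : 0 ≤ K) (hR0 : 0 < R)
    (hR : R ≤ 1) (hKR : K * R ≤ 1) {Q : Set (EE n)} (hD : ∀ q ∈ Q, ∀ x ∈ ball q R, DI u K x)
    (hH : ∀ q ∈ Q, 0 < Hf (tr u q) R) (hG : ∀ q ∈ Q, Gam (tr u q) R ≤ Γ) :
    ∃ t0 > 0, ∀ q ∈ Q, μH[(n : ℝ) - 1] ({x | gr2 u x = 0} ∩ Q ∩ closedBall q t0) < ⊤ := by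
  obtain ⟨t0, ht0, C1, hC1, h⟩ := step hn (Γ := Γ) hK hR0 hR hKR
  refine ⟨t0, ht0, fun q hq => Cov.hausdorff hn (M := max C1 1 * t0 ^ (n - 1)) fun δ hδ => ?_⟩
  obtain ⟨k, hk⟩ := pow_unbounded_of_one_lt (t0 / δ) (one_lt_two (α := ℝ))
  rw [div_lt_iff₀ hδ] at hk
  exact scales hC1 (fun q hq t ht htt => h u hu q (hD q hq) (hH q hq) (hG q hq) t ht htt) k hδ q hq t0 ht0 le_rfl hk.le


lemma J_tr_continuous {m : ℕ} (hm : m ≠ 0) (r : ℝ) {F : EE n → ℝ} (hF : Continuous F) :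
    Continuous (fun q : EE n => J m r (fun x => F (q + x))) := by
  have h : (fun q : EE n => J m r (fun x => F (q + x))) = cv F (fun x => wt r x ^ m) := by
    ext q
    unfold J cv
    rw [← integral_add_left_eq_self (fun t => F t * wt r (q - t) ^ m) q]
    refine integral_congr_ae (ae_of_all _ fun x => ?_)
    simp [wt]
  rw [h, cv_eq]
  exact (hasCompactSupport_wt r m hm).continuous_convolution_right _ hF.locallyIntegrable
    ((continuous_wt r).pow m)

lemma vd_tr {u : EE n → ℝ} (hu : ContDiff ℝ 3 u) (q x : EE n) : vd (tr u q) x = vd u (q + x) := by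
  unfold vd
  refine Finset.sum_congr rfl fun i _ => ?_
  have h1 : pd i (tr u q) = fun y => (1 * 1) * pd i u (q + (1:ℝ) • y) :=
    pd_rescale_fun (hu.of_le (by norm_num)) 1 1 q i
  rw [h1, lap_rescale (u_c1 hu i)]
  simp

lemma Hf_tr_cont {u : EE n → ℝ} (hu : ContDiff ℝ 3 u) (R : ℝ) : Continuous (fun q => Hf (tr u q) R) := by
  have : (fun q => Hf (tr u q) R) = fun q => J 2 R (fun x => gr2 u (q + x)) := by
    ext q; unfold Hf; congr 1; ext x; exact gr2_tr (hu.of_le (by norm_num)) q x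
  rw [this]; exact J_tr_continuous two_ne_zero R (cont_gr2 hu)

lemma If_tr_cont {u : EE n → ℝ} (hu : ContDiff ℝ 3 u) (R : ℝ) : Continuous (fun q => If (tr u q) R) := by
  have : (fun q => If (tr u q) R) = fun q => J 3 R (fun x => hs2 u (q + x)) + J 3 R (fun x => vd u (q + x)) := by
    ext q; unfold If; congr 2
    · ext x; exact hs2_tr (hu.of_le (by norm_num)) q x
    · ext x; exact vd_tr hu q x
  rw [this]
  exact (J_tr_continuous three_ne_zero R (cont_hs2 hu)).add (J_tr_continuous three_ne_zero R (cont_vd hu))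

lemma loc_data {u : EE n → ℝ} (hu : ContDiff ℝ 3 u) {K ρ : ℝ} (hK : 0 ≤ K) (hρ : 0 < ρ) {p : EE n}
    (hD : ∀ x ∈ ball p ρ, DI u K x) (hp : p ∈ closure {x | gr2 u x ≠ 0}) :
    ∃ R > 0, R ≤ 1 ∧ K * R ≤ 1 ∧ ∃ r > 0, ∃ Γ : ℝ, (∀ q ∈ closedBall p r, ∀ x ∈ ball q R, DI u K x) ∧
      (∀ q ∈ closedBall p r, 0 < Hf (tr u q) R) ∧ (∀ q ∈ closedBall p r, Gam (tr u q) R ≤ Γ) := by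
  obtain ⟨R, hRd⟩ : ∃ R, R = min (min 1 (1 / (K + 1))) (ρ / 2) := ⟨_, rfl⟩
  have hR0 : 0 < R := by rw [hRd]; positivity
  have hR1 : R ≤ 1 := by rw [hRd]; exact (min_le_left _ _).trans (min_le_left _ _)
  have hR2 : R ≤ 1 / (K + 1) := by rw [hRd]; exact (min_le_left _ _).trans (min_le_right _ _)
  have hR3 : R ≤ ρ / 2 := by rw [hRd]; exact min_le_right _ _
  obtain ⟨x0, hx0, hx0d⟩ := Metric.mem_closure_iff.1 hp (R / 4) (by positivity)
  have hH : ∀ q ∈ closedBall p (R / 4), 0 < Hf (tr u q) R := by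
    intro q hq
    refine Hf_pos (tr_contDiff hu q) (x := x0 - q) ?_ ?_
    · rw [mem_closedBall] at hq
      rw [← dist_eq_norm]
      have := dist_triangle x0 p q
      rw [dist_comm x0 p, dist_comm p q] at this
      linarith
    · rw [gr2_tr (hu.of_le (by norm_num)), add_sub_cancel]; exact hx0
  have hc : ContinuousOn (fun q => If (tr u q) R / Hf (tr u q) R) (closedBall p (R/4)) :=
    (If_tr_cont hu R).continuousOn.div (Hf_tr_cont hu R).continuousOn (fun q hq => (hH q hq).ne')
  obtain ⟨B, hB⟩ := (isCompact_closedBall p (R/4)).exists_bound_of_continuousOn hc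
  refine ⟨R, hR0, hR1, ?_, R / 4, by positivity,
    (4 + n) + Real.exp (33 + 3 * n) * (B + (8 + n) / 4), ?_, hH, ?_⟩
  · rw [le_div_iff₀ (by positivity)] at hR2; nlinarith
  · intro q hq x hx
    refine hD x ?_
    rw [mem_ball] at hx ⊢
    rw [mem_closedBall] at hq
    linarith [dist_triangle x q p]
  · intro q hq
    unfold Gam
    have := (le_abs_self _).trans (hB q hq)
    gcongr

lemma loc_fin (hn : 0 < n) {u : EE n → ℝ} (hu : ContDiff ℝ 3 u) {K ρ : ℝ} (hK : 0 ≤ K) (hρ : 0 < ρ) {p : EE n}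
    (hD : ∀ x ∈ ball p ρ, DI u K x) (hp : p ∈ closure {x | gr2 u x ≠ 0}) :
    ∃ r > 0, μH[(n : ℝ) - 1] ({x | gr2 u x = 0} ∩ closedBall p r) < ⊤ := by
  obtain ⟨R, hR0, hR1, hKR, r, hr, Γ, h1, h2, h3⟩ := loc_data hu hK hρ hD hp
  obtain ⟨t0, ht0, h⟩ := local_fin hn hu hK hR0 hR1 hKR h1 h2 h3
  refine ⟨min r t0, lt_min hr ht0, lt_of_le_of_lt (measure_mono ?_) (h p (mem_closedBall_self hr.le))⟩
  rintro x ⟨hx1, hx2⟩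
  exact ⟨⟨hx1, closedBall_subset_closedBall (min_le_left _ _) hx2⟩,
    closedBall_subset_closedBall (min_le_right _ _) hx2⟩

lemma loc_uc {u : EE n → ℝ} (hu : ContDiff ℝ 3 u) {K ρ : ℝ} (hK : 0 ≤ K) (hρ : 0 < ρ) {p : EE n}
    (hD : ∀ x ∈ ball p ρ, DI u K x) (hp : p ∈ closure {x | gr2 u x ≠ 0}) :
    ∃ r > 0, ∀ q ∈ closedBall p r, q ∈ closure {x | gr2 u x ≠ 0} := by
  obtain ⟨R, hR0, hR1, hKR, r, hr, Γ, h1, h2, h3⟩ := loc_data hu hK hρ hD hp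
  refine ⟨r, hr, fun q hq => Metric.mem_closure_iff.2 fun e he => ?_⟩
  by_contra hcon
  push Not at hcon
  have hs0 : 0 < min e R := lt_min he hR0
  have hdb := (doubling (tr_contDiff hu q) hK hR1 hKR
    (fun x hx => DI_tr hu (h1 q hq _ (by simpa using hx))) (h2 q hq) (h3 q hq) hs0 (min_le_right e R) le_rfl).1
  have : Hf (tr u q) (min e R) = 0 := by
    unfold Hf J
    rw [integral_eq_zero_of_ae]
    refine ae_of_all _ fun x => ?_
    by_cases hx : min e R ≤ ‖x‖
    · simp [wt_eq_zero hs0.le hx]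
    · push Not at hx
      have : gr2 (tr u q) x = 0 := by
        rw [gr2_tr (hu.of_le (by norm_num))]
        by_contra hne
        have := hcon (q + x) hne
        simp only [dist_self_add_right] at this
        exact absurd (hx.trans_le (min_le_left _ _)) (not_lt.2 this)
      simp [this]
  linarith


/-- `p_i p_j / |p|` -/
def hij (i j : Fin n) (p : EE n) : ℝ := p i * p j / ‖p‖

lemma abs_coord_le (p : EE n) (i : Fin n) : |p i| ≤ ‖p‖ := by
  have := PiLp.norm_apply_le p i
  simpa using this

lemma hij_abs_le (i j : Fin n) (p : EE n) : |hij i j p| ≤ ‖p‖ := by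
  unfold hij
  rw [abs_div, abs_mul, abs_norm]
  rcases eq_or_lt_of_le (norm_nonneg p) with h | h
  · rw [← h]; simp
  · rw [div_le_iff₀ h]
    exact mul_le_mul (abs_coord_le p i) (abs_coord_le p j) (abs_nonneg _) h.le

lemma hij_lip (i j : Fin n) (p q : EE n) : |hij i j p - hij i j q| ≤ 3 * ‖p - q‖ := by
  by_cases hp : p = 0
  · subst hp
    have := hij_abs_le i j q
    have h0 : hij i j (0 : EE n) = 0 := by simp [hij]
    rw [h0, zero_sub, abs_neg, zero_sub, norm_neg]
    linarith [norm_nonneg q]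
  by_cases hq : q = 0
  · subst hq
    have := hij_abs_le i j p
    have h0 : hij i j (0 : EE n) = 0 := by simp [hij]
    rw [h0, sub_zero, sub_zero]
    linarith [norm_nonneg p]
  have tp : 0 < ‖p‖ := norm_pos_iff.2 hp
  have tq : 0 < ‖q‖ := norm_pos_iff.2 hq
  have e : hij i j p - hij i j q = (p i - q i) * (p j / ‖p‖) + (q i / ‖q‖) * (p j / ‖p‖) * (‖q‖ - ‖p‖)
      + (q i / ‖q‖) * (p j - q j) := by
    unfold hij; field_simp; ring
  have b1 : |p i - q i| ≤ ‖p - q‖ := abs_coord_le (p - q) i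
  have b2 : |p j - q j| ≤ ‖p - q‖ := abs_coord_le (p - q) j
  have b3 : |p j / ‖p‖| ≤ 1 := by
    rw [abs_div, abs_norm, div_le_one tp]; exact abs_coord_le p j
  have b4 : |q i / ‖q‖| ≤ 1 := by
    rw [abs_div, abs_norm, div_le_one tq]; exact abs_coord_le q i
  have b5 : |‖q‖ - ‖p‖| ≤ ‖p - q‖ := by rw [norm_sub_rev]; exact abs_norm_sub_norm_le q p
  have c1 : |(p i - q i) * (p j / ‖p‖)| ≤ ‖p - q‖ * 1 := by
    rw [abs_mul]; gcongr
  have c2 : |(q i / ‖q‖) * (p j / ‖p‖) * (‖q‖ - ‖p‖)| ≤ 1 * 1 * ‖p - q‖ := by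
    rw [abs_mul, abs_mul]; gcongr
  have c3 : |(q i / ‖q‖) * (p j - q j)| ≤ 1 * ‖p - q‖ := by
    rw [abs_mul]; gcongr
  rw [e]
  refine (abs_add_three _ _ _).trans ?_
  linarith

lemma hij_cont (i j : Fin n) : Continuous (hij i j) := by
  refine (LipschitzWith.of_dist_le_mul (K := 3) fun p q => ?_).continuous
  rw [Real.dist_eq, dist_eq_norm]
  exact hij_lip i j p q

lemma gradient_coord (w : EE n → ℝ) (x : EE n) (i : Fin n) : (gradient w x) i = pd i w x := by
  have : ⟪gradient w x, ee i⟫ = pd i w x := by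
    unfold gradient pd
    rw [InnerProductSpace.toDual_symm_apply]
  rw [← this, EuclideanSpace.inner_single_right]
  simp

lemma norm_gradient_sq (w : EE n → ℝ) (x : EE n) : ‖gradient w x‖ ^ 2 = gr2 w x := by
  rw [← sum_sq_eq_norm]
  simp [gradient_coord, gr2]

lemma gradient_eq_zero_iff (w : EE n → ℝ) (x : EE n) : gradient w x = 0 ↔ gr2 w x = 0 := by
  rw [← norm_gradient_sq]; simp

lemma inner_gradient (w φ : EE n → ℝ) (x : EE n) :
    ⟪gradient w x, gradient φ x⟫ = ∑ i, pd i w x * pd i φ x := by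
  rw [PiLp.inner_apply]
  refine Finset.sum_congr rfl fun i _ => ?_
  rw [gradient_coord, gradient_coord]; simp [mul_comm]

lemma contDiff_gradient {w : EE n → ℝ} {k m : WithTop ℕ∞} (hw : ContDiff ℝ k w) (h : m + 1 ≤ k) :
    ContDiff ℝ m (gradient w) := by
  rw [contDiff_euclidean]
  intro i
  simp only [gradient_coord]
  exact contDiff_pd hw h i

/-- The differential inequality from the strong form of the equation. -/
lemma DI_of_strong {w : EE n → ℝ} (hw : ContDiff ℝ 3 w) {f : ℝ → ℝ} (hf : ContDiff ℝ 1 f)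
    {p : EE n} {A D : EE n → ℝ} {L α r : ℝ} (hr : 0 < r) (hL : 0 ≤ L) (hα : 0 < α)
    (hA : ∀ x ∈ ball p r, ∀ y ∈ ball p r, |A x - A y| ≤ L * ‖x - y‖)
    (hD : ∀ x ∈ ball p r, ∀ y ∈ ball p r, |D x - D y| ≤ L * ‖x - y‖)
    (hAp : ∀ x ∈ ball p r, α ≤ A x)
    (heq : ∀ x ∈ ball p r, A x * lap w x +
      ∑ i, ∑ j, (D x * hij i j (gradient w x)) * pd j (pd i w) x + f (w x) = 0) :
    ∃ K, 0 ≤ K ∧ ∃ ρ > 0, ∀ x ∈ ball p ρ, DI w K x := by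
  have hV : ContDiff ℝ 1 (gradient w) := contDiff_gradient hw (by norm_num)
  obtain ⟨LV, U, hU, hLV⟩ := (hV.contDiffAt (x := p)).exists_lipschitzOnWith
  obtain ⟨r1, hr1, hU1⟩ := Metric.mem_nhds_iff.1 hU
  set ρ := min r r1 / 2 with hρd
  have hρ : 0 < ρ := by have := lt_min hr hr1; positivity
  have hρr : closedBall p ρ ⊆ ball p r := closedBall_subset_ball (by
    have := min_le_left r r1; have := lt_min hr hr1; rw [hρd]; linarith)
  have hρr1 : closedBall p ρ ⊆ ball p r1 := closedBall_subset_ball (by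
    have := min_le_right r r1; have := lt_min hr hr1; rw [hρd]; linarith)
  have hVl : ∀ x ∈ closedBall p ρ, ∀ y ∈ closedBall p ρ,
      ‖gradient w x - gradient w y‖ ≤ LV * ‖x - y‖ := fun x hx y hy => by
    have := hLV.dist_le_mul x (hU1 (hρr1 hx)) y (hU1 (hρr1 hy))
    rwa [dist_eq_norm, dist_eq_norm] at this
  -- bounds
  have hcp := isCompact_closedBall p ρ
  obtain ⟨MV, hMV⟩ := hcp.exists_bound_of_continuousOn hV.continuous.continuousOn
  have hMV0 : 0 ≤ MV := (norm_nonneg _).trans (hMV p (mem_closedBall_self hρ.le))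
  set MD := |D p| + L * ρ with hMDd
  have hMD0 : 0 ≤ MD := by positivity
  have hMD : ∀ x ∈ closedBall p ρ, |D x| ≤ MD := fun x hx => by
    have h1 := hD x (hρr hx) p (mem_ball_self hr)
    have h2 : ‖x - p‖ ≤ ρ := by rwa [← dist_eq_norm]
    have h3 : L * ‖x - p‖ ≤ L * ρ := by gcongr
    have := abs_sub_abs_le_abs_sub (D x) (D p)
    linarith
  have hfd : ContinuousOn (fun x => deriv f (w x)) (closedBall p ρ) :=
    ((hf.continuous_deriv le_rfl).comp hw.continuous).continuousOn
  obtain ⟨Mf, hMf⟩ := hcp.exists_bound_of_continuousOn hfd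
  have hMf0 : 0 ≤ Mf := (norm_nonneg _).trans (hMf p (mem_closedBall_self hρ.le))
  have h2c : ∀ i j, ContDiff ℝ 1 (pd j (pd i w)) := fun i j =>
    contDiff_pd (contDiff_pd hw (m := 2) (by norm_num) i) (by norm_num) j
  have h3c : Continuous (fun x => ∑ i, ∑ j, ∑ k, |pd k (pd j (pd i w)) x|) := by
    refine continuous_finsetSum _ fun i _ => continuous_finsetSum _ fun j _ =>
      continuous_finsetSum _ fun k _ => ?_
    exact (contDiff_pd (h2c i j) (m := 0) (by norm_num) k).continuous.abs
  obtain ⟨M3, hM3⟩ := hcp.exists_bound_of_continuousOn h3c.continuousOn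
  have hM30 : 0 ≤ M3 := (norm_nonneg _).trans (hM3 p (mem_closedBall_self hρ.le))
  have hM3' : ∀ x ∈ closedBall p ρ, ∀ i j k, |pd k (pd j (pd i w)) x| ≤ M3 := by
    intro x hx i j k
    refine le_trans ?_ ((le_abs_self _).trans (hM3 x hx))
    refine le_trans ?_ (Finset.single_le_sum (f := fun i => ∑ j, ∑ k, |pd k (pd j (pd i w)) x|)
      (fun _ _ => by positivity) (Finset.mem_univ i))
    refine le_trans ?_ (Finset.single_le_sum (f := fun j => ∑ k, |pd k (pd j (pd i w)) x|)
      (fun _ _ => by positivity) (Finset.mem_univ j))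
    exact Finset.single_le_sum (f := fun k => |pd k (pd j (pd i w)) x|)
      (fun _ _ => by positivity) (Finset.mem_univ k)
  set LG := L * MV + MD * (3 * LV) with hLGd
  have hLG0 : 0 ≤ LG := by positivity
  have hG : ∀ i j, ∀ x ∈ closedBall p ρ, ∀ y ∈ closedBall p ρ,
      |D x * hij i j (gradient w x) - D y * hij i j (gradient w y)| ≤ LG * ‖x - y‖ := by
    intro i j x hx y hy
    have e : D x * hij i j (gradient w x) - D y * hij i j (gradient w y)
      = (D x - D y) * hij i j (gradient w x)
        + D y * (hij i j (gradient w x) - hij i j (gradient w y)) := by ring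
    rw [e]
    refine (abs_add_le _ _).trans ?_
    rw [abs_mul, abs_mul]
    have h1 := hD x (hρr hx) y (hρr hy)
    have h2 := (hij_abs_le i j (gradient w x)).trans (hMV x hx)
    have h3 := hMD y hy
    have h4 := (hij_lip i j (gradient w x) (gradient w y)).trans
      (mul_le_mul_of_nonneg_left (hVl x hx y hy) (by norm_num : (0:ℝ) ≤ 3))
    calc _ ≤ (L * ‖x - y‖) * MV + MD * (3 * (LV * ‖x - y‖)) := by gcongr
      _ = _ := by rw [hLGd]; ring
  set K0 := (L * n + LG * (n * n) + MD * M3 * (n * n) + Mf) / α with hK0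
  have hK00 : 0 ≤ K0 := by positivity
  refine ⟨√n * K0, by positivity, ρ, hρ, fun x hx => ?_⟩
  have hxc : x ∈ closedBall p ρ := ball_subset_closedBall hx
  set S := √(gr2 w x + hs2 w x) with hS
  have hg0 := gr2_nonneg w x
  have hh0 := hs2_nonneg w x
  have hS0 : 0 ≤ S := Real.sqrt_nonneg _
  have hSV : ‖gradient w x‖ ≤ S := Real.le_sqrt_of_sq_le (by rw [norm_gradient_sq]; linarith)
  have hS2 : ∀ i j, |pd j (pd i w) x| ≤ S := fun i j => Real.le_sqrt_of_sq_le (by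
    rw [sq_abs]; linarith [pd_sq_le_hs2 w x i j])
  have hS1 : ∀ i, |pd i w x| ≤ S := fun i => Real.le_sqrt_of_sq_le (by
    rw [sq_abs]; linarith [pd_sq_le_gr2 w x i])
  have hlapS : |lap w x| ≤ n * S := by
    unfold lap
    refine (Finset.abs_sum_le_sum_abs _ _).trans ?_
    refine (Finset.sum_le_sum fun j _ => hS2 j j).trans ?_
    simp
  -- the frozen coefficient operator
  set T : EE n → ℝ := fun y => A x * lap w y +
      ∑ i, ∑ j, (D x * hij i j (gradient w x)) * pd j (pd i w) y + f (w y) with hT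
  have hlapc : ContDiff ℝ 1 (lap w) := contDiff_lap hw (by norm_num)
  have hTd : ContDiff ℝ 1 T := by
    refine ((contDiff_const.mul hlapc).add (ContDiff.sum fun i _ => ContDiff.sum fun j _ =>
      contDiff_const.mul (h2c i j))).add (hf.comp (hw.of_le (by norm_num)))
  set R : EE n → ℝ := fun y => L * |lap w y| + ∑ i, ∑ j, LG * |pd j (pd i w) y| with hR
  have hRc : Continuous R := by
    refine (continuous_const.mul hlapc.continuous.abs).add ?_
    exact continuous_finsetSum _ fun i _ => continuous_finsetSum _ fun j _ =>
      continuous_const.mul (h2c i j).continuous.abs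
  have hTx : T x = 0 := heq x (hρr hxc)
  have hTy : ∀ y ∈ closedBall p ρ, |T y| ≤ R y * ‖y - x‖ := by
    intro y hy
    have e : T y = (A x - A y) * lap w y + ∑ i, ∑ j,
        (D x * hij i j (gradient w x) - D y * hij i j (gradient w y)) * pd j (pd i w) y := by
      have := heq y (hρr hy)
      simp only [hT, sub_mul, Finset.sum_sub_distrib]
      linarith
    rw [e, hR]
    simp only
    rw [add_mul, Finset.sum_mul]
    refine (abs_add_le _ _).trans (add_le_add ?_ ?_)
    · rw [abs_mul]
      have := hA x (hρr hxc) y (hρr hy)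
      rw [norm_sub_rev] at this
      calc _ ≤ (L * ‖y - x‖) * |lap w y| := by gcongr
        _ = _ := by ring
    · refine (Finset.abs_sum_le_sum_abs _ _).trans (Finset.sum_le_sum fun i _ => ?_)
      rw [Finset.sum_mul]
      refine (Finset.abs_sum_le_sum_abs _ _).trans (Finset.sum_le_sum fun j _ => ?_)
      rw [abs_mul]
      have := hG i j x hxc y hy
      rw [norm_sub_rev] at this
      calc _ ≤ (LG * ‖y - x‖) * |pd j (pd i w) y| := by gcongr
        _ = _ := by ring
  have hR0 : ∀ y, 0 ≤ R y := fun y => by simp only [hR]; positivity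
  have hTn : ‖fderiv ℝ T x‖ ≤ R x := by
    refine le_of_forall_pos_le_add fun ε hε => ?_
    refine ((hTd.differentiable one_ne_zero x).hasFDerivAt).le_of_lip' (by linarith [hR0 x]) ?_
    have h1 : ∀ᶠ y in 𝓝 x, R y < R x + ε :=
      hRc.continuousAt.eventually_lt continuousAt_const (by linarith)
    filter_upwards [h1, isOpen_ball.mem_nhds hx] with y hy1 hy2
    rw [hTx, sub_zero]
    refine (hTy y (ball_subset_closedBall hy2)).trans ?_
    gcongr
  have hRx : R x ≤ (L * n + LG * (n * n)) * S := by
    simp only [hR]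
    have : ∑ i : Fin n, ∑ j : Fin n, LG * |pd j (pd i w) x| ≤ ∑ i : Fin n, ∑ j : Fin n, LG * S := by
      refine Finset.sum_le_sum fun i _ => Finset.sum_le_sum fun j _ => ?_
      exact mul_le_mul_of_nonneg_left (hS2 i j) hLG0
    simp only [Finset.sum_const, Finset.card_univ, Fintype.card_fin, nsmul_eq_mul] at this
    have h2 := mul_le_mul_of_nonneg_left hlapS hL
    linarith
  have hk : ∀ k, |pd k (lap w) x| ≤ K0 * S := by
    intro k
    have e : pd k T x = A x * pd k (lap w) x +
      ∑ i, ∑ j, (D x * hij i j (gradient w x)) * pd k (pd j (pd i w)) x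
        + deriv f (w x) * pd k w x := by
      have d1 : DifferentiableAt ℝ (fun y => A x * lap w y) x :=
        (contDiff_const.mul hlapc).differentiable one_ne_zero x
      have d2' : ∀ i j, DifferentiableAt ℝ (fun y => (D x * hij i j (gradient w x)) * pd j (pd i w) y) x :=
        fun i j => (contDiff_const.mul (h2c i j)).differentiable one_ne_zero x
      have d2'' : ∀ i, DifferentiableAt ℝ (fun y => ∑ j, (D x * hij i j (gradient w x)) * pd j (pd i w) y) x :=
        fun i => (ContDiff.sum fun j _ => contDiff_const.mul (h2c i j)).differentiable one_ne_zero x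
      have d2 : DifferentiableAt ℝ (fun y => ∑ i, ∑ j, (D x * hij i j (gradient w x)) * pd j (pd i w) y) x :=
        (ContDiff.sum fun i _ => ContDiff.sum fun j _ => contDiff_const.mul (h2c i j)).differentiable one_ne_zero x
      have d3 : DifferentiableAt ℝ (fun y => f (w y)) x :=
        (hf.comp (hw.of_le (by norm_num))).differentiable one_ne_zero x
      have s1 : pd k T x = pd k (fun y => (A x * lap w y +
          ∑ i, ∑ j, (D x * hij i j (gradient w x)) * pd j (pd i w) y) + f (w y)) x := rfl
      have d12 : DifferentiableAt ℝ (fun y => A x * lap w y +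
          ∑ i, ∑ j, (D x * hij i j (gradient w x)) * pd j (pd i w) y) x := d1.add d2
      rw [s1, pd_add d12 d3, pd_add d1 d2,
        pd_const_mul _ (hlapc.differentiable one_ne_zero x),
        pd_comp ((hf.differentiable one_ne_zero (w x)).hasDerivAt) (hw.differentiable (by norm_num) x),
        pd_sum _ (fun i _ => d2'' i)]
      congr 2
      refine Finset.sum_congr rfl fun i _ => ?_
      rw [pd_sum _ (fun j _ => d2' i j)]
      refine Finset.sum_congr rfl fun j _ => ?_
      rw [pd_const_mul _ ((h2c i j).differentiable one_ne_zero x)]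
    have b1 : |pd k T x| ≤ (L * n + LG * (n * n)) * S := by
      refine le_trans ?_ (hTn.trans hRx)
      have := (fderiv ℝ T x).le_opNorm (ee k)
      simpa [pd, ee] using this
    have b2 : |∑ i, ∑ j, (D x * hij i j (gradient w x)) * pd k (pd j (pd i w)) x|
        ≤ MD * M3 * (n * n) * S := by
      have : |∑ i, ∑ j, (D x * hij i j (gradient w x)) * pd k (pd j (pd i w)) x|
        ≤ ∑ i : Fin n, ∑ j : Fin n, (MD * S) * M3 := by
        refine (Finset.abs_sum_le_sum_abs _ _).trans (Finset.sum_le_sum fun i _ => ?_)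
        refine (Finset.abs_sum_le_sum_abs _ _).trans (Finset.sum_le_sum fun j _ => ?_)
        rw [abs_mul, abs_mul]
        have h1 := hMD x hxc
        have h2 := (hij_abs_le i j (gradient w x)).trans hSV
        have h3 := hM3' x hxc i j k
        gcongr
      simp only [Finset.sum_const, Finset.card_univ, Fintype.card_fin, nsmul_eq_mul] at this
      linarith
    have b3 : |deriv f (w x) * pd k w x| ≤ Mf * S := by
      rw [abs_mul]
      have h1 : |deriv f (w x)| ≤ Mf := hMf x hxc
      have h2 := hS1 k
      gcongr
    have b4 : α * |pd k (lap w) x| ≤ |A x * pd k (lap w) x| := by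
      rw [abs_mul]
      have := (hAp x (hρr hxc)).trans (le_abs_self _)
      gcongr
    have e2 : A x * pd k (lap w) x = pd k T x -
      ∑ i, ∑ j, (D x * hij i j (gradient w x)) * pd k (pd j (pd i w)) x
        - deriv f (w x) * pd k w x := by rw [e]; ring
    rw [e2] at b4
    have b5 := b4.trans ((abs_sub _ _).trans (add_le_add_left (abs_sub _ _) _))
    rw [hK0, div_mul_eq_mul_div, le_div_iff₀ hα]
    linarith
  unfold DI
  have : ∀ i, (lap (pd i w) x) ^ 2 ≤ K0 ^ 2 * S ^ 2 := by
    intro i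
    rw [lap_pd hw, ← sq_abs, ← mul_pow]
    exact pow_le_pow_left₀ (abs_nonneg _) (hk i) 2
  refine (Finset.sum_le_sum fun i _ => this i).trans ?_
  have hSsq : S ^ 2 = gr2 w x + hs2 w x := Real.sq_sqrt (by positivity)
  have hnsq : (√(n : ℝ)) ^ 2 = n := Real.sq_sqrt (by positivity)
  rw [mul_pow, hSsq, hnsq]
  simp only [Finset.sum_const, Finset.card_univ, Fintype.card_fin, nsmul_eq_mul]
  rw [mul_assoc]


/-- the differential of `p ↦ a(|p|) p_i` -/
def dPhi (a : ℝ → ℝ) (i : Fin n) (p : EE n) : EE n →L[ℝ] ℝ :=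
  a ‖p‖ • (EuclideanSpace.proj i : EE n →L[ℝ] ℝ) +
    ∑ j, (deriv a ‖p‖ * hij i j p) • (EuclideanSpace.proj j : EE n →L[ℝ] ℝ)

lemma cont_comp_norm {b : ℝ → ℝ} (hb : ContinuousOn b (Ici 0)) :
    Continuous (fun p : EE n => b ‖p‖) :=
  hb.comp_continuous continuous_norm (fun p => norm_nonneg p)

lemma dPhi_cont {a : ℝ → ℝ} (ha : ContDiffOn ℝ 1 a (Ici 0)) (hd : ContinuousOn (deriv a) (Ici 0))
    (i : Fin n) : Continuous (dPhi a i) := by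
  unfold dPhi
  refine ((cont_comp_norm ha.continuousOn).smul continuous_const).add ?_
  exact continuous_finsetSum _ fun j _ =>
    ((cont_comp_norm hd).mul (hij_cont i j)).smul continuous_const

lemma hasFDerivAt_Phi {a : ℝ → ℝ} (ha : ContDiffOn ℝ 1 a (Ici 0)) (i : Fin n) (p : EE n) :
    HasFDerivAt (fun q : EE n => a ‖q‖ * q i) (dPhi a i p) p := by
  by_cases hp : p = 0
  · subst hp
    have e : dPhi a i (0 : EE n) = a 0 • (EuclideanSpace.proj i : EE n →L[ℝ] ℝ) := by
      simp [dPhi, hij]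
    rw [e, hasFDerivAt_iff_isLittleO]
    have h1 : (fun q : EE n => a ‖q‖ - a 0) =o[𝓝 0] (fun _ => (1:ℝ)) := by
      rw [Asymptotics.isLittleO_one_iff]
      have := (cont_comp_norm (n := n) ha.continuousOn).tendsto 0
      have := this.sub_const (a 0)
      simpa using this
    have h2 : (fun q : EE n => q i) =O[𝓝 0] (fun q => q) :=
      Asymptotics.IsBigO.of_bound 1 (Eventually.of_forall fun q => by
        simpa using abs_coord_le q i)
    have := h1.mul_isBigO h2.norm_right
    simp only [one_mul] at this
    rw [← Asymptotics.isLittleO_norm_right]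
    refine this.congr (fun q => ?_) (fun q => by simp)
    simp; ring
  · have tp : 0 < ‖p‖ := norm_pos_iff.2 hp
    have hda : HasDerivAt a (deriv a ‖p‖) ‖p‖ :=
      ((ha.contDiffAt (Ici_mem_nhds tp)).differentiableAt one_ne_zero).hasDerivAt
    have hs : √(‖p‖ ^ 2) = ‖p‖ := Real.sqrt_sq tp.le
    have h1 : HasDerivAt Real.sqrt (1 / (2 * √(‖p‖ ^ 2))) (‖p‖ ^ 2) :=
      Real.hasDerivAt_sqrt (by positivity)
    have h2 : HasDerivAt (fun s => a (√s)) (deriv a ‖p‖ * (1 / (2 * √(‖p‖ ^ 2)))) (‖p‖ ^ 2) :=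
      HasDerivAt.comp (h₂ := a) (‖p‖ ^ 2) (by rw [hs]; exact hda) h1
    have h3 := (hasStrictFDerivAt_norm_sq p).hasFDerivAt
    have h4 := h2.comp_hasFDerivAt p h3
    have h5 := h4.mul (hasFDerivAt_coord i p)
    have e1 : (fun q : EE n => a ‖q‖ * q i) =
        (((fun s => a (√s)) ∘ fun q : EE n => ‖q‖ ^ 2) * fun q : EE n => q i) := by
      funext q
      simp [Real.sqrt_sq (norm_nonneg q)]
    rw [e1]
    refine h5.congr_fderiv ?_
    ext v
    rw [hs]
    have hin : ⟪p, v⟫ = ∑ j, p j * v j := by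
      rw [PiLp.inner_apply]; exact Finset.sum_congr rfl fun j _ => by simp [mul_comm]
    simp [dPhi, hij, hs, hin, Finset.mul_sum, Finset.sum_mul]
    refine Finset.sum_congr rfl fun j _ => ?_
    field_simp

lemma contDiff_Phi {a : ℝ → ℝ} (ha : ContDiffOn ℝ 1 a (Ici 0)) (hd : ContinuousOn (deriv a) (Ici 0))
    (i : Fin n) : ContDiff ℝ 1 (fun q : EE n => a ‖q‖ * q i) :=
  contDiff_one_iff_hasFDerivAt.2 ⟨dPhi a i, dPhi_cont ha hd i, hasFDerivAt_Phi ha i⟩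

lemma pd_gradient {w : EE n → ℝ} (hw : ContDiff ℝ 3 w) (x : EE n) (i k : Fin n) :
    (fderiv ℝ (gradient w) x (ee k)) i = pd k (pd i w) x := by
  have hV : ContDiff ℝ 1 (gradient w) := contDiff_gradient hw (by norm_num)
  have h := ((EuclideanSpace.proj i : EE n →L[ℝ] ℝ).hasFDerivAt).comp x
    (hV.differentiable one_ne_zero x).hasFDerivAt
  have e : (⇑(EuclideanSpace.proj i : EE n →L[ℝ] ℝ) ∘ gradient w) = pd i w := by
    funext y; simp [gradient_coord]
  rw [e] at h
  rw [hasFDerivAt_pd_eq h]; simp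

lemma pd_Phi {a : ℝ → ℝ} (ha : ContDiffOn ℝ 1 a (Ici 0))
    {w : EE n → ℝ} (hw : ContDiff ℝ 3 w) (i k : Fin n) (x : EE n) :
    pd k (fun y => a ‖gradient w y‖ * pd i w y) x = a ‖gradient w x‖ * pd k (pd i w) x +
      ∑ j, (deriv a ‖gradient w x‖ * hij i j (gradient w x)) * pd k (pd j w) x := by
  have hV : ContDiff ℝ 1 (gradient w) := contDiff_gradient hw (by norm_num)
  have h := (hasFDerivAt_Phi ha i (gradient w x)).comp x
    (hV.differentiable one_ne_zero x).hasFDerivAt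
  have e : ((fun q : EE n => a ‖q‖ * q i) ∘ gradient w) = fun y => a ‖gradient w y‖ * pd i w y := by
    funext y; simp [gradient_coord]
  rw [e] at h
  rw [hasFDerivAt_pd_eq h]
  have hpr : ∀ j, (EuclideanSpace.proj j : EE n →L[ℝ] ℝ) (fderiv ℝ (gradient w) x (ee k))
      = pd k (pd j w) x := fun j => pd_gradient hw x j k
  simp only [dPhi, ContinuousLinearMap.comp_apply, _root_.add_apply,
    _root_.smul_apply, _root_.sum_apply, hpr, smul_eq_mul]

/-- weak solutions are strong solutions -/
lemma strong_of_weak {a f : ℝ → ℝ} (ha : ContDiffOn ℝ 1 a (Ici 0))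
    (hd : ContinuousOn (deriv a) (Ici 0)) (hf : ContDiff ℝ 1 f)
    {w : EE n → ℝ} (hw : ContDiff ℝ 3 w) {B : Set (EE n)} (hB : IsOpen B)
    (hweak : ∀ φ : EE n → ℝ, ContDiff ℝ 1 φ → HasCompactSupport φ → tsupport φ ⊆ B →
      ∫ x, a ‖gradient w x‖ * ⟪gradient w x, gradient φ x⟫ = ∫ x, f (w x) * φ x) :
    ∀ x ∈ B, a ‖gradient w x‖ * lap w x +
      ∑ i, ∑ j, (deriv a ‖gradient w x‖ * hij i j (gradient w x)) * pd j (pd i w) x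
        + f (w x) = 0 := by
  have hV : ContDiff ℝ 1 (gradient w) := contDiff_gradient hw (by norm_num)
  set F : Fin n → EE n → ℝ := fun i y => a ‖gradient w y‖ * pd i w y with hF
  have hFc : ∀ i, ContDiff ℝ 1 (F i) := by
    intro i
    have := (contDiff_Phi ha hd i).comp hV
    have e : ((fun q : EE n => a ‖q‖ * q i) ∘ gradient w) = F i := by
      funext y; simp [hF, gradient_coord]
    rwa [e] at this
  have hFd : ∀ i, Continuous (pd i (F i)) := fun i =>
    (contDiff_pd (m := 0) (hFc i) (by norm_num) i).continuous
  set E : EE n → ℝ := fun x => ∑ i, pd i (F i) x + f (w x) with hE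
  have hEc : Continuous E :=
    (continuous_finsetSum _ fun i _ => hFd i).add (hf.continuous.comp hw.continuous)
  have hae : ∀ᵐ x, x ∈ B → E x = 0 := by
    refine hB.ae_eq_zero_of_integral_contDiff_smul_eq_zero
      (hEc.locallyIntegrable.locallyIntegrableOn _) fun φ hφ hφc hφs => ?_
    have hφ1 : ContDiff ℝ 1 φ := hφ.of_le (by exact_mod_cast le_top)
    have h := hweak φ hφ1 hφc hφs
    have hpφ : ∀ i, Continuous (pd i φ) := fun i =>
      (contDiff_pd (m := 0) hφ1 (by norm_num) i).continuous
    have hs : ∀ i, HasCompactSupport (pd i φ) := fun i =>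
      (hφc.fderiv (𝕜 := ℝ)).comp_left (g := fun L : EE n →L[ℝ] ℝ => L (ee i)) (by simp)
    have e1 : ∫ x, a ‖gradient w x‖ * ⟪gradient w x, gradient φ x⟫
        = ∑ i, ∫ x, F i x * pd i φ x := by
      have i0 : ∀ i, Integrable (fun x => F i x * pd i φ x) := fun i =>
        ((hFc i).continuous.mul (hpφ i)).integrable_of_hasCompactSupport (hs i).mul_left
      rw [← integral_finsetSum _ fun i _ => i0 i]
      congr 1; funext x
      rw [inner_gradient, Finset.mul_sum]
      exact Finset.sum_congr rfl fun i _ => by simp only [hF]; ring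
    have e2 : ∀ i, ∫ x, pd i (F i) x * φ x = - ∫ x, F i x * pd i φ x := fun i =>
      integral_by_parts (hFc i) hφ1 hφc i
    have i1 : ∀ i, Integrable (fun x => pd i (F i) x * φ x) := fun i =>
      ((hFd i).mul hφ1.continuous).integrable_of_hasCompactSupport hφc.mul_left
    have i2 : Integrable (fun x => f (w x) * φ x) :=
      ((hf.continuous.comp hw.continuous).mul hφ1.continuous).integrable_of_hasCompactSupport hφc.mul_left
    have e3 : ∀ x, φ x • E x = ∑ i, pd i (F i) x * φ x + f (w x) * φ x := fun x => by
      rw [smul_eq_mul, hE, mul_comm]; simp only [add_mul, Finset.sum_mul]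
    simp_rw [e3]
    rw [integral_add (integrable_finsetSum _ fun i _ => i1 i) i2,
      integral_finsetSum _ fun i _ => i1 i]
    simp_rw [e2]
    rw [Finset.sum_neg_distrib, ← e1, h]; ring
  have hEq : EqOn E (fun _ => 0) B := by
    refine Measure.eqOn_open_of_ae_eq (μ := volume) ?_ hB hEc.continuousOn continuousOn_const
    exact (ae_restrict_iff' hB.measurableSet).2 hae
  intro x hx
  have := hEq hx
  simp only [hE, hF] at this
  rw [← this]
  simp_rw [pd_Phi ha hw]
  rw [Finset.sum_add_distrib, lap, Finset.mul_sum]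
  congr 2
  refine Finset.sum_congr rfl fun i _ => Finset.sum_congr rfl fun j _ => ?_
  rw [pd_comm (hw.of_le (by norm_num))]


lemma lip_comp_grad {w : EE n → ℝ} (hw : ContDiff ℝ 3 w) {b : ℝ → ℝ} {p : EE n} {V : Set ℝ}
    (hV : V ∈ 𝓝[Ici (0 : ℝ)] ‖gradient w p‖) {K : NNReal} (hb : LipschitzOnWith K b V) :
    ∃ L, 0 ≤ L ∧ ∀ᶠ r in 𝓝[>] (0 : ℝ), ∀ x ∈ ball p r, ∀ y ∈ ball p r,
      |b ‖gradient w x‖ - b ‖gradient w y‖| ≤ L * ‖x - y‖ := by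
  have hG : ContDiff ℝ 1 (gradient w) := contDiff_gradient hw (by norm_num)
  obtain ⟨LV, U, hU, hLV⟩ := (hG.contDiffAt (x := p)).exists_lipschitzOnWith
  have h1 : Tendsto (fun x => ‖gradient w x‖) (𝓝 p) (𝓝[Ici (0 : ℝ)] ‖gradient w p‖) :=
    tendsto_nhdsWithin_iff.2 ⟨hG.continuous.norm.tendsto p,
      Eventually.of_forall fun x => norm_nonneg _⟩
  have h2 : U ∩ {x | ‖gradient w x‖ ∈ V} ∈ 𝓝 p := inter_mem hU (h1 hV)
  obtain ⟨r0, hr0, hr0s⟩ := Metric.mem_nhds_iff.1 h2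
  refine ⟨K * LV, by positivity, ?_⟩
  filter_upwards [Ioo_mem_nhdsGT hr0] with r hr x hx y hy
  have hx' := hr0s (ball_subset_ball hr.2.le hx)
  have hy' := hr0s (ball_subset_ball hr.2.le hy)
  have e1 := hb.dist_le_mul _ hx'.2 _ hy'.2
  have e2 := hLV.dist_le_mul _ hx'.1 _ hy'.1
  rw [Real.dist_eq, Real.dist_eq] at e1
  rw [dist_eq_norm, dist_eq_norm] at e2
  refine e1.trans ?_
  rw [mul_assoc]
  gcongr
  exact (abs_norm_sub_norm_le _ _).trans e2

lemma pd_congr_open {u w : EE n → ℝ} {B : Set (EE n)} (hB : IsOpen B) (h : ∀ x ∈ B, w x = u x)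
    {x : EE n} (hx : x ∈ B) (i : Fin n) : pd i w x = pd i u x := by
  have : w =ᶠ[𝓝 x] u := by
    filter_upwards [hB.mem_nhds hx] with y hy using h y hy
  unfold pd; rw [this.fderiv_eq]

lemma gr2_congr_open {u w : EE n → ℝ} {B : Set (EE n)} (hB : IsOpen B) (h : ∀ x ∈ B, w x = u x)
    {x : EE n} (hx : x ∈ B) : gr2 w x = gr2 u x := by
  unfold gr2
  exact Finset.sum_congr rfl fun i _ => by rw [pd_congr_open hB h hx]

lemma gradient_congr_open {u w : EE n → ℝ} {B : Set (EE n)} (hB : IsOpen B)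
    (h : ∀ x ∈ B, w x = u x) {x : EE n} (hx : x ∈ B) : gradient w x = gradient u x := by
  ext i
  rw [gradient_coord, gradient_coord, pd_congr_open hB h hx]

lemma exists_cutoff {Ω : Set (EE n)} (hΩ : IsOpen Ω) {u : EE n → ℝ} (hu : ContDiffOn ℝ 3 u Ω)
    {p : EE n} (hp : p ∈ Ω) :
    ∃ w : EE n → ℝ, ContDiff ℝ 3 w ∧ ∃ ρ > 0, ball p ρ ⊆ Ω ∧ ∀ x ∈ ball p ρ, w x = u x := by
  obtain ⟨r, hr, hrs⟩ := Metric.isOpen_iff.1 hΩ p hp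
  let χ : ContDiffBump p := ⟨r / 4, r / 2, by positivity, by linarith⟩
  refine ⟨fun x => χ x * u x, ?_, r / 4, by positivity,
    (ball_subset_ball (by linarith)).trans hrs, fun x hx => ?_⟩
  · rw [contDiff_iff_contDiffAt]
    intro x
    by_cases hx : x ∈ Ω
    · exact χ.contDiff.contDiffAt.mul (hu.contDiffAt (hΩ.mem_nhds hx))
    · have hxs : x ∉ tsupport χ := by
        rw [χ.tsupport_eq]
        intro hmem
        exact hx (hrs (closedBall_subset_ball (show r / 2 < r by linarith) hmem))
      have : (fun x => χ x * u x) =ᶠ[𝓝 x] fun _ => 0 := by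
        filter_upwards [(isClosed_tsupport χ).isOpen_compl.mem_nhds hxs] with y hy
        rw [image_eq_zero_of_notMem_tsupport hy, zero_mul]
      exact contDiffAt_const.congr_of_eventuallyEq this
  · simp only
    rw [χ.one_of_mem_closedBall (ball_subset_closedBall hx), one_mul]

lemma deriv_contOn {a : ℝ → ℝ} (ha : C11Loc a) : ContinuousOn (deriv a) (Ici 0) := by
  intro t ht
  obtain ⟨V, hV, K, hK⟩ := ha.2 t ht
  have htV : t ∈ V := mem_of_mem_nhdsWithin ht hV
  exact (hK.continuousOn t htV).mono_of_mem_nhdsWithin hV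

lemma local_model {Ω : Set (EE n)} (hΩ : IsOpen Ω) {a f : ℝ → ℝ} (ha : C11Loc a)
    (hapos : ∀ t ≥ (0 : ℝ), 0 < a t) (hf : ContDiff ℝ 1 f)
    {u : EE n → ℝ} (hu : ContDiffOn ℝ 3 u Ω) (hsol : IsWeakSolution a f Ω u)
    {p : EE n} (hp : p ∈ Ω) :
    ∃ w : EE n → ℝ, ContDiff ℝ 3 w ∧ ∃ K, 0 ≤ K ∧ ∃ ρ > 0, ball p ρ ⊆ Ω ∧
      (∀ x ∈ ball p ρ, w x = u x) ∧ ∀ x ∈ ball p ρ, DI w K x := by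
  obtain ⟨w, hw, ρ, hρ, hρs, hwu⟩ := exists_cutoff hΩ hu hp
  have hd := deriv_contOn ha
  have hstrong := strong_of_weak ha.1 hd hf hw (B := ball p ρ) isOpen_ball (by
    intro φ hφ hφc hφs
    have htest : IsTestOn Ω φ :=
      ⟨hφ.lipschitzWith_of_hasCompactSupport hφc one_ne_zero, hφc, hφs.trans hρs⟩
    have h := hsol φ htest
    have hz : ∀ x, x ∉ ball p ρ → φ x = 0 ∧ gradient φ x = 0 := by
      intro x hx
      have hxs : x ∉ tsupport φ := fun h => hx (hφs h)
      refine ⟨image_eq_zero_of_notMem_tsupport hxs, ?_⟩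
      have : φ =ᶠ[𝓝 x] fun _ => 0 := by
        filter_upwards [(isClosed_tsupport φ).isOpen_compl.mem_nhds hxs] with y hy
        exact image_eq_zero_of_notMem_tsupport hy
      unfold gradient
      rw [this.fderiv_eq]; simp
    have e1 : ∀ x, a ‖gradient w x‖ * ⟪gradient w x, gradient φ x⟫
        = a ‖gradient u x‖ * ⟪gradient u x, gradient φ x⟫ := by
      intro x
      by_cases hx : x ∈ ball p ρ
      · rw [gradient_congr_open isOpen_ball hwu hx]
      · rw [(hz x hx).2]; simp
    have e2 : ∀ x, f (w x) * φ x = f (u x) * φ x := by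
      intro x
      by_cases hx : x ∈ ball p ρ
      · rw [hwu x hx]
      · rw [(hz x hx).1]; simp
    simp_rw [e1, e2]
    rw [← setIntegral_eq_integral_of_forall_compl_eq_zero (s := Ω), h,
      setIntegral_eq_integral_of_forall_compl_eq_zero]
    · intro x hx
      rw [(hz x fun h => hx (hρs h)).1, mul_zero]
    · intro x hx
      rw [(hz x fun h => hx (hρs h)).2]; simp)
  have ht0 : ‖gradient w p‖ ∈ Ici (0 : ℝ) := norm_nonneg _
  obtain ⟨K1, V1, hV1, hl1⟩ := (ha.1 _ ht0).exists_lipschitzOnWith (convex_Ici 0)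
  obtain ⟨V2, hV2, K2, hl2⟩ := ha.2 _ ht0
  obtain ⟨L1, hL1, hr1⟩ := lip_comp_grad hw hV1 hl1
  obtain ⟨L2, hL2, hr2⟩ := lip_comp_grad hw hV2 hl2
  have hG : ContDiff ℝ 1 (gradient w) := contDiff_gradient hw (by norm_num)
  have hac : Continuous (fun x => a ‖gradient w x‖) :=
    (cont_comp_norm ha.1.continuousOn).comp hG.continuous
  have hα : 0 < a ‖gradient w p‖ := hapos _ ht0
  have h3 : ∀ᶠ x in 𝓝 p, a ‖gradient w p‖ / 2 < a ‖gradient w x‖ :=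
    continuousAt_const.eventually_lt hac.continuousAt (by linarith)
  obtain ⟨r3, hr3, hr3s⟩ := Metric.eventually_nhds_iff_ball.1 h3
  obtain ⟨r, ⟨⟨hA, hD⟩, hr0⟩⟩ :=
    ((hr1.and hr2).and (Ioo_mem_nhdsGT (lt_min hr3 hρ))).exists
  have hrr3 : ball p r ⊆ ball p r3 := ball_subset_ball (hr0.2.le.trans (min_le_left _ _))
  have hrρ : ball p r ⊆ ball p ρ := ball_subset_ball (hr0.2.le.trans (min_le_right _ _))
  obtain ⟨K, hK, ρ', hρ', hDI⟩ := DI_of_strong hw hf (A := fun x => a ‖gradient w x‖)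
    (D := fun x => deriv a ‖gradient w x‖) (L := max L1 L2) (α := a ‖gradient w p‖ / 2) hr0.1
    (hL1.trans (le_max_left _ _)) (by positivity)
    (fun x hx y hy => (hA x hx y hy).trans (by gcongr; exact le_max_left _ _))
    (fun x hx y hy => (hD x hx y hy).trans (by gcongr; exact le_max_right _ _))
    (fun x hx => (hr3s x (hrr3 hx)).le) (fun x hx => hstrong x (hrρ hx))
  refine ⟨w, hw, K, hK, min ρ ρ', lt_min hρ hρ', ?_, ?_, ?_⟩
  · exact (ball_subset_ball (min_le_left _ _)).trans hρs
  · exact fun x hx => hwu x (ball_subset_ball (min_le_left _ _) hx)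
  · exact fun x hx => hDI x (ball_subset_ball (min_le_right _ _) hx)

lemma closure_congr_ball {u w : EE n → ℝ} {p : EE n} {ρ : ℝ} (h : ∀ x ∈ ball p ρ, w x = u x)
    {q : EE n} (hq : q ∈ ball p ρ) :
    q ∈ closure {x | gr2 w x ≠ 0} ↔ q ∈ closure {x | gr2 u x ≠ 0} := by
  have key : ∀ S T : Set (EE n), (∀ x ∈ ball p ρ, x ∈ S → x ∈ T) → q ∈ closure S →
      q ∈ closure T := by
    intro S T hST hqS
    rw [mem_closure_iff_nhds] at hqS ⊢
    intro t ht
    obtain ⟨y, ⟨hy1, hy2⟩, hy3⟩ := hqS (t ∩ ball p ρ) (inter_mem ht (isOpen_ball.mem_nhds hq))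
    exact ⟨y, hy1, hST y hy2 hy3⟩
  constructor
  · refine key _ _ fun x hx hxS => ?_
    rwa [mem_setOf_eq, ← gr2_congr_open isOpen_ball h hx]
  · refine key _ _ fun x hx hxS => ?_
    rwa [mem_setOf_eq, gr2_congr_open isOpen_ball h hx]

lemma uc_domain {Ω : Set (EE n)} (hΩ : IsOpen Ω) (hcon : IsPreconnected Ω) {a f : ℝ → ℝ}
    (ha : C11Loc a)
    (hapos : ∀ t ≥ (0 : ℝ), 0 < a t) (hf : ContDiff ℝ 1 f)
    {u : EE n → ℝ} (hu : ContDiffOn ℝ 3 u Ω) (hsol : IsWeakSolution a f Ω u)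
    (hnc : ¬ ∃ c : ℝ, ∀ x ∈ Ω, u x = c) :
    ∀ p ∈ Ω, p ∈ closure {x | gr2 u x ≠ 0} := by
  set Z := closure {x : EE n | gr2 u x ≠ 0} with hZ
  have hne : ∃ x ∈ Ω, gr2 u x ≠ 0 := by
    by_contra hcon'
    push Not at hcon'
    apply hnc
    refine hΩ.exists_is_const_of_fderiv_eq_zero hcon (hu.differentiableOn (by norm_num))
      fun x hx => ?_
    have h0 := (gradient_eq_zero_iff u x).2 (hcon' x hx)
    have : (InnerProductSpace.toDual ℝ (EE n)).symm (fderiv ℝ u x) = 0 := h0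
    simpa using this
  set U1 := {q | q ∈ Ω ∧ q ∈ Z} with hU1
  have hU1o : IsOpen U1 := by
    rw [Metric.isOpen_iff]
    rintro p ⟨hp, hpZ⟩
    obtain ⟨w, hw, K, hK, ρ, hρ, hρs, hwu, hDI⟩ := local_model hΩ ha hapos hf hu hsol hp
    obtain ⟨r, hr, h⟩ := loc_uc hw hK hρ hDI
      ((closure_congr_ball hwu (mem_ball_self hρ)).2 hpZ)
    refine ⟨min r ρ, lt_min hr hρ, fun q hq => ?_⟩
    have hq1 : q ∈ ball p ρ := ball_subset_ball (min_le_right _ _) hq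
    have hq2 : q ∈ closedBall p r := ball_subset_closedBall (ball_subset_ball (min_le_left _ _) hq)
    exact ⟨hρs hq1, (closure_congr_ball hwu hq1).1 (h q hq2)⟩
  have hsub : Ω ⊆ U1 := by
    refine hcon.subset_left_of_subset_union hU1o (isClosed_closure (s := {x : EE n | gr2 u x ≠ 0})).isOpen_compl
      ?_ ?_ ?_
    · rw [Set.disjoint_left]
      rintro x ⟨_, hx⟩ hx2
      exact hx2 hx
    · intro x hx
      by_cases h : x ∈ Z
      · exact Or.inl ⟨hx, h⟩
      · exact Or.inr h
    · obtain ⟨x, hx, hx0⟩ := hne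
      exact ⟨x, hx, hx, subset_closure hx0⟩
  exact fun p hp => (hsub hp).2

/-- The Hausdorff-measure part of Lemma 5.1 of the paper: if `∂Ω₀ ⊆ ∂Ω ∪ crit(u)` then
`H^{n-1}(K ∩ ∂Ω₀) < ∞` for every compact `K ⊆ Ω`. -/
theorem hausdorff_measure_of_boundary_finite
    (n : ℕ) (Ω : Set (EuclideanSpace ℝ (Fin n)))
    (hΩ : IsCkDomain 1 Ω)
    (a : ℝ → ℝ) (ha : C11Loc a)
    (hapos : ∀ t ≥ (0 : ℝ), 0 < a t) (hlam : ∀ t ≥ (0 : ℝ), 0 < lam1 a t)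
    (f : ℝ → ℝ) (hf : ContDiff ℝ 1 f)
    (u : EuclideanSpace ℝ (Fin n) → ℝ) (hu3 : ContDiffOn ℝ 3 u Ω)
    (hnc : ¬ ∃ c : ℝ, ∀ x ∈ Ω, u x = c)
    (hsol : IsWeakSolution a f Ω u)
    (Ω₀ : Set (EuclideanSpace ℝ (Fin n))) (hΩ₀o : IsOpen Ω₀) (hΩ₀sub : Ω₀ ⊆ Ω)
    (hfr : frontier Ω₀ ⊆ frontier Ω ∪ {x ∈ Ω | gradient u x = 0}) :
    ∀ K : Set (EuclideanSpace ℝ (Fin n)), IsCompact K → K ⊆ Ω →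
      (μH[(n : ℝ) - 1] : Measure (EuclideanSpace ℝ (Fin n))) (K ∩ frontier Ω₀) < ⊤ := by
  intro K hK hKΩ
  obtain ⟨hne, hΩo, hΩc, -⟩ := hΩ
  have hn : 0 < n := by
    rcases Nat.eq_zero_or_pos n with h | h
    · subst h
      exact absurd ⟨u 0, fun x _ => by rw [Subsingleton.elim x 0]⟩ hnc
    · exact h
  have huc := uc_domain hΩo hΩc.isPreconnected ha hapos hf hu3 hsol hnc
  have hsub : K ∩ frontier Ω₀ ⊆ K ∩ {x | gr2 u x = 0} := by
    rintro x ⟨hxK, hxf⟩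
    refine ⟨hxK, ?_⟩
    rcases hfr hxf with h | h
    · rw [hΩo.frontier_eq] at h
      exact absurd (hKΩ hxK) h.2
    · exact (gradient_eq_zero_iff u x).1 h.2
  refine lt_of_le_of_lt (measure_mono hsub) ?_
  refine hK.induction_on
    (p := fun s => (μH[(n : ℝ) - 1] : Measure (EuclideanSpace ℝ (Fin n))) (s ∩ {x | gr2 u x = 0}) < ⊤)
    (by simp) ?_ ?_ ?_
  · intro s t hst ht
    exact lt_of_le_of_lt (measure_mono (inter_subset_inter_left _ hst)) ht
  · intro s t hs ht
    rw [union_inter_distrib_right]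
    exact lt_of_le_of_lt (measure_union_le _ _) (ENNReal.add_lt_top.2 ⟨hs, ht⟩)
  · intro p hp
    obtain ⟨w, hw, L, hL, ρ, hρ, hρs, hwu, hDI⟩ :=
      local_model hΩo ha hapos hf hu3 hsol (hKΩ hp)
    obtain ⟨r, hr, h⟩ := loc_fin hn hw hL hρ hDI
      ((closure_congr_ball hwu (mem_ball_self hρ)).2 (huc p (hKΩ hp)))
    refine ⟨ball p (min r ρ), mem_nhdsWithin_of_mem_nhds (ball_mem_nhds p (lt_min hr hρ)), ?_⟩
    refine lt_of_le_of_lt (measure_mono ?_) h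
    rintro x ⟨hx1, hx2⟩
    have hxρ : x ∈ ball p ρ := ball_subset_ball (min_le_right _ _) hx1
    exact ⟨(gr2_congr_open isOpen_ball hwu hxρ).trans hx2,
      ball_subset_closedBall (ball_subset_ball (min_le_left _ _) hx1)⟩
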